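/- Let K be a field, let q ∈ K have multiplicative order e with e ≥ 3 (e may be infinite), and let f be an integer with 0 ≤ f and 2f ≤ e. If n < e and n < 2f + 4 then the Iwahori–Hecke algebra H_q(B_n) has finite representation type. -/

import Mathlib

/-- A finite-dimensional right `A`-module, where `A` is a `K`-algebra.
Right modules are modules over the opposite ring `Aᵐᵒᵖ`. -/
structure FDRightModule (K A : Type) [Field K] [Ring A] [Algebra K A] : Type 1 where
  carrier : Type
  [isAddCommGroup : AddCommGroup carrier]
  [isModuleK : Module K carrier]
  [isModuleA : Module Aᵐᵒᵖ carrier]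
  [isTower : IsScalarTower K Aᵐᵒᵖ carrier]
  [isFinDim : FiniteDimensional K carrier]

attribute [instance] FDRightModule.isAddCommGroup FDRightModule.isModuleK
  FDRightModule.isModuleA FDRightModule.isTower FDRightModule.isFinDim

/-- A module is indecomposable if it is nonzero and is not the (internal) direct
sum of two nonzero submodules. -/
def IsIndecomposableModule (R M : Type*) [Ring R] [AddCommGroup M] [Module R M] : Prop :=
  Nontrivial M ∧ ∀ N₁ N₂ : Submodule R M, IsCompl N₁ N₂ → N₁ = ⊥ ∨ N₂ = ⊥

/-- A `K`-algebra `A` has finite representation type if there are only finitely many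
isomorphism classes of indecomposable finite-dimensional right `A`-modules. -/
def HasFiniteRepresentationType (K A : Type) [Field K] [Ring A] [Algebra K A] : Prop :=
  Finite (Quot fun M N : {M : FDRightModule K A // IsIndecomposableModule Aᵐᵒᵖ M.carrier} =>
    Nonempty (M.1.carrier ≃ₗ[Aᵐᵒᵖ] N.1.carrier))
/-- The multiplicative order of an element, valued in `ℕ∞`, with `⊤` for infinite order. -/
noncomputable def multOrder {M : Type*} [Monoid M] (x : M) : ℕ∞ :=
  if orderOf x = 0 then ⊤ else (orderOf x : ℕ∞)
/-- The defining relations of the Iwahori--Hecke algebra of type `Bₙ` with generators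
`T_0, …, T_{n-1}`, where `T_0` satisfies `(T_0 - α)(T_0 - β) = 0` and the other
generators satisfy `(T_i + 1)(T_i - q) = 0`. -/
inductive HeckeBRel (K : Type) [Field K] (α β q : K) (n : ℕ) :
    FreeAlgebra K (Fin n) → FreeAlgebra K (Fin n) → Prop
  | quad_zero (i : Fin n) (hi : (i : ℕ) = 0) :
      HeckeBRel K α β q n
        ((FreeAlgebra.ι K i - algebraMap K (FreeAlgebra K (Fin n)) α) *
          (FreeAlgebra.ι K i - algebraMap K (FreeAlgebra K (Fin n)) β)) 0
  | quad (i : Fin n) (hi : 0 < (i : ℕ)) :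
      HeckeBRel K α β q n
        ((FreeAlgebra.ι K i + 1) * (FreeAlgebra.ι K i - algebraMap K (FreeAlgebra K (Fin n)) q)) 0
  | braid_zero (i j : Fin n) (hi : (i : ℕ) = 0) (hj : (j : ℕ) = 1) :
      HeckeBRel K α β q n
        (FreeAlgebra.ι K i * FreeAlgebra.ι K j * FreeAlgebra.ι K i * FreeAlgebra.ι K j)
        (FreeAlgebra.ι K j * FreeAlgebra.ι K i * FreeAlgebra.ι K j * FreeAlgebra.ι K i)
  | braid (i j : Fin n) (hi : 0 < (i : ℕ)) (hij : (j : ℕ) = (i : ℕ) + 1) :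
      HeckeBRel K α β q n
        (FreeAlgebra.ι K j * FreeAlgebra.ι K i * FreeAlgebra.ι K j)
        (FreeAlgebra.ι K i * FreeAlgebra.ι K j * FreeAlgebra.ι K i)
  | comm (i j : Fin n) (hij : (i : ℕ) + 1 < (j : ℕ)) :
      HeckeBRel K α β q n (FreeAlgebra.ι K i * FreeAlgebra.ι K j)
        (FreeAlgebra.ι K j * FreeAlgebra.ι K i)

/-- The Iwahori--Hecke algebra of type `Bₙ`: the quotient of the free algebra on
`T_0, …, T_{n-1}` by the two-sided ideal generated by the defining relations, where
`T_0` satisfies `(T_0 - α)(T_0 - β) = 0`. -/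
abbrev HeckeB (K : Type) [Field K] (α β q : K) (n : ℕ) : Type := RingQuot (HeckeBRel K α β q n)

/-- A family `t 0, …, t (n-1)` in an algebra satisfying the relations of the Hecke algebra of
type `Bₙ`. -/
structure HeckeSystem {K R : Type*} [Field K] [Ring R] [Algebra K R] (α β q : K) (n : ℕ)
    (t : ℕ → R) : Prop where
  quad_zero : 0 < n → (t 0 - algebraMap K R α) * (t 0 - algebraMap K R β) = 0
  quad : ∀ i, 0 < i → i < n → (t i + 1) * (t i - algebraMap K R q) = 0
  braid_zero : 1 < n → t 0 * t 1 * t 0 * t 1 = t 1 * t 0 * t 1 * t 0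
  braid : ∀ i, 0 < i → i + 1 < n → t (i + 1) * t i * t (i + 1) = t i * t (i + 1) * t i
  comm : ∀ i j, i + 1 < j → j < n → t i * t j = t j * t i

/-- The Jucys-Murphy elements of a Hecke system of type `B`. -/
def jucysMurphy {K R : Type*} [Field K] [Ring R] [Algebra K R] (q : K) (t : ℕ → R) : ℕ → R
  | 0 => t 0
  | k + 1 => q⁻¹ • (t (k + 1) * jucysMurphy q t k * t (k + 1))

namespace HeckeSystem

variable {K R : Type*} [Field K] [Ring R] [Algebra K R] {α β q : K} {n : ℕ} {t : ℕ → R}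

local notation "x" => jucysMurphy q t

theorem mono (H : HeckeSystem α β q n t) {m : ℕ} (hm : m ≤ n) : HeckeSystem α β q m t where
  quad_zero h := H.quad_zero (by omega)
  quad i h h' := H.quad i h (by omega)
  braid_zero h := H.braid_zero (by omega)
  braid i h h' := H.braid i h (by omega)
  comm i j h h' := H.comm i j h (by omega)

theorem map {S : Type*} [Ring S] [Algebra K S] (H : HeckeSystem α β q n t) (φ : R →ₐ[K] S) :
    HeckeSystem α β q n (fun i => φ (t i)) where
  quad_zero h := by simpa using congrArg φ (H.quad_zero h)
  quad i h h' := by simpa using congrArg φ (H.quad i h h')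
  braid_zero h := by simpa using congrArg φ (H.braid_zero h)
  braid i h h' := by simpa using congrArg φ (H.braid i h h')
  comm i j h h' := by simpa using congrArg φ (H.comm i j h h')

theorem prod {S : Type*} [Ring S] [Algebra K S] {s : ℕ → S} (H : HeckeSystem α β q n t)
    (H' : HeckeSystem α β q n s) : HeckeSystem α β q n (fun i => (t i, s i)) where
  quad_zero h := Prod.ext (H.quad_zero h) (H'.quad_zero h)
  quad i h h' := Prod.ext (H.quad i h h') (H'.quad i h h')
  braid_zero h := Prod.ext (H.braid_zero h) (H'.braid_zero h)
  braid i h h' := Prod.ext (H.braid i h h') (H'.braid i h h')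
  comm i j h h' := Prod.ext (H.comm i j h h') (H'.comm i j h h')

theorem sq (H : HeckeSystem α β q n t) {i : ℕ} (hi : 0 < i) (hin : i < n) :
    t i * t i = (q - 1) • t i + q • 1 := by
  have := H.quad i hi hin
  simp only [Algebra.algebraMap_eq_smul_one, mul_sub, add_mul, one_mul, mul_smul_comm,
    mul_one] at this
  rw [← sub_eq_zero, ← this]; module

theorem sq_zero (H : HeckeSystem α β q n t) (hn : 0 < n) :
    t 0 * t 0 = (α + β) • t 0 - (α * β) • 1 := by
  have := H.quad_zero hn
  simp only [Algebra.algebraMap_eq_smul_one, mul_sub, sub_mul, one_mul, mul_smul_comm,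
    mul_one, smul_mul_assoc] at this
  rw [← sub_eq_zero, ← this]; module

theorem sq_mul (H : HeckeSystem α β q n t) {i : ℕ} (hi : 0 < i) (hin : i < n) (z : R) :
    t i * (t i * z) = (q - 1) • (t i * z) + q • z := by
  rw [← mul_assoc, H.sq hi hin]; simp [add_mul]

theorem jm_succ (k : ℕ) : x (k + 1) = q⁻¹ • (t (k + 1) * x k * t (k + 1)) := rfl

theorem commute_far (H : HeckeSystem α β q n t) {i j : ℕ} (h : i + 1 < j) (hj : j < n) :
    Commute (t i) (t j) := H.comm i j h hj

theorem commute_jm_high (H : HeckeSystem α β q n t) {k i : ℕ} (h : k + 1 < i) (hi : i < n) :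
    Commute (t i) (x k) := by
  induction k with
  | zero => exact (H.commute_far h hi).symm
  | succ k ih =>
    have h1 := (H.commute_far h hi).symm
    exact (((h1.mul_right (ih (by omega))).mul_right h1).smul_right _)

theorem commute_jm_low (H : HeckeSystem α β q n t) {i k : ℕ} (h : i < k) (hk : k < n) :
    Commute (t i) (x k) := by
  induction k with
  | zero => omega
  | succ k ih =>
    rcases Nat.lt_succ_iff_lt_or_eq.1 h with h | rfl
    · have h1 := H.commute_far (Nat.succ_lt_succ h) hk
      exact (((h1.mul_right (ih h (by omega))).mul_right h1).smul_right _)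
    · refine Commute.smul_right ?_ _
      cases i with
      | zero =>
        have := H.braid_zero hk
        simp only [Commute, SemiconjBy, jucysMurphy, zero_add, mul_assoc] at this ⊢
        exact this
      | succ j =>
        have hb := H.braid (j + 1) (by omega) hk
        have hx : Commute (t (j + 1 + 1)) (x j) := H.commute_jm_high (by omega) hk
        simp only [Commute, SemiconjBy, jucysMurphy, mul_smul_comm, smul_mul_assoc,
          mul_assoc] at hb hx ⊢
        congr 1
        rw [show t (j + 1) * (t (j + 1 + 1) * (t (j + 1) * (x j * (t (j + 1) * t (j + 1 + 1))))) =
          (t (j + 1) * (t (j + 1 + 1) * t (j + 1))) * (x j * (t (j + 1) * t (j + 1 + 1))) by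
          simp only [mul_assoc], ← hb]
        simp only [mul_assoc]
        rw [← mul_assoc (t (j + 1 + 1)) (x j), hx]
        simp only [mul_assoc]

theorem commute_of_lt_aux (H : HeckeSystem α β q n t) {j k : ℕ} (h : j < k) (hk : k < n) :
    Commute (x j) (x k) := by
  induction j with
  | zero => exact H.commute_jm_low h hk
  | succ j ih =>
    have h1 := H.commute_jm_low h hk
    exact (((h1.mul_left (ih (by omega))).mul_left h1).smul_left _)

theorem commute_jm (H : HeckeSystem α β q n t) {j k : ℕ} (hj : j < n) (hk : k < n) :
    Commute (x j) (x k) := by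
  rcases lt_trichotomy j k with h | rfl | h
  · exact H.commute_of_lt_aux h hk
  · exact Commute.refl _
  · exact (H.commute_of_lt_aux h hj).symm

theorem commute_gen_jm (H : HeckeSystem α β q n t) {i k : ℕ} (h1 : i ≠ k) (h2 : i ≠ k + 1)
    (hi : i < n) (hk : k < n) : Commute (t i) (x k) := by
  rcases lt_or_gt_of_ne h1 with h | h
  · exact H.commute_jm_low h hk
  · exact H.commute_jm_high (by omega) hi

theorem gen_mul_jm_succ (H : HeckeSystem α β q n t) (hq : q ≠ 0) {k : ℕ} (hk : k + 1 < n) :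
    t (k + 1) * x (k + 1) = x k * t (k + 1) + (q - 1) • x (k + 1) := by
  rw [jm_succ, mul_smul_comm, mul_assoc, H.sq_mul (by omega) hk, smul_add, smul_smul q⁻¹ q,
    inv_mul_cancel₀ hq, smul_comm q⁻¹]
  module

theorem jm_succ_mul_gen (H : HeckeSystem α β q n t) (hq : q ≠ 0) {k : ℕ} (hk : k + 1 < n) :
    x (k + 1) * t (k + 1) = t (k + 1) * x k + (q - 1) • x (k + 1) := by
  rw [jm_succ, smul_mul_assoc, mul_assoc, H.sq (by omega) hk, mul_add, mul_smul_comm,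
    mul_smul_comm, mul_one, smul_add, smul_smul q⁻¹ q,
    inv_mul_cancel₀ hq, smul_comm q⁻¹, mul_assoc]
  module

theorem gen_mul_jm (H : HeckeSystem α β q n t) (hq : q ≠ 0) {k : ℕ} (hk : k + 1 < n) :
    t (k + 1) * x k = x (k + 1) * t (k + 1) - (q - 1) • x (k + 1) := by
  rw [H.jm_succ_mul_gen hq hk]; module

theorem jm_mul_gen (H : HeckeSystem α β q n t) (hq : q ≠ 0) {k : ℕ} (hk : k + 1 < n) :
    x k * t (k + 1) = t (k + 1) * x (k + 1) - (q - 1) • x (k + 1) := by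
  rw [H.gen_mul_jm_succ hq hk]; module

end HeckeSystem

/-- The relative trace from the centralizer of `t 0, …, t (n-2)` to the centralizer of
`t 0, …, t (n-1)`, expressed through Jucys-Murphy elements. -/
def jmTrace {K R : Type*} [Field K] [Ring R] [Algebra K R] (α β q : K) (t : ℕ → R) :
    ℕ → R →ₗ[K] R
  | 0 => 0
  | n + 1 => LinearMap.id
      - (α * β)⁻¹ • LinearMap.mulLeftRight K (jucysMurphy q t n, jucysMurphy q t n)
      + jmTrace α β q t n ∘ₗ (q⁻¹ • LinearMap.mulLeftRight K (t n, t n))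

namespace HeckeSystem

variable {K R : Type*} [Field K] [Ring R] [Algebra K R] {α β q : K} {n : ℕ} {t : ℕ → R}

local notation "x" => jucysMurphy q t
local notation "tr" => jmTrace α β q t

theorem jmTrace_zero (h : R) : tr 0 h = 0 := rfl

theorem jmTrace_succ (n : ℕ) (h : R) : tr (n + 1) h =
    h - (α * β)⁻¹ • (x n * h * x n) + tr n (q⁻¹ • (t n * h * t n)) := by
  simp [jmTrace, LinearMap.mulLeftRight_apply]

theorem commute_jm_of_commute {u : R} (hu : ∀ i < n, Commute u (t i)) :
    ∀ k < n, Commute u (x k) := by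
  intro k
  induction k with
  | zero => exact hu 0
  | succ k ih =>
    intro hk
    exact (((hu _ hk).mul_right (ih (by omega))).mul_right (hu _ hk)).smul_right _

theorem commute_jmTrace {u : R} (hu : ∀ i < n, Commute u (t i)) {h : R} (hh : Commute u h) :
    Commute u (tr n h) := by
  induction n generalizing h with
  | zero => exact Commute.zero_right _
  | succ n ih =>
    rw [jmTrace_succ]
    have hx := commute_jm_of_commute (q := q) hu n (by omega)
    have ht := hu n (by omega)
    exact (hh.sub_right (((hx.mul_right hh).mul_right hx).smul_right _)).add_right
      (ih (fun i hi => hu i (by omega)) (((ht.mul_right hh).mul_right ht).smul_right _))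

theorem jmTrace_mul_left {u : R} (hu : ∀ i < n, Commute u (t i)) (h : R) :
    tr n (u * h) = u * tr n h := by
  induction n generalizing h with
  | zero => simp [jmTrace_zero]
  | succ n ih =>
    have hx := commute_jm_of_commute (q := q) hu n (by omega)
    have ht := hu n (by omega)
    have e1 (y : R) (hy : Commute u y) : y * (u * h) * y = u * (y * h * y) := by
      rw [← mul_assoc, ← hy.eq]; simp only [mul_assoc]
    rw [jmTrace_succ, jmTrace_succ, e1 _ hx, e1 _ ht, ← mul_smul_comm q⁻¹,
      ih (fun i hi => hu i (by omega))]
    simp only [mul_add, mul_sub, mul_smul_comm]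

theorem commute_pair (H : HeckeSystem α β q n t) (hq : q ≠ 0) {i : ℕ} (hi : 0 < i) (hin : i < n)
    (y : R) : Commute (t i) (y + q⁻¹ • (t i * y * t i)) := by
  simp only [Commute, SemiconjBy, mul_add, add_mul, mul_smul_comm, smul_mul_assoc, mul_assoc,
    H.sq hi hin, mul_one]
  rw [H.sq_mul hi hin]
  simp only [smul_add, smul_smul, inv_mul_cancel₀ hq]
  module

theorem commute_jmTrace_gen (H : HeckeSystem α β q n t) (hq : q ≠ 0) (hα : α * β ≠ 0) {h : R}
    (hh : ∀ i, i + 1 < n → Commute (t i) h) : ∀ i < n, Commute (t i) (tr n h) := by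
  induction n generalizing h with
  | zero => intro i hi; omega
  | succ n ih =>
    intro i hi
    cases n with
    | zero =>
      obtain rfl : i = 0 := by omega
      rw [jmTrace_succ, jmTrace_zero, add_zero]
      simp only [Commute, SemiconjBy, mul_sub, sub_mul, mul_smul_comm, smul_mul_assoc,
        jucysMurphy, mul_assoc, H.sq_zero hi]
      rw [← mul_assoc (t 0) (t 0), H.sq_zero hi]
      simp only [sub_mul, smul_mul_assoc, one_mul, smul_sub, smul_smul, inv_mul_cancel₀ hα, mul_one]
      module
    | succ n =>
      have hn : n + 1 < n + 2 := by omega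
      rcases Nat.lt_succ_iff_lt_or_eq.1 hi with hlt | rfl
      · rw [jmTrace_succ]
        have h1 := hh i (by omega)
        have h2 := H.commute_jm_low hlt hn
        refine (h1.sub_right (((h2.mul_right h1).mul_right h2).smul_right _)).add_right ?_
        refine ih (H.mono (by omega)) (fun j hj => ?_) i hlt
        have h3 := H.commute_far hj hn
        exact ((h3.mul_right (hh j (by omega))).mul_right h3).smul_right _
      · rw [jmTrace_succ, jmTrace_succ]
        set h' := q⁻¹ • (t (n + 1) * h * t (n + 1)) with h'_def
        have e : h - (α * β)⁻¹ • (x (n + 1) * h * x (n + 1)) +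
            (h' - (α * β)⁻¹ • (x n * h' * x n) + tr n (q⁻¹ • (t n * h' * t n))) =
          (h + h') - (α * β)⁻¹ • (x n * h' * x n + q⁻¹ • (t (n + 1) * (x n * h' * x n) * t (n + 1)))
            + tr n (q⁻¹ • (t n * h' * t n)) := by
          have : x (n + 1) * h * x (n + 1) = q⁻¹ • (t (n + 1) * (x n * h' * x n) * t (n + 1)) := by
            simp only [h'_def, jm_succ, mul_smul_comm, smul_mul_assoc, mul_assoc]
          rw [this]; module
        rw [e]
        refine ((H.commute_pair hq (by omega) hn h).sub_right
          ((H.commute_pair hq (by omega) hn _).smul_right _)).add_right ?_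
        cases n with
        | zero => exact Commute.zero_right _
        | succ m =>
          refine commute_jmTrace (fun i hi => (H.commute_far (by omega) hn).symm) ?_
          refine Commute.smul_right ?_ _
          have hc : Commute (t (m + 1)) h := hh _ (by omega)
          have hb := H.braid (m + 1) (by omega) hn
          simp only [h'_def, mul_smul_comm, smul_mul_assoc]
          refine Commute.smul_right ?_ _
          simp only [Commute, SemiconjBy, mul_assoc] at hb hc ⊢
          have hb' (z : R) : t (m + 1 + 1) * (t (m + 1) * (t (m + 1 + 1) * z)) =
              t (m + 1) * (t (m + 1 + 1) * (t (m + 1) * z)) := by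
            simpa only [mul_assoc] using congrArg (· * z) hb
          rw [hb', hb, ← mul_assoc (t (m + 1)) h, hc, mul_assoc]

end HeckeSystem

namespace HeckeSystem

variable {K R : Type*} [Field K] [Ring R] [Algebra K R] {α β q : K} {n : ℕ} {t : ℕ → R}

local notation "x" => jucysMurphy q t
local notation "tr" => jmTrace α β q t

theorem jmTrace_mul_right {u : R} (hu : ∀ i < n, Commute u (t i)) (h : R) :
    tr n (h * u) = tr n h * u := by
  induction n generalizing h with
  | zero => simp [jmTrace_zero]
  | succ n ih =>
    have hx := commute_jm_of_commute (q := q) hu n (by omega)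
    have ht := hu n (by omega)
    have e1 (y : R) (hy : Commute u y) : y * (h * u) * y = y * h * y * u := by
      simp only [mul_assoc, hy.eq]
    rw [jmTrace_succ, jmTrace_succ, e1 _ hx, e1 _ ht, ← smul_mul_assoc q⁻¹,
      ih (fun i hi => hu i (by omega))]
    simp only [add_mul, sub_mul, smul_mul_assoc]

/-- Resolvents `J k = (1 - w x k)⁻¹` of the Jucys-Murphy elements at a central parameter `w`. -/
structure IsResolvent (q : K) (t : ℕ → R) (w : R) (J : ℕ → R) : Prop where
  central : ∀ z, Commute w z
  eq : ∀ k, J k = 1 + w * (jucysMurphy q t k * J k)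
  commute : ∀ k z, Commute z (jucysMurphy q t k) → Commute z (J k)

/-- The trace of the resolvent of the last Jucys-Murphy element. -/
def resolventTrace (α β q : K) (t J : ℕ → R) : ℕ → R
  | 0 => 0
  | n + 1 => jmTrace α β q t (n + 1) (J n)

/-- The trace of the resolvent of the last Jucys-Murphy element times the next generator. -/
def resolventGenTrace (α β q : K) (t J : ℕ → R) : ℕ → R
  | 0 => 0
  | n + 1 => jmTrace α β q t (n + 1) (J n * t (n + 1))

/-- The generating function `(1-αw)(1-βw) ∏ (1 - q w x_k) (1 - q⁻¹ w x_k) / (1 - w x_k)²`. -/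
def centralSeries (α β q : K) (t J : ℕ → R) (w : R) : ℕ → R
  | 0 => (1 - α • w) * (1 - β • w)
  | n + 1 => centralSeries α β q t J w n *
      (1 - (q + q⁻¹ - 2) • (w * (jucysMurphy q t n * (J n * J n))))

namespace IsResolvent

variable {w : R} {J : ℕ → R}

theorem commute_gen (hJ : IsResolvent q t w J) (H : HeckeSystem α β q n t) {i k : ℕ}
    (h1 : i ≠ k) (h2 : i ≠ k + 1) (hi : i < n) (hk : k < n) : Commute (t i) (J k) :=
  hJ.commute _ _ (H.commute_gen_jm h1 h2 hi hk)

theorem commute_jm (hJ : IsResolvent q t w J) (H : HeckeSystem α β q n t) {i k : ℕ}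
    (hi : i < n) (hk : k < n) : Commute (x i) (J k) :=
  hJ.commute _ _ (H.commute_jm hi hk)

theorem commute_self (hJ : IsResolvent q t w J) (H : HeckeSystem α β q n t) {i k : ℕ}
    (hi : i < n) (hk : k < n) : Commute (J i) (J k) :=
  hJ.commute _ _ (hJ.commute_jm H hk hi).symm

theorem mul_sub (hJ : IsResolvent q t w J) (k : ℕ) : J k * (1 - w * x k) = 1 := by
  have h1 := hJ.eq k
  have h2 := hJ.commute k (x k) (Commute.refl _)
  rw [_root_.mul_sub, mul_one, ← mul_assoc, ← (hJ.central (J k)).eq, mul_assoc, ← h2.eq]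
  nth_rewrite 1 [h1]; abel

theorem sub_mul (hJ : IsResolvent q t w J) (k : ℕ) : (1 - w * x k) * J k = 1 := by
  rw [_root_.sub_mul, one_mul, mul_assoc]
  nth_rewrite 1 [hJ.eq k]; abel

theorem param_mul (hJ : IsResolvent q t w J) (k : ℕ) : w * (x k * J k) = J k - 1 := by
  nth_rewrite 2 [hJ.eq k]; abel

theorem gen_mul (hJ : IsResolvent q t w J) (H : HeckeSystem α β q n t) (hq : q ≠ 0) {k : ℕ}
    (hk : k + 1 < n) :
    t (k + 1) * J k = J (k + 1) * t (k + 1) - (q - 1) • (J (k + 1) * (w * (x (k + 1) * J k))) := by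
  have h : (1 - w * x (k + 1)) * t (k + 1) =
      t (k + 1) * (1 - w * x k) - (q - 1) • (w * x (k + 1)) := by
    rw [_root_.sub_mul, mul_assoc, H.jm_succ_mul_gen hq hk, _root_.mul_sub, ← mul_assoc (t _),
      ← (hJ.central (t (k + 1))).eq, mul_add, mul_smul_comm, mul_assoc]
    simp only [one_mul, mul_one]; abel
  have h2 := congrArg (fun z => J (k + 1) * z * J k) h
  simp only [← mul_assoc, hJ.mul_sub] at h2
  rw [one_mul, _root_.mul_sub, _root_.sub_mul, ← mul_assoc, mul_assoc _ (1 - w * x k), hJ.sub_mul,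
    mul_one] at h2
  rw [h2]
  simp only [mul_smul_comm, smul_mul_assoc, mul_assoc]

theorem gen_mul' (hJ : IsResolvent q t w J) (H : HeckeSystem α β q n t) (hq : q ≠ 0) {k : ℕ}
    (hk : k + 1 < n) :
    t (k + 1) * J (k + 1) =
      J k * t (k + 1) + (q - 1) • (J k * (w * (x (k + 1) * J (k + 1)))) := by
  have h : (1 - w * x k) * t (k + 1) =
      t (k + 1) * (1 - w * x (k + 1)) + (q - 1) • (w * x (k + 1)) := by
    rw [_root_.sub_mul, mul_assoc, H.jm_mul_gen hq hk, _root_.mul_sub w, _root_.mul_sub (t _), ← mul_assoc (t _),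
      ← (hJ.central (t (k + 1))).eq, mul_smul_comm, mul_assoc]
    simp only [one_mul, mul_one]; abel
  have h2 := congrArg (fun z => J k * z * J (k + 1)) h
  simp only [← mul_assoc, hJ.mul_sub] at h2
  rw [one_mul, mul_add, add_mul, ← mul_assoc, mul_assoc _ (1 - w * x (k + 1)), hJ.sub_mul,
    mul_one] at h2
  rw [h2]
  simp only [mul_smul_comm, smul_mul_assoc, mul_assoc]

theorem resolventGenTrace_succ (hJ : IsResolvent q t w J) (H : HeckeSystem α β q n t)
    (hq : q ≠ 0) {k : ℕ} (hk : k + 1 < n) :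
    resolventGenTrace α β q t J (k + 1) = J k * t (k + 1)
      - (α * β)⁻¹ • (x k * (J k * t (k + 1)) * x k)
      + (q⁻¹ • (t (k + 1) * resolventGenTrace α β q t J k * t (k + 1))
        + (1 - q⁻¹) • (w * (x k * J k) * t (k + 1) * resolventGenTrace α β q t J k)) := by
  rw [resolventGenTrace, jmTrace_succ]
  congr 1
  cases k with
  | zero => simp [resolventGenTrace, jmTrace_zero]
  | succ k =>
    rw [resolventGenTrace]
    have c1 : Commute (t (k + 1 + 1)) (J k) := hJ.commute_gen H (by omega) (by omega) hk (by omega)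
    have c2 : Commute (x (k + 1)) (J k) := hJ.commute_jm H (by omega) (by omega)
    have c3 : Commute (J (k + 1)) (J k) := hJ.commute_self H (by omega) (by omega)
    have hu1 : ∀ i < k + 1, Commute (t (k + 1 + 1)) (t i) :=
      fun i hi => (H.commute_far (by omega) hk).symm
    have hu2 : ∀ i < k + 1, Commute (w * (x (k + 1) * J (k + 1))) (t i) := fun i hi =>
      have h := H.commute_jm_low hi (by omega)
      ((hJ.central _).symm.mul_right (h.mul_right (hJ.commute _ _ h))).symm
    have e : q⁻¹ • (t (k + 1) * (J (k + 1) * t (k + 1 + 1)) * t (k + 1)) =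
        q⁻¹ • (t (k + 1 + 1) * ((J k * t (k + 1)) * t (k + 1 + 1))) +
        (1 - q⁻¹) • (w * (x (k + 1) * J (k + 1)) * (t (k + 1 + 1) * (J k * t (k + 1)))) := by
      have hb := H.braid (k + 1) (by omega) hk
      rw [← mul_assoc (t (k + 1)), hJ.gen_mul' H hq (by omega), add_mul, add_mul, smul_add]
      congr 1
      · rw [mul_assoc, mul_assoc, ← mul_assoc (t (k + 1)), ← hb, mul_assoc, mul_assoc,
          ← mul_assoc (t _) (J k), c1.eq, mul_assoc]
      · rw [smul_mul_assoc, smul_mul_assoc, smul_smul, _root_.mul_sub, mul_one,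
          inv_mul_cancel₀ hq]
        congr 1
        have c4 : Commute (w * (x (k + 1) * J (k + 1))) (J k) :=
          (hJ.central _).mul_left (c2.mul_left c3)
        rw [← c4.eq, ← mul_assoc (t (k + 1 + 1)), c1.eq]
        simp only [mul_assoc]
    rw [e, map_add, map_smul, map_smul, jmTrace_mul_left hu1, jmTrace_mul_right hu1,
      jmTrace_mul_left hu2, jmTrace_mul_left hu1]
    simp only [mul_assoc]

theorem resolventTrace_succ (hJ : IsResolvent q t w J) (H : HeckeSystem α β q n t)
    (hq : q ≠ 0) {k : ℕ} (hk : k < n) :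
    resolventTrace α β q t J (k + 1) = J k - (α * β)⁻¹ • (x k * J k * x k)
      + (resolventTrace α β q t J k + (1 - q⁻¹) • (J k * resolventGenTrace α β q t J k)) := by
  rw [resolventTrace, jmTrace_succ]
  congr 1
  cases k with
  | zero => simp [resolventGenTrace, jmTrace_zero, resolventTrace]
  | succ k =>
    rw [resolventGenTrace, resolventTrace]
    have c2 : Commute (x (k + 1)) (J k) := hJ.commute_jm H hk (by omega)
    have c3 : Commute (J (k + 1)) (J k) := hJ.commute_self H hk (by omega)
    have hu2 : ∀ i < k + 1, Commute (J (k + 1)) (t i) := fun i hi =>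
      (hJ.commute _ _ (H.commute_jm_low hi (by omega))).symm
    have e : q⁻¹ • (t (k + 1) * J (k + 1) * t (k + 1)) =
        J k + (1 - q⁻¹) • (J (k + 1) * (J k * t (k + 1))) := by
      have c4 : Commute (w * (x (k + 1) * J (k + 1))) (J k) :=
        (hJ.central _).mul_left (c2.mul_left c3)
      rw [hJ.gen_mul' H hq hk, ← c4.eq, add_mul, mul_assoc, H.sq (by omega) hk,
        ← mul_assoc (J _)]
      rw [hJ.param_mul, _root_.sub_mul, c3.eq]
      simp only [mul_add, smul_add, smul_smul, mul_smul_comm, mul_one, smul_mul_assoc,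
        inv_mul_cancel₀ hq, one_smul, mul_assoc, one_mul]
      simp only [_root_.sub_mul, smul_sub, _root_.mul_sub, inv_mul_cancel₀ hq, mul_assoc]
      module
    rw [e, map_add, map_smul, jmTrace_mul_left hu2]

theorem commute_centralSeries (hJ : IsResolvent q t w J) {z : R} {k : ℕ}
    (hz : ∀ i < k, Commute z (x i)) : Commute z (centralSeries α β q t J w k) := by
  have hw := (hJ.central z).symm
  induction k with
  | zero =>
    exact ((Commute.one_right z).sub_right (hw.smul_right _)).mul_right
      ((Commute.one_right z).sub_right (hw.smul_right _))
  | succ k ih =>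
    have h1 := hz k (by omega)
    have h2 := hJ.commute k z h1
    exact (ih fun i hi => hz i (by omega)).mul_right ((Commute.one_right z).sub_right
      ((hw.mul_right (h1.mul_right (h2.mul_right h2))).smul_right _))

theorem gen_mul_jm_mul (hJ : IsResolvent q t w J) (H : HeckeSystem α β q n t)
    (hq : q ≠ 0) {k : ℕ} (hk : k + 1 < n) :
    t (k + 1) * (x k * J k) =
      x (k + 1) * J (k + 1) * t (k + 1) - (q - 1) • (x (k + 1) * J (k + 1) * J k) := by
  have ca : Commute (x k) (J k) := hJ.commute _ _ (Commute.refl _)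
  have cb : Commute (x (k + 1)) (J (k + 1)) := hJ.commute _ _ (Commute.refl _)
  rw [ca.eq, ← mul_assoc, hJ.gen_mul H hq hk, _root_.sub_mul, mul_assoc, H.gen_mul_jm hq hk,
    _root_.mul_sub, cb.eq, smul_mul_assoc, mul_smul_comm, ← mul_assoc, sub_sub, ← smul_add]
  congr 2
  have : J (k + 1) * (w * (x (k + 1) * J k)) * x k = J (k + 1) * x (k + 1) * (w * (x k * J k)) := by
    have h1 : w * (x (k + 1) * J k) = x (k + 1) * (w * J k) := by
      rw [← mul_assoc, (hJ.central (x (k + 1))).eq, mul_assoc]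
    rw [h1, ca.eq]
    simp only [mul_assoc]
  rw [this, hJ.param_mul, _root_.mul_sub]
  simp only [mul_one]; abel

theorem gen_resolvent_identity (hJ : IsResolvent q t w J) (H : HeckeSystem α β q n t)
    (hq : q ≠ 0) {k : ℕ} (hk : k + 1 < n) :
    q⁻¹ • (t (k + 1) * (x k * J k) * t (k + 1)) +
      (1 - q⁻¹) • ((J k - 1) * (t (k + 1) * (x k * J k))) =
    x (k + 1) * J (k + 1) * (1 - (q + q⁻¹ - 2) • (w * (x k * (J k * J k)))) := by
  have c1 : Commute (J k) (x (k + 1) * J (k + 1)) :=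
    (hJ.commute_jm H hk (by omega)).symm.mul_right (hJ.commute_self H (by omega) hk)
  rw [hJ.gen_mul_jm_mul H hq hk, ← mul_assoc (x k), ← mul_assoc w, hJ.param_mul]
  generalize x (k + 1) * J (k + 1) = z at c1
  simp only [_root_.sub_mul, _root_.mul_sub, mul_smul_comm, smul_mul_assoc, mul_assoc,
    H.sq (Nat.succ_pos k) hk, one_mul, mul_add, mul_one]
  rw [← mul_assoc (J k) z, ← mul_assoc (J k) z, c1.eq]
  simp only [smul_sub, smul_add, smul_smul, inv_mul_cancel₀ hq, _root_.mul_sub, _root_.sub_mul,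
    mul_assoc]
  match_scalars <;> field_simp <;> ring

theorem smul_resolventGenTrace (hJ : IsResolvent q t w J) (H : HeckeSystem α β q n t)
    (hq : q ≠ 0) (hα : α * β ≠ 0) {k : ℕ} (hk : k < n) :
    (α * β * (1 - q⁻¹)) • (w * resolventGenTrace α β q t J k) =
      x k - (α * β) • w - x k * J k * centralSeries α β q t J w k := by
  induction k with
  | zero =>
    have h0 : x 0 * J 0 * centralSeries α β q t J w 0 = x 0 - (α * β) • w := by
      have h1 : x 0 * centralSeries α β q t J w 0 = (x 0 - (α * β) • w) * (1 - w * x 0) := by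
        have := H.sq_zero (by omega)
        simp only [centralSeries, jucysMurphy, _root_.mul_sub, _root_.sub_mul, mul_one, one_mul,
          mul_smul_comm, smul_mul_assoc, ← mul_assoc, ← (hJ.central (t 0)).eq]
        simp only [mul_assoc, this, ← (hJ.central (t 0)).eq]
        simp only [_root_.mul_sub, mul_smul_comm, mul_one]
        module
      have c := hJ.commute_centralSeries (α := α) (β := β) (k := 0) (z := J 0) (by simp)
      rw [mul_assoc, c.eq, ← mul_assoc, h1, mul_assoc, hJ.sub_mul, mul_one]
    rw [h0, resolventGenTrace]; simp
  | succ k ih =>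
    have ih := ih (by omega)
    have hid := hJ.gen_resolvent_identity H hq hk
    have c1 : Commute (t (k + 1)) (centralSeries α β q t J w k) :=
      hJ.commute_centralSeries fun i hi => H.commute_jm_high (by omega) hk
    set L := resolventGenTrace α β q t J k
    set φ := centralSeries α β q t J w k
    have c2 := hJ.commute_centralSeries (α := α) (β := β) (k := k)
      (z := 1 - (q + q⁻¹ - 2) • (w * (x k * (J k * J k)))) (fun i hi => by
        have h1 := H.commute_jm (show k < n by omega) (show i < n by omega)
        have h2 := hJ.commute_jm H (show i < n by omega) (show k < n by omega)
        exact ((Commute.one_left _).sub_left (((hJ.central _).mul_left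
          (h1.mul_left (h2.symm.mul_left h2.symm))).smul_left _)))
    have hR : x (k + 1) * J (k + 1) * centralSeries α β q t J w (k + 1) =
        (q⁻¹ • (t (k + 1) * (x k * J k) * t (k + 1)) +
      (1 - q⁻¹) • ((J k - 1) * (t (k + 1) * (x k * J k)))) * φ := by
      rw [hid, centralSeries, ← c2.eq, mul_assoc, mul_assoc, mul_assoc]
    have hb : x (k + 1) = q⁻¹ • (t (k + 1) * x k * t (k + 1)) := rfl
    have e1 : (α * β * (1 - q⁻¹)) • (w * (t (k + 1) * L * t (k + 1))) =
        t (k + 1) * (x k - (α * β) • w - x k * J k * φ) * t (k + 1) := by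
      rw [← ih, mul_smul_comm, smul_mul_assoc]
      congr 1
      simp only [← mul_assoc, (hJ.central (t (k + 1))).eq]
    have e2 : (α * β * (1 - q⁻¹)) • (w * (w * (x k * J k) * t (k + 1) * L)) =
        (J k - 1) * (t (k + 1) * (x k - (α * β) • w - x k * J k * φ)) := by
      rw [← ih, mul_smul_comm, mul_smul_comm, hJ.param_mul]
      congr 1
      simp only [← mul_assoc, (hJ.central (J k - 1)).eq]
      rw [mul_assoc _ w, (hJ.central (t (k + 1))).eq]
      simp only [mul_assoc]
    have e3 : w * (x k * (J k * t (k + 1)) * x k) = (J k - 1) * (t (k + 1) * x k) := by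
      rw [← hJ.param_mul]; simp only [mul_assoc]
    have e4 : t (k + 1) * w = w * t (k + 1) := ((hJ.central _).eq).symm
    have e6 (z : R) : J k * (w * z) = w * (J k * z) := by
      rw [← mul_assoc, ← (hJ.central (J k)).eq, mul_assoc]
    rw [hR, hJ.resolventGenTrace_succ H hq hk, mul_add, mul_add, _root_.mul_sub w, mul_smul_comm,
      mul_smul_comm, mul_smul_comm, smul_add, smul_add, smul_comm _ q⁻¹, smul_comm _ (1 - q⁻¹),
      e1, e2, e3, hb]
    simp only [_root_.sub_mul, _root_.mul_sub, mul_smul_comm, smul_mul_assoc, mul_assoc, add_mul,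
      one_mul, e4, e6, ← c1.eq, H.sq (Nat.succ_pos k) hk, mul_add, mul_one]
    obtain ⟨hα0, hβ0⟩ := mul_ne_zero_iff.1 hα
    match_scalars <;> field_simp <;> ring

theorem smul_resolventTrace (hJ : IsResolvent q t w J) (H : HeckeSystem α β q n t)
    (hq : q ≠ 0) (hα : α * β ≠ 0) {k : ℕ} (hk : k ≤ n) :
    (α * β * (q + q⁻¹ - 2)) • (w * (w * resolventTrace α β q t J k)) =
      (q + q⁻¹ - 2) • (w * ∑ i ∈ Finset.range k, x i) + centralSeries α β q t J w k
        - centralSeries α β q t J w 0 := by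
  induction k with
  | zero => simp [resolventTrace]
  | succ k ih =>
    have h1 := hJ.smul_resolventGenTrace H hq hα (k := k) (by omega)
    have hφ : Commute (x k * (J k * J k)) (centralSeries α β q t J w k) :=
      hJ.commute_centralSeries fun i hi => by
        have h1 := H.commute_jm (show k < n by omega) (show i < n by omega)
        have h2 := hJ.commute_jm H (show i < n by omega) (show k < n by omega)
        exact h1.mul_left (h2.symm.mul_left h2.symm)
    have ca : Commute (x k) (J k) := hJ.commute _ _ (Commute.refl _)
    have e6 (z : R) : J k * (w * z) = w * (J k * z) := by
      rw [← mul_assoc, ← (hJ.central (J k)).eq, mul_assoc]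
    have h2 : (α * β * (1 - q⁻¹)) • (w * (J k * resolventGenTrace α β q t J k)) =
        J k * x k - (α * β) • (w * J k)
          - x k * (J k * J k) * centralSeries α β q t J w k := by
      rw [← e6, ← mul_smul_comm, h1, _root_.mul_sub, _root_.mul_sub, mul_smul_comm,
        ← (hJ.central (J k)).eq, ← mul_assoc, ← mul_assoc (J k), ← ca.eq, mul_assoc (x k)]
    have h3 : w * (x k * J k * x k) = J k * x k - x k := by
      rw [← mul_assoc, hJ.param_mul, _root_.sub_mul, one_mul]
    have h4 : (α * β) • (w * resolventTrace α β q t J (k + 1)) =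
        (α * β) • (w * resolventTrace α β q t J k) + x k
          - x k * (J k * J k) * centralSeries α β q t J w k := by
      rw [hJ.resolventTrace_succ H hq (by omega), mul_add, mul_add, _root_.mul_sub w,
        mul_smul_comm, mul_smul_comm, h3, smul_add, smul_add, smul_smul _ (1 - q⁻¹), h2, smul_sub,
        smul_smul _ (α * β)⁻¹, mul_inv_cancel₀ hα]
      module
    have h5 : (α * β * (q + q⁻¹ - 2)) • (w * (w * resolventTrace α β q t J (k + 1))) =
        (q + q⁻¹ - 2) • (w * ((α * β) • (w * resolventTrace α β q t J (k + 1)))) := by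
      rw [mul_smul_comm, smul_smul, mul_comm (α * β)]
    rw [h5, h4, _root_.mul_sub w, mul_add w, mul_smul_comm, smul_sub, smul_add, smul_smul,
      mul_comm _ (α * β), ih (by omega), Finset.sum_range_succ, mul_add w, hφ.eq,
      centralSeries.eq_def α β q t J w (k + 1)]
    simp only [_root_.mul_sub, mul_smul_comm, mul_one]
    rw [← mul_assoc w, (hJ.central (centralSeries α β q t J w k)).eq, mul_assoc]
    module

end IsResolvent
end HeckeSystem

/-- The intertwiner `t (k+1) (x (k+1) - x k) - (q - 1) x (k+1)` between the Jucys-Murphy elements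
`x k` and `x (k+1)`. -/
def intertwiner {K R : Type*} [Field K] [Ring R] [Algebra K R] (q : K) (t : ℕ → R) (k : ℕ) : R :=
  t (k + 1) * (jucysMurphy q t (k + 1) - jucysMurphy q t k) - (q - 1) • jucysMurphy q t (k + 1)

namespace HeckeSystem

section Ring

variable {K R : Type*} [Field K] [Ring R] [Algebra K R] {α β q : K} {n : ℕ} {t : ℕ → R}

local notation "x" => jucysMurphy q t
local notation "τ" => intertwiner q t

theorem intertwiner_mul_jm_succ (H : HeckeSystem α β q n t) (hq : q ≠ 0) {k : ℕ}
    (hk : k + 1 < n) : τ k * x (k + 1) = x k * τ k := by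
  have c := H.commute_jm (show k < n by omega) hk
  simp only [intertwiner, sub_mul, mul_sub, smul_mul_assoc, mul_smul_comm, mul_assoc, c.eq]
  simp only [← mul_assoc, H.jm_mul_gen hq hk, sub_mul, smul_mul_assoc]
  simp only [mul_assoc]
  module

theorem intertwiner_mul_jm (H : HeckeSystem α β q n t) (hq : q ≠ 0) {k : ℕ}
    (hk : k + 1 < n) : τ k * x k = x (k + 1) * τ k := by
  have c := H.commute_jm (show k < n by omega) hk
  simp only [intertwiner, sub_mul, mul_sub, smul_mul_assoc, mul_smul_comm, mul_assoc]
  simp only [← mul_assoc, H.jm_succ_mul_gen hq hk, add_mul, smul_mul_assoc]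
  simp only [mul_assoc, c.eq]
  module

theorem intertwiner_sq (H : HeckeSystem α β q n t) (hq : q ≠ 0) {k : ℕ}
    (hk : k + 1 < n) : τ k * τ k = (q • x (k + 1) - x k) * (q • x k - x (k + 1)) := by
  have c := H.commute_jm (show k < n by omega) hk
  have e : τ k * τ k = t (k + 1) * τ k * (x k - x (k + 1)) - (q - 1) • (τ k * x k) := by
    nth_rewrite 1 [intertwiner]
    rw [sub_mul, mul_assoc, sub_mul (x (k + 1)), ← H.intertwiner_mul_jm hq hk,
      ← H.intertwiner_mul_jm_succ hq hk, ← mul_sub, ← mul_assoc, smul_mul_assoc,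
      ← H.intertwiner_mul_jm hq hk]
  rw [e]
  simp only [intertwiner, sub_mul, mul_sub, smul_mul_assoc, mul_smul_comm, mul_assoc, c.eq,
    H.sq_mul (show 0 < k + 1 by omega) hk, add_mul]
  module

theorem intertwiner_commute {k : ℕ} {z : R}
    (h1 : Commute z (t (k + 1))) (h2 : Commute z (x k)) : Commute z (τ k) := by
  have h3 : Commute z (x (k + 1)) := ((h1.mul_right h2).mul_right h1).smul_right _
  exact (h1.mul_right (h3.sub_right h2)).sub_right (h3.smul_right _)

theorem commute_jm_intertwiner (H : HeckeSystem α β q n t) {j k : ℕ} (hk : k + 1 < n) (hj : j < n)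
    (h1 : j ≠ k) (h2 : j ≠ k + 1) : Commute (x j) (τ k) :=
  intertwiner_commute (H.commute_gen_jm (Ne.symm h2) (by omega) hk hj).symm
    (H.commute_jm hj (by omega))

theorem commute_gen_intertwiner (H : HeckeSystem α β q n t) {j k : ℕ} (hk : k + 1 < n)
    (hj : j < n) (h : j + 1 ≤ k ∨ k + 2 < j) : Commute (t j) (τ k) := by
  rcases h with h | h
  · exact intertwiner_commute (H.commute_far (by omega) hk)
      (H.commute_gen_jm (by omega) (by omega) hj (by omega))
  · exact intertwiner_commute (H.commute_far (by omega) hj).symm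
      (H.commute_gen_jm (by omega) (by omega) hj (by omega))

theorem commute_intertwiner (H : HeckeSystem α β q n t) {j k : ℕ} (hk : k + 1 < n) (hj : j + 1 < k) :
    Commute (τ j) (τ k) :=
  intertwiner_commute (H.commute_gen_intertwiner (by omega) hk (by omega)).symm
    (H.commute_jm_intertwiner (by omega) (by omega) (by omega) (by omega)).symm

end Ring

section Module

variable {K V : Type*} [Field K] [AddCommGroup V] [Module K V] {α β q : K} {n : ℕ}
  {t : ℕ → Module.End K V}

local notation "x" => jucysMurphy q t
local notation "τ" => intertwiner q t

theorem exists_eigenvector (H : HeckeSystem α β q n t) (hq : q ≠ 0) (hα : α ≠ 0) (hβ : β ≠ 0)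
    {k : ℕ} (hk : k < n) (U : Submodule K V) (hU : U ≠ ⊥) (hx : ∀ j < n, ∀ u ∈ U, x j u ∈ U) :
    ∃ u ∈ U, u ≠ 0 ∧ ∃ c : K, c ≠ 0 ∧ x k u = c • u := by
  induction k generalizing U with
  | zero =>
    obtain ⟨u, hu, hu0⟩ := U.exists_mem_ne_zero_of_ne_bot hU
    by_cases h : x 0 u = β • u
    · exact ⟨u, hu, hu0, β, hβ, h⟩
    · refine ⟨x 0 u - β • u, U.sub_mem (hx 0 hk u hu) (U.smul_mem _ hu), sub_ne_zero.2 h, α, hα, ?_⟩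
      have := LinearMap.congr_fun (H.quad_zero hk) u
      simp only [Module.End.mul_apply, LinearMap.sub_apply, Module.algebraMap_end_apply,
        LinearMap.zero_apply] at this
      exact sub_eq_zero.1 this
  | succ k ih =>
    obtain ⟨u, hu, hu0, a, ha, hau⟩ := ih (by omega) U hU hx
    have hsq (v : V) (hv : x k v = a • v) : τ k (τ k v) =
        q • x (k + 1) (q • a • v - x (k + 1) v) - a • (q • a • v - x (k + 1) v) := by
      have c := LinearMap.congr_fun (H.commute_jm (show k < n by omega) hk).eq v
      have := LinearMap.congr_fun (H.intertwiner_sq hq hk) v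
      simp only [Module.End.mul_apply, LinearMap.sub_apply, LinearMap.smul_apply, hv, map_sub,
        map_smul] at this c ⊢
      rw [this, c]; module
    by_contra! hcon
    have hinj (v : V) (hvU : v ∈ U) (hv : x k v = a • v) (h0 : τ k v = 0) : v = 0 := by
      by_contra hv0
      have h1 := hsq v hv
      rw [h0, map_zero] at h1
      have hw0 : q • a • v - x (k + 1) v ≠ 0 := fun h =>
        hcon v hvU hv0 (q * a) (mul_ne_zero hq ha) (by rw [mul_smul]; exact (sub_eq_zero.1 h).symm)
      refine hcon _ (U.sub_mem (U.smul_mem _ (U.smul_mem _ hvU)) (hx _ hk _ hvU)) hw0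
        (q⁻¹ * a) (mul_ne_zero (inv_ne_zero hq) ha) ?_
      rw [mul_smul, eq_inv_smul_iff₀ hq]
      exact sub_eq_zero.1 h1.symm
    let U' := U ⊓ LinearMap.ker (x k - algebraMap K _ a)
    have hU' {v : V} : v ∈ U' ↔ v ∈ U ∧ x k v = a • v := by
      simp [U', sub_eq_zero]
    have hxU' : ∀ j < n, ∀ u ∈ U', x j u ∈ U' := fun j hj v hv => by
      rw [hU'] at hv ⊢
      refine ⟨hx j hj v hv.1, ?_⟩
      have := LinearMap.congr_fun (H.commute_jm (show k < n by omega) hj).eq v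
      simp only [Module.End.mul_apply] at this
      rw [this, hv.2, map_smul]
    obtain ⟨w, hw, hw0, c, hc, hcw⟩ := ih (by omega) (U'.map (τ k))
      (fun h => hu0 (hinj u hu hau (by
        have : τ k u ∈ U'.map (τ k) := Submodule.mem_map_of_mem (hU'.2 ⟨hu, hau⟩)
        simpa [h] using this)))
      (by
        rintro j hj _ ⟨v, hv, rfl⟩
        rcases eq_or_ne j k with rfl | h1
        · exact ⟨x (j + 1) v, hxU' _ hk v hv, LinearMap.congr_fun (H.intertwiner_mul_jm_succ hq hk) v⟩
        rcases eq_or_ne j (k + 1) with rfl | h2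
        · exact ⟨x k v, hxU' _ (by omega) v hv, LinearMap.congr_fun (H.intertwiner_mul_jm hq hk) v⟩
        · exact ⟨x j v, hxU' _ hj v hv,
            (LinearMap.congr_fun (H.commute_jm_intertwiner hk hj h1 h2).eq v).symm⟩)
    obtain ⟨m, hm, rfl⟩ := hw
    have h1 : τ k (x (k + 1) m - c • m) = 0 := by
      have := LinearMap.congr_fun (H.intertwiner_mul_jm_succ hq hk) m
      simp only [Module.End.mul_apply] at this
      rw [map_sub, this, hcw, map_smul, sub_self]
    have h2 := hU'.1 (U'.sub_mem (hxU' _ hk m hm) (U'.smul_mem c hm))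
    have h3 := hinj _ h2.1 h2.2 h1
    exact hcon m (hU'.1 hm).1 (fun h => hw0 (by simp [h])) c hc (sub_eq_zero.1 h3)

theorem exists_weight_vector (H : HeckeSystem α β q n t) (hq : q ≠ 0) (hα : α ≠ 0) (hβ : β ≠ 0)
    (U : Submodule K V) (hU : U ≠ ⊥) (hx : ∀ j < n, ∀ u ∈ U, x j u ∈ U) :
    ∃ u ∈ U, u ≠ 0 ∧ ∃ c : ℕ → K, ∀ k < n, c k ≠ 0 ∧ x k u = c k • u := by
  suffices h : ∀ m ≤ n, ∃ u ∈ U, u ≠ 0 ∧ ∃ c : ℕ → K, ∀ k < m, c k ≠ 0 ∧ x k u = c k • u from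
    h n le_rfl
  intro m
  induction m with
  | zero =>
    obtain ⟨u, hu, hu0⟩ := U.exists_mem_ne_zero_of_ne_bot hU
    exact fun _ => ⟨u, hu, hu0, 0, by simp⟩
  | succ m ih =>
    intro hm
    obtain ⟨u, hu, hu0, c, hc⟩ := ih (by omega)
    let U' : Submodule K V := U ⊓ ⨅ k ∈ Finset.range m, LinearMap.ker (x k - algebraMap K _ (c k))
    have hU' {v : V} : v ∈ U' ↔ v ∈ U ∧ ∀ k < m, x k v = c k • v := by
      simp [U', sub_eq_zero]
    obtain ⟨v, hv, hv0, d, hd, hdv⟩ := H.exists_eigenvector hq hα hβ (k := m) (by omega) U'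
      (fun h => hu0 (by simpa [h] using hU'.2 ⟨hu, fun k hk => (hc k hk).2⟩))
      (fun j hj v hv => by
        rw [hU'] at hv ⊢
        refine ⟨hx j hj v hv.1, fun k hk => ?_⟩
        have := LinearMap.congr_fun (H.commute_jm (show k < n by omega) hj).eq v
        simp only [Module.End.mul_apply] at this
        rw [this, hv.2 k hk, map_smul])
    rw [hU'] at hv
    refine ⟨v, hv.1, hv0, Function.update c m d, fun k hk => ?_⟩
    rcases eq_or_ne k m with rfl | hkm
    · simpa using ⟨hd, hdv⟩
    · simpa [hkm] using ⟨(hc k (by omega)).1, hv.2 k (by omega)⟩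

end Module

end HeckeSystem

namespace HeckeSystem
open PowerSeries

section map
variable {K R S : Type*} [Field K] [Ring R] [Algebra K R] [Ring S] [Algebra K S] {α β q : K}
  {n : ℕ} {t : ℕ → R}

theorem jucysMurphy_map (φ : R →ₐ[K] S) (k : ℕ) :
    jucysMurphy q (fun i => φ (t i)) k = φ (jucysMurphy q t k) := by
  induction k with
  | zero => rfl
  | succ k ih => simp [jucysMurphy, ih]

/-- The embedding of coefficients into power series, as an algebra homomorphism. -/
noncomputable def powerSeriesC (K R : Type*) [Field K] [Ring R] [Algebra K R] : R →ₐ[K] R⟦X⟧ where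
  __ := PowerSeries.C (R := R)
  commutes' _ := algebraMap_apply.symm

theorem powerSeriesC_apply (a : R) : powerSeriesC K R a = PowerSeries.C a := rfl

theorem coeff_smul_algebra (c : K) (P : R⟦X⟧) (j : ℕ) : coeff j (c • P) = c • coeff j P := rfl

theorem coeff_jmTrace (n : ℕ) (P : R⟦X⟧) (j : ℕ) :
    coeff j (jmTrace α β q (fun i => powerSeriesC K R (t i)) n P) =
      jmTrace α β q t n (coeff j P) := by
  induction n generalizing P with
  | zero => simp [jmTrace_zero]
  | succ n ih =>
    have h (a : R) (P : R⟦X⟧) :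
        coeff j (powerSeriesC K R a * P * powerSeriesC K R a) = a * coeff j P * a := by
      rw [powerSeriesC_apply, coeff_mul_C, coeff_C_mul]
    rw [jmTrace_succ, jmTrace_succ, jucysMurphy_map, map_add, ih, map_sub, coeff_smul_algebra,
      coeff_smul_algebra, h, h]

theorem isResolvent_powerSeries (t : ℕ → R) :
    IsResolvent q (fun i => powerSeriesC K R (t i)) (X : R⟦X⟧)
      (fun k => PowerSeries.mk fun j => jucysMurphy q t k ^ j) where
  central z := (commute_X z).symm
  eq k := by
    rw [jucysMurphy_map]
    ext j
    cases j with
    | zero => simp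
    | succ j =>
      rw [map_add, coeff_succ_X_mul]
      rw [powerSeriesC_apply, coeff_C_mul, coeff_mk, coeff_mk, pow_succ', coeff_one]
      simp
  commute k z hz := by
    rw [jucysMurphy_map] at hz
    have h1 (j : ℕ) : Commute (coeff j z) (jucysMurphy q t k) := by
      have := congrArg (coeff j) hz.eq
      rwa [powerSeriesC_apply, coeff_mul_C, coeff_C_mul] at this
    ext j
    rw [coeff_mul, coeff_mul, ← Finset.Nat.sum_antidiagonal_swap]
    refine Finset.sum_congr rfl fun p _ => ?_
    simp only [coeff_mk, Prod.fst_swap, Prod.snd_swap]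
    exact ((h1 _).pow_right _).eq

end map

section weight

variable {K V : Type*} [Field K] [AddCommGroup V] [Module K V] {α β q : K} {n : ℕ}
  {t : ℕ → Module.End K V}

/-- The coefficients of `P` act on `v` through the coefficients of the scalar series `p`. -/
def ActsBy (v : V) (P : (Module.End K V)⟦X⟧) (p : K⟦X⟧) : Prop :=
  ∀ j, coeff j P v = coeff j p • v

namespace ActsBy

variable {v : V} {P Q : (Module.End K V)⟦X⟧} {p r : K⟦X⟧}

theorem coeff_eq_zero (h : ActsBy v P p) (hv : v ≠ 0) {j : ℕ} (hn : IsNilpotent (coeff j P)) :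
    coeff j p = 0 := by
  obtain ⟨N, hN⟩ := hn
  have h1 (N : ℕ) : (coeff j P ^ N) v = coeff j p ^ N • v := by
    induction N with
    | zero => simp
    | succ N ih => rw [pow_succ', Module.End.mul_apply, ih, map_smul, h j, smul_smul, pow_succ]
  have h2 := h1 N
  rw [hN, LinearMap.zero_apply] at h2
  exact eq_zero_of_pow_eq_zero (by simpa [hv] using h2.symm)

theorem add (h : ActsBy v P p) (h' : ActsBy v Q r) : ActsBy v (P + Q) (p + r) := fun j => by
  simp [h j, h' j, add_smul]

theorem sub (h : ActsBy v P p) (h' : ActsBy v Q r) : ActsBy v (P - Q) (p - r) := fun j => by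
  simp [h j, h' j, sub_smul]

theorem smul (c : K) (h : ActsBy v P p) : ActsBy v (c • P) (c • p) := fun j => by
  rw [coeff_smul_algebra, LinearMap.smul_apply, h j]; simp [mul_smul]

theorem mul (h : ActsBy v P p) (h' : ActsBy v Q r) : ActsBy v (P * Q) (p * r) := fun j => by
  rw [coeff_mul, coeff_mul, LinearMap.sum_apply, Finset.sum_smul]
  refine Finset.sum_congr rfl fun a _ => ?_
  rw [Module.End.mul_apply, h', map_smul, h, smul_smul, mul_comm]

theorem one : ActsBy v (1 : (Module.End K V)⟦X⟧) 1 := fun j => by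
  rw [coeff_one, coeff_one]; split_ifs <;> simp

theorem X : ActsBy v (X : (Module.End K V)⟦X⟧) X := fun j => by
  rw [coeff_X, coeff_X]; split_ifs <;> simp

theorem sum {ι : Type*} {s : Finset ι} {F : ι → (Module.End K V)⟦X⟧} {f : ι → K⟦X⟧}
    (h : ∀ i ∈ s, ActsBy v (F i) (f i)) : ActsBy v (∑ i ∈ s, F i) (∑ i ∈ s, f i) := fun j => by
  rw [map_sum, map_sum, LinearMap.sum_apply, Finset.sum_smul]
  exact Finset.sum_congr rfl fun i hi => h i hi j

theorem C {f : Module.End K V} {c : K} (h : f v = c • v) :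
    ActsBy v (powerSeriesC K _ f) (PowerSeries.C c) := fun j => by
  rw [powerSeriesC_apply, coeff_C, coeff_C]; split_ifs <;> simp [h]

theorem mk_pow {f : Module.End K V} {c : K} (h : f v = c • v) :
    ActsBy v (PowerSeries.mk fun j => f ^ j) (PowerSeries.mk fun j => c ^ j) := fun j => by
  rw [coeff_mk, coeff_mk]
  induction j with
  | zero => simp
  | succ j ih => rw [pow_succ', Module.End.mul_apply, ih, map_smul, h, smul_smul, pow_succ]

end ActsBy

theorem weight_series_identity (H : HeckeSystem α β q (n + 1) t) (hq : q ≠ 0) (hα : α * β ≠ 0)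
    (hnil : ∀ j, IsNilpotent (jmTrace α β q t (n + 1) (jucysMurphy q t n ^ j)))
    {v : V} (hv : v ≠ 0) {c : ℕ → K} (hc : ∀ k < n + 1, jucysMurphy q t k v = c k • v) :
    (q + q⁻¹ - 2) • ((X : K⟦X⟧) * ∑ i ∈ Finset.range (n + 1), PowerSeries.C (c i)) +
      (1 - α • X) * (1 - β • X) * ∏ k ∈ Finset.range (n + 1), (1 - (q + q⁻¹ - 2) •
        ((X : K⟦X⟧) * (PowerSeries.C (c k) *
          ((PowerSeries.mk fun j => c k ^ j) * PowerSeries.mk fun j => c k ^ j)))) -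
      (1 - α • X) * (1 - β • X) = 0 := by
  set T : ℕ → (Module.End K V)⟦X⟧ := fun i => powerSeriesC K _ (t i)
  have hJ := isResolvent_powerSeries (q := q) t
  have key := hJ.smul_resolventTrace (H.map (powerSeriesC K _)) hq hα le_rfl
  have h0 : ActsBy v ((1 - α • X) * (1 - β • X) : (Module.End K V)⟦X⟧)
      ((1 - α • X) * (1 - β • X) : K⟦X⟧) :=
    (ActsBy.one.sub (ActsBy.X.smul α)).mul (ActsBy.one.sub (ActsBy.X.smul β))
  have h1 : ∀ m ≤ n + 1, ActsBy v (centralSeries α β q T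
      (fun k => PowerSeries.mk fun j => jucysMurphy q t k ^ j) X m)
      ((1 - α • X) * (1 - β • X) * ∏ k ∈ Finset.range m, (1 - (q + q⁻¹ - 2) •
        ((X : K⟦X⟧) * (PowerSeries.C (c k) *
          ((PowerSeries.mk fun j => c k ^ j) * PowerSeries.mk fun j => c k ^ j))))) := by
    intro m
    induction m with
    | zero => intro _; simpa [centralSeries] using h0
    | succ m ih =>
      intro hm
      rw [Finset.prod_range_succ, ← mul_assoc, centralSeries, jucysMurphy_map]
      have hx := hc m (by omega)
      have hmk := ActsBy.mk_pow hx
      exact (ih (by omega)).mul (ActsBy.one.sub ((ActsBy.X.mul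
        ((ActsBy.C hx).mul (hmk.mul hmk))).smul _))
  have h2 : ActsBy v (∑ i ∈ Finset.range (n + 1), jucysMurphy q T i)
      (∑ i ∈ Finset.range (n + 1), PowerSeries.C (c i)) := ActsBy.sum fun i hi => by
    rw [jucysMurphy_map]
    exact ActsBy.C (hc i (Finset.mem_range.1 hi))
  have h3 := (((ActsBy.X.mul h2).smul (q + q⁻¹ - 2)).add (h1 (n + 1) le_rfl)).sub h0
  rw [show ((1 - α • X) * (1 - β • X) : (Module.End K V)⟦X⟧) = centralSeries α β q T
    (fun k => PowerSeries.mk fun j => jucysMurphy q t k ^ j) X 0 from rfl,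
    ← key] at h3
  ext j
  rw [map_zero]
  have h5 : IsNilpotent (coeff j ((α * β * (q + q⁻¹ - 2)) • ((X : (Module.End K V)⟦X⟧) * (X *
      resolventTrace α β q T (fun k => PowerSeries.mk fun j => jucysMurphy q t k ^ j)
        (n + 1))))) := by
    rw [coeff_smul_algebra]
    refine IsNilpotent.smul ?_ _
    rcases j with _ | _ | j
    · simp
    · rw [coeff_succ_X_mul]; simp
    · rw [coeff_succ_X_mul, coeff_succ_X_mul, resolventTrace, coeff_jmTrace, coeff_mk]
      exact hnil j
  exact h3.coeff_eq_zero hv h5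

end weight

end HeckeSystem

open Polynomial in
theorem rootMultiplicity_one_sub_C_mul_X {K : Type*} [Field K] [DecidableEq K] (c y : K)
    (hy : y ≠ 0) : rootMultiplicity y⁻¹ (1 - C c * X : K[X]) = if c = y then 1 else 0 := by
  split_ifs with h
  · subst h
    have : (1 - C c * X : K[X]) = C (-c) * (X - C c⁻¹) := by
      rw [mul_sub, ← C_mul, neg_mul, mul_inv_cancel₀ hy]; simp; ring
    rw [this, ← count_roots, roots_C_mul _ (neg_ne_zero.2 hy), roots_X_sub_C]
    simp
  · rw [rootMultiplicity_eq_zero]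
    intro h'
    simp only [IsRoot, eval_sub, eval_one, eval_mul, eval_C, eval_X] at h'
    apply h
    have h2 : c * y⁻¹ = 1 := (sub_eq_zero.1 h').symm
    rwa [← div_eq_mul_inv, div_eq_one_iff_eq hy] at h2

open Polynomial in
theorem one_sub_C_mul_X_ne_zero {K : Type*} [Field K] (c : K) : (1 - C c * X : K[X]) ≠ 0 := by
  intro h
  simpa using congrArg (eval 0) h

open Polynomial in
theorem rootMultiplicity_prod_one_sub {K : Type*} [Field K] [DecidableEq K] {ι : Type*}
    (s : Finset ι) (c : ι → K) (y : K) (hy : y ≠ 0) :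
    rootMultiplicity y⁻¹ (∏ k ∈ s, (1 - C (c k) * X : K[X])) = (s.filter fun k => c k = y).card := by
  rw [Finset.card_filter, ← count_roots, roots_prod _ _
    (Finset.prod_ne_zero_iff.2 fun k _ => one_sub_C_mul_X_ne_zero _), Multiset.count_bind]
  simp only [count_roots, rootMultiplicity_one_sub_C_mul_X _ _ hy]
  rfl

open PowerSeries in
theorem one_sub_C_mul_X_mul_mk {K : Type*} [Field K] (c : K) :
    (1 - PowerSeries.C c * X : K⟦X⟧) * PowerSeries.mk (fun j => c ^ j) = 1 := by
  ext j
  rw [sub_mul, one_mul, map_sub, mul_assoc, coeff_C_mul, coeff_mk]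
  cases j with
  | zero => simp
  | succ j => rw [coeff_succ_X_mul, coeff_mk, coeff_one, pow_succ']; simp

/-- Root counting in the series identity satisfied by the weights. -/
theorem weight_count {K : Type*} [Field K] [DecidableEq K] {α β q : K} {n : ℕ} (hq : q ≠ 0)
    {c : ℕ → K} 
    (h : (q + q⁻¹ - 2) • ((PowerSeries.X : PowerSeries K) *
          ∑ i ∈ Finset.range n, PowerSeries.C (c i)) +
      (1 - α • PowerSeries.X) * (1 - β • PowerSeries.X) *
        ∏ k ∈ Finset.range n, (1 - (q + q⁻¹ - 2) •
        ((PowerSeries.X : PowerSeries K) * (PowerSeries.C (c k) *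
          ((PowerSeries.mk fun j => c k ^ j) * PowerSeries.mk fun j => c k ^ j)))) -
      (1 - α • PowerSeries.X) * (1 - β • PowerSeries.X) = 0) (y : K) (hy : y ≠ 0) :
    2 * ((Finset.range n).filter fun k => c k = y).card ≤
      (if α = y then 1 else 0) + (if β = y then 1 else 0) +
      (((Finset.range n).filter fun k => c k = q⁻¹ * y).card +
      ((Finset.range n).filter fun k => c k = q * y).card) := by
  have hps : (((PowerSeries.C : K →+* PowerSeries K) 1 - PowerSeries.C α * PowerSeries.X) *
        (1 - PowerSeries.C β * PowerSeries.X) - PowerSeries.C (q + q⁻¹ - 2) * (PowerSeries.X *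
          ∑ i ∈ Finset.range n, PowerSeries.C (c i))) *
      (∏ k ∈ Finset.range n, (1 - PowerSeries.C (c k) * PowerSeries.X)) ^ 2 =
      (1 - PowerSeries.C α * PowerSeries.X) * (1 - PowerSeries.C β * PowerSeries.X) *
      ((∏ k ∈ Finset.range n, (1 - PowerSeries.C (q * c k) * PowerSeries.X)) *
       ∏ k ∈ Finset.range n, (1 - PowerSeries.C (q⁻¹ * c k) * PowerSeries.X)) := by
    simp only [PowerSeries.smul_eq_C_mul] at h
    have h1 : (∏ k ∈ Finset.range n, (1 - PowerSeries.C (q + q⁻¹ - 2) *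
        ((PowerSeries.X : PowerSeries K) * (PowerSeries.C (c k) *
          ((PowerSeries.mk fun j => c k ^ j) * PowerSeries.mk fun j => c k ^ j))))) *
        (∏ k ∈ Finset.range n, (1 - PowerSeries.C (c k) * PowerSeries.X)) ^ 2 =
        ((∏ k ∈ Finset.range n, (1 - PowerSeries.C (q * c k) * PowerSeries.X)) *
       ∏ k ∈ Finset.range n, (1 - PowerSeries.C (q⁻¹ * c k) * PowerSeries.X)) := by
      rw [← Finset.prod_pow, ← Finset.prod_mul_distrib, ← Finset.prod_mul_distrib]
      refine Finset.prod_congr rfl fun k _ => ?_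
      have h2 := one_sub_C_mul_X_mul_mk (c k)
      have h3 : (PowerSeries.C q : PowerSeries K) * PowerSeries.C q⁻¹ = 1 := by
        rw [← map_mul, mul_inv_cancel₀ hq, map_one]
      set m := PowerSeries.mk fun j => c k ^ j
      simp only [map_add, map_sub, map_mul, map_ofNat]
      linear_combination (-(PowerSeries.C q + PowerSeries.C q⁻¹ - 2) * PowerSeries.X *
        PowerSeries.C (c k)) * ((1 - PowerSeries.C (c k) * PowerSeries.X) * m + 1) * h2
        - (PowerSeries.C (c k)) ^ 2 * PowerSeries.X ^ 2 * h3
    rw [← h1, map_one]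
    linear_combination (-(∏ k ∈ Finset.range n, (1 - PowerSeries.C (c k) * PowerSeries.X)) ^ 2) * h
  open Polynomial in
  have hpoly : ((1 - C α * X) * (1 - C β * X) - C (q + q⁻¹ - 2) * (X *
          ∑ i ∈ Finset.range n, C (c i))) * (∏ k ∈ Finset.range n, (1 - C (c k) * X)) ^ 2 =
      (1 - C α * X) * (1 - C β * X) * ((∏ k ∈ Finset.range n, (1 - C (q * c k) * X)) *
       ∏ k ∈ Finset.range n, (1 - C (q⁻¹ * c k) * X) : K[X]) := by
    apply Polynomial.coe_injective
    rw [map_one] at hps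
    have hs (c : ℕ → K) : ((∏ k ∈ Finset.range n, (1 - C (c k) * X) : K[X]) : PowerSeries K) =
        ∏ k ∈ Finset.range n, (1 - PowerSeries.C (c k) * PowerSeries.X) := by
      rw [← Polynomial.coeToPowerSeries.ringHom_apply, map_prod]
      simp
    have hs' : ((∑ k ∈ Finset.range n, C (c k) : K[X]) : PowerSeries K) =
        ∑ k ∈ Finset.range n, PowerSeries.C (c k) := by
      rw [← Polynomial.coeToPowerSeries.ringHom_apply, map_sum]
      simp
    simp only [Polynomial.coe_mul, Polynomial.coe_sub, Polynomial.coe_one, Polynomial.coe_C,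
      Polynomial.coe_X, Polynomial.coe_pow, hs, hs']
    exact hps
  have hp1 (d : ℕ → K) : (∏ k ∈ Finset.range n, (1 - Polynomial.C (d k) * Polynomial.X)) ≠ 0 :=
    Finset.prod_ne_zero_iff.2 fun k _ => one_sub_C_mul_X_ne_zero _
  have h1 := congrArg (Polynomial.rootMultiplicity y⁻¹) hpoly
  have hne : (1 - Polynomial.C α * Polynomial.X) * (1 - Polynomial.C β * Polynomial.X) *
    ((∏ k ∈ Finset.range n, (1 - Polynomial.C (q * c k) * Polynomial.X)) *
       ∏ k ∈ Finset.range n, (1 - Polynomial.C (q⁻¹ * c k) * Polynomial.X)) ≠ 0 :=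
    mul_ne_zero (mul_ne_zero (one_sub_C_mul_X_ne_zero _) (one_sub_C_mul_X_ne_zero _))
      (mul_ne_zero (hp1 _) (hp1 _))
  have hne' := hne
  rw [← hpoly] at hne'
  rw [Polynomial.rootMultiplicity_mul hne', Polynomial.rootMultiplicity_mul hne,
    Polynomial.rootMultiplicity_mul (left_ne_zero_of_mul hne),
    Polynomial.rootMultiplicity_mul (right_ne_zero_of_mul hne), sq,
    Polynomial.rootMultiplicity_mul (mul_ne_zero (hp1 _) (hp1 _)),
    rootMultiplicity_prod_one_sub _ _ _ hy, rootMultiplicity_prod_one_sub _ _ _ hy,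
    rootMultiplicity_prod_one_sub _ _ _ hy, rootMultiplicity_one_sub_C_mul_X _ _ hy,
    rootMultiplicity_one_sub_C_mul_X _ _ hy] at h1
  have e1 : ((Finset.range n).filter fun k => q * c k = y) =
      (Finset.range n).filter fun k => c k = q⁻¹ * y :=
    Finset.filter_congr fun k _ => by rw [eq_inv_mul_iff_mul_eq₀ hq]
  have e2 : ((Finset.range n).filter fun k => q⁻¹ * c k = y) =
      (Finset.range n).filter fun k => c k = q * y :=
    Finset.filter_congr fun k _ => by rw [inv_mul_eq_iff_eq_mul₀ hq]
  rw [e1, e2] at h1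
  omega

/-- Linear maps commuting with the first `n` operators of two families. -/
def IsRepHom {K V W : Type*} [Field K] [AddCommGroup V] [Module K V] [AddCommGroup W] [Module K W]
    (n : ℕ) (t : ℕ → Module.End K V) (s : ℕ → Module.End K W) (φ : V →ₗ[K] W) : Prop :=
  ∀ i < n, ∀ v, φ (t i v) = s i (φ v)

/-- Indecomposability of a vector space with `n` operators, in terms of idempotents. -/
def IsIndecRep {K V : Type*} [Field K] [AddCommGroup V] [Module K V] (n : ℕ)
    (t : ℕ → Module.End K V) : Prop :=
  Nontrivial V ∧ ∀ p : Module.End K V, IsRepHom n t t p → p * p = p → p = 0 ∨ p = 1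

section rep

variable {K V W U : Type*} [Field K] [AddCommGroup V] [Module K V] [AddCommGroup W] [Module K W]
  [AddCommGroup U] [Module K U] {n : ℕ} {t : ℕ → Module.End K V} {s : ℕ → Module.End K W}
  {r : ℕ → Module.End K U}

namespace IsRepHom

theorem comp {ψ : W →ₗ[K] U} {φ : V →ₗ[K] W} (hψ : IsRepHom n s r ψ) (hφ : IsRepHom n t s φ) :
    IsRepHom n t r (ψ ∘ₗ φ) := fun i hi v => by
  rw [LinearMap.comp_apply, LinearMap.comp_apply, hφ i hi, hψ i hi]

theorem one : IsRepHom n t t 1 := fun _ _ _ => rfl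

theorem mul {ψ φ : Module.End K V} (hψ : IsRepHom n t t ψ) (hφ : IsRepHom n t t φ) :
    IsRepHom n t t (ψ * φ) := hψ.comp hφ

theorem add {ψ φ : V →ₗ[K] W} (hψ : IsRepHom n t s ψ) (hφ : IsRepHom n t s φ) :
    IsRepHom n t s (ψ + φ) := fun i hi v => by
  simp [hφ i hi, hψ i hi]

theorem sub {ψ φ : V →ₗ[K] W} (hψ : IsRepHom n t s ψ) (hφ : IsRepHom n t s φ) :
    IsRepHom n t s (ψ - φ) := fun i hi v => by
  simp [hφ i hi, hψ i hi]

theorem sum {ι : Type*} {S : Finset ι} {φ : ι → V →ₗ[K] W} (h : ∀ k ∈ S, IsRepHom n t s (φ k)) :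
    IsRepHom n t s (∑ k ∈ S, φ k) := fun i hi v => by
  rw [LinearMap.sum_apply, LinearMap.sum_apply, map_sum]
  exact Finset.sum_congr rfl fun k hk => h k hk i hi v

theorem pow {φ : Module.End K V} (h : IsRepHom n t t φ) (N : ℕ) : IsRepHom n t t (φ ^ N) := by
  induction N with
  | zero => exact one
  | succ N ih => rw [pow_succ]; exact ih.mul h

theorem iff_commute {φ : Module.End K V} : IsRepHom n t t φ ↔ ∀ i < n, Commute (t i) φ :=
  forall₂_congr fun i _ => by
    rw [commute_iff_eq, LinearMap.ext_iff]
    exact forall_congr' fun v => eq_comm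

theorem of_mul_eq_one {φ ψ : Module.End K V} (h : IsRepHom n t t φ) (h1 : φ * ψ = 1)
    (h2 : ψ * φ = 1) : IsRepHom n t t ψ := fun i hi v => by
  have h3 (v) : φ (ψ v) = v := LinearMap.congr_fun h1 v
  have h4 (v) : ψ (φ v) = v := LinearMap.congr_fun h2 v
  calc ψ (t i v) = ψ (t i (φ (ψ v))) := by rw [h3]
    _ = ψ (φ (t i (ψ v))) := by rw [h i hi]
    _ = _ := h4 _

theorem projection {p p' : Submodule K V} (h : IsCompl p p') (hp : ∀ i < n, ∀ v ∈ p, t i v ∈ p)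
    (hp' : ∀ i < n, ∀ v ∈ p', t i v ∈ p') : IsRepHom n t t (p.projection p' h) := fun i hi v => by
  obtain ⟨a, b, rfl, -⟩ := Submodule.existsUnique_add_of_isCompl h v
  simp only [map_add]
  rw [Submodule.projection_apply_of_mem_left h (hp i hi a a.2),
    (Submodule.projection_apply_eq_zero_iff h).2 (hp' i hi b b.2),
    Submodule.projection_apply_left, Submodule.projection_apply_right, map_zero]

end IsRepHom

namespace IsIndecRep

/-- Fitting's lemma. -/
theorem isNilpotent_or_isUnit [FiniteDimensional K V] (h : IsIndecRep n t) {φ : Module.End K V}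
    (hφ : IsRepHom n t t φ) : IsNilpotent φ ∨ IsUnit φ := by
  obtain ⟨N, hN⟩ := (φ.eventually_isCompl_ker_pow_range_pow.and
    (Filter.eventually_gt_atTop 0)).exists
  obtain ⟨hc, hN⟩ := hN
  have hp := IsRepHom.projection (n := n) (t := t) hc
    (fun i hi v hv => by
      rw [LinearMap.mem_ker] at hv ⊢
      rw [hφ.pow N i hi, hv, map_zero])
    (fun i hi v hv => by
      obtain ⟨w, rfl⟩ := hv
      exact ⟨t i w, hφ.pow N i hi w⟩)
  rcases h.2 _ hp (Submodule.isIdempotentElem_projection hc) with h0 | h1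
  · right
    have hk : LinearMap.ker (φ ^ N) = ⊥ := by
      rw [← Submodule.range_projection hc, h0]; exact LinearMap.range_zero
    have hu : IsUnit (φ ^ N) := (LinearMap.isUnit_iff_ker_eq_bot _).2 hk
    exact (isUnit_pow_iff hN.ne').1 hu
  · left
    refine ⟨N, LinearMap.range_eq_bot.1 ?_⟩
    rw [← Submodule.ker_projection hc, h1]
    exact LinearMap.ker_id

theorem isUnit_of_isUnit_add [FiniteDimensional K V] (h : IsIndecRep n t) {φ ψ : Module.End K V}
    (hφ : IsRepHom n t t φ) (hψ : IsRepHom n t t ψ) (hu : IsUnit (φ + ψ)) :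
    IsUnit φ ∨ IsUnit ψ := by
  obtain ⟨u, hu⟩ := hu
  have hi : IsRepHom n t t ((u⁻¹ : (Module.End K V)ˣ) : Module.End K V) :=
    (hu ▸ hφ.add hψ : IsRepHom n t t (u : Module.End K V)).of_mul_eq_one u.mul_inv u.inv_mul
  rcases h.isNilpotent_or_isUnit (hi.mul hφ) with h1 | h1
  · right
    have h2 : (↑u⁻¹ : Module.End K V) * ψ = 1 - ↑u⁻¹ * φ := by
      rw [eq_sub_iff_add_eq, add_comm, ← mul_add, ← hu, Units.inv_mul]
    have h3 := h1.isUnit_one_sub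
    rwa [← h2, Units.isUnit_units_mul] at h3
  · left
    rwa [Units.isUnit_units_mul] at h1

theorem isUnit_of_isUnit_sum [FiniteDimensional K V] (h : IsIndecRep n t) {ι : Type*}
    {S : Finset ι} {φ : ι → Module.End K V} (hφ : ∀ k ∈ S, IsRepHom n t t (φ k))
    (hu : IsUnit (∑ k ∈ S, φ k)) : ∃ k ∈ S, IsUnit (φ k) := by
  have hV := h.1
  classical
  induction S using Finset.induction_on with
  | empty => simp at hu
  | insert a S ha ih =>
    rw [Finset.sum_insert ha] at hu
    rcases h.isUnit_of_isUnit_add (hφ a (Finset.mem_insert_self _ _))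
      (.sum fun k hk => hφ k (Finset.mem_insert_of_mem hk)) hu with h1 | h1
    · exact ⟨a, Finset.mem_insert_self _ _, h1⟩
    · obtain ⟨k, hk, h2⟩ := ih (fun k hk => hφ k (Finset.mem_insert_of_mem hk)) h1
      exact ⟨k, Finset.mem_insert_of_mem hk, h2⟩

/-- Two indecomposable representations with a non-nilpotent endomorphism of one factoring through
the other are isomorphic. -/
theorem exists_equiv [FiniteDimensional K V] (h : IsIndecRep n t) (h' : IsIndecRep n s)
    {F : V →ₗ[K] W} {G : W →ₗ[K] V} (hF : IsRepHom n t s F) (hG : IsRepHom n s t G)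
    (hn : ¬ IsNilpotent (G ∘ₗ F : Module.End K V)) : ∃ e : V ≃ₗ[K] W, IsRepHom n t s e := by
  have hGF : IsRepHom n t t (G ∘ₗ F) := hG.comp hF
  obtain ⟨u, hu⟩ := (h.isNilpotent_or_isUnit hGF).resolve_left hn
  rw [← hu] at hGF
  set v : Module.End K V := ↑u⁻¹
  have hi : IsRepHom n t t v := hGF.of_mul_eq_one u.mul_inv u.inv_mul
  have hv (a : V) : v (G (F a)) = a := LinearMap.congr_fun (hu ▸ u.inv_mul : v * (G ∘ₗ F) = 1) a
  have hinj : Function.Injective F := fun a b hab => by rw [← hv a, hab, hv b]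
  have hp := h'.2 (F ∘ₗ v ∘ₗ G) (hF.comp (hi.comp hG)) (by ext w; simp [hv])
  have hV := h.1
  obtain ⟨a, ha⟩ := exists_ne (0 : V)
  rcases hp with h0 | h1
  · exfalso
    have := LinearMap.congr_fun h0 (F a)
    rw [LinearMap.comp_apply, LinearMap.comp_apply, hv, LinearMap.zero_apply] at this
    exact ha (hinj (by rw [this, map_zero]))
  · exact ⟨LinearEquiv.ofBijective F ⟨hinj, fun w => ⟨v (G w), LinearMap.congr_fun h1 w⟩⟩, hF⟩

end IsIndecRep

theorem HeckeSystem.of_injective {α β q : K} (H : HeckeSystem α β q n s) {φ : V →ₗ[K] W}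
    (hφ : IsRepHom n t s φ) (hi : Function.Injective φ) : HeckeSystem α β q n t where
  quad_zero h := LinearMap.ext fun v => hi <| by
    simpa [hφ 0 h, Module.algebraMap_end_apply] using LinearMap.congr_fun (H.quad_zero h) (φ v)
  quad i h h' := LinearMap.ext fun v => hi <| by
    simpa [hφ i h', Module.algebraMap_end_apply] using LinearMap.congr_fun (H.quad i h h') (φ v)
  braid_zero h := LinearMap.ext fun v => hi <| by
    simpa [hφ 0 (by omega), hφ 1 h] using LinearMap.congr_fun (H.braid_zero h) (φ v)
  braid i h h' := LinearMap.ext fun v => hi <| by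
    simpa [hφ i (by omega), hφ _ h'] using LinearMap.congr_fun (H.braid i h h') (φ v)
  comm i j h h' := LinearMap.ext fun v => hi <| by
    simpa [hφ i (by omega), hφ _ h'] using LinearMap.congr_fun (H.comm i j h h') (φ v)

end rep

/-- Finite-dimensional representations of the Hecke algebra of type `Bₙ`. -/
structure HeckeRep (K : Type) [Field K] (α β q : K) (n : ℕ) : Type 1 where
  V : Type
  [isAddCommGroup : AddCommGroup V]
  [isModule : Module K V]
  [isFinDim : FiniteDimensional K V]
  t : ℕ → Module.End K V
  sys : HeckeSystem α β q n t

attribute [instance] HeckeRep.isAddCommGroup HeckeRep.isModule HeckeRep.isFinDim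

namespace HeckeRep

variable {K : Type} [Field K] {α β q : K} {n : ℕ}

/-- Isomorphism of representations. -/
def Iso (M N : HeckeRep K α β q n) : Prop := ∃ e : M.V ≃ₗ[K] N.V, IsRepHom n M.t N.t e

theorem Iso.symm {M N : HeckeRep K α β q n} (h : M.Iso N) : N.Iso M := by
  obtain ⟨e, he⟩ := h
  refine ⟨e.symm, fun i hi v => ?_⟩
  have := he i hi (e.symm v)
  simp only [LinearEquiv.coe_coe, LinearEquiv.apply_symm_apply] at this
  simp [← this]

theorem Iso.trans {M N P : HeckeRep K α β q n} (h : M.Iso N) (h' : N.Iso P) : M.Iso P := by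
  obtain ⟨e, he⟩ := h
  obtain ⟨e', he'⟩ := h'
  exact ⟨e.trans e', fun i hi v => (he'.comp he) i hi v⟩

/-- The restriction along `Hₘ ⊆ Hₙ`. -/
def res (M : HeckeRep K α β q n) {m : ℕ} (h : m ≤ n) : HeckeRep K α β q m where
  V := M.V
  t := M.t
  sys := M.sys.mono h

theorem exists_ofIdem (M : HeckeRep K α β q n) (p : Module.End K M.V) (hp : IsRepHom n M.t M.t p)
    (hpp : p * p = p) : ∃ (N : HeckeRep K α β q n) (a : N.V →ₗ[K] M.V) (b : M.V →ₗ[K] N.V),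
      IsRepHom n N.t M.t a ∧ IsRepHom n M.t N.t b ∧ a ∘ₗ b = p ∧
      Module.finrank K N.V = Module.finrank K (LinearMap.range p) := by
  have hpp' (v) : p (p v) = p v := LinearMap.congr_fun hpp v
  have ha : IsRepHom n (fun i => p.rangeRestrict ∘ₗ M.t i ∘ₗ (LinearMap.range p).subtype) M.t
      (LinearMap.range p).subtype := by
    rintro i hi ⟨_, v, rfl⟩
    change p (M.t i (p v)) = M.t i (p v)
    rw [← hp i hi, hpp']
  refine ⟨⟨LinearMap.range p, _, M.sys.of_injective ha Subtype.val_injective⟩,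
    (LinearMap.range p).subtype, p.rangeRestrict, ha, fun i hi v => ?_, rfl, rfl⟩
  apply Subtype.ext
  change p (M.t i v) = p (M.t i (p v))
  rw [← hp i hi, hpp']

theorem exists_decomposition (M : HeckeRep K α β q n) :
    ∃ (ι : Type) (_ : Fintype ι) (N : ι → HeckeRep K α β q n) (a : ∀ k, (N k).V →ₗ[K] M.V)
      (b : ∀ k, M.V →ₗ[K] (N k).V), (∀ k, IsIndecRep n (N k).t) ∧
      (∀ k, IsRepHom n (N k).t M.t (a k)) ∧ (∀ k, IsRepHom n M.t (N k).t (b k)) ∧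
      ∑ k, a k ∘ₗ b k = LinearMap.id := by
  induction hd : Module.finrank K M.V using Nat.strong_induction_on generalizing M with
  | _ d ih =>
  by_cases hI : IsIndecRep n M.t
  · exact ⟨Unit, inferInstance, fun _ => M, fun _ => LinearMap.id, fun _ => LinearMap.id,
      fun _ => hI, fun _ _ _ _ => rfl, fun _ _ _ _ => rfl, by simp⟩
  by_cases hV : Nontrivial M.V
  swap
  · rw [not_nontrivial_iff_subsingleton] at hV
    exact ⟨Empty, inferInstance, fun _ => M, fun _ => LinearMap.id, fun _ => LinearMap.id,
      nofun, nofun, nofun, LinearMap.ext fun v => Subsingleton.elim _ _⟩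
  simp only [IsIndecRep, hV, true_and, not_forall, not_or] at hI
  obtain ⟨p, hp, hpp, hp0, hp1⟩ := hI
  have step (p : Module.End K M.V) (hp : IsRepHom n M.t M.t p) (hpp : p * p = p) (hp1 : p ≠ 1) :
      ∃ (ι : Type) (_ : Fintype ι) (N : ι → HeckeRep K α β q n) (a : ∀ k, (N k).V →ₗ[K] M.V)
      (b : ∀ k, M.V →ₗ[K] (N k).V), (∀ k, IsIndecRep n (N k).t) ∧
      (∀ k, IsRepHom n (N k).t M.t (a k)) ∧ (∀ k, IsRepHom n M.t (N k).t (b k)) ∧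
      ∑ k, a k ∘ₗ b k = p := by
    obtain ⟨P, a', b', h1, h2, h3, h4⟩ := M.exists_ofIdem p hp hpp
    have hlt : Module.finrank K P.V < d := by
      rw [h4, ← hd]
      refine Submodule.finrank_lt fun h => hp1 ?_
      ext v
      obtain ⟨w, rfl⟩ := LinearMap.range_eq_top.1 h v
      exact LinearMap.congr_fun hpp w
    obtain ⟨ι, hι, N, a, b, hN, ha, hb, hab⟩ := ih _ hlt P rfl
    refine ⟨ι, hι, N, fun k => a' ∘ₗ a k, fun k => b k ∘ₗ b',
      hN, fun k => h1.comp (ha k), fun k => (hb k).comp h2, ?_⟩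
    ext v
    have := congrArg a' (LinearMap.congr_fun hab (b' v))
    simp only [LinearMap.sum_apply, LinearMap.comp_apply, LinearMap.id_apply, map_sum] at this ⊢
    rw [this, ← h3, LinearMap.comp_apply]
  obtain ⟨ι, hι, N, a, b, hN, ha, hb, hab⟩ := step p hp hpp hp1
  obtain ⟨ι', hι', N', a', b', hN', ha', hb', hab'⟩ := step (1 - p) (.sub .one hp)
    (by simp [mul_sub, sub_mul, hpp]) (by simpa using hp0)
  refine ⟨ι ⊕ ι', inferInstance, Sum.elim N N', fun k => k.casesOn a a', fun k => k.casesOn b b',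
    ?_, ?_, ?_, ?_⟩
  · rintro (k | k)
    exacts [hN k, hN' k]
  · rintro (k | k)
    exacts [ha k, ha' k]
  · rintro (k | k)
    exacts [hb k, hb' k]
  · rw [Fintype.sum_sum_type]
    calc _ = p + (1 - p) := congrArg₂ (· + ·) hab hab'
      _ = _ := add_sub_cancel p 1

end HeckeRep

namespace HeckeSystem

section fg

variable {K R : Type*} [Field K] [Ring R] [Algebra K R] {α β q : K} {n : ℕ} {t : ℕ → R}

local notation "x" => jucysMurphy q t

/-- The subalgebra generated by the first `n` generators. -/
def parabolic (K : Type*) {R : Type*} [Field K] [Ring R] [Algebra K R] (t : ℕ → R) (n : ℕ) :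
    Subalgebra K R := Algebra.adjoin K (t '' Set.Iio n)

theorem gen_mem_parabolic {i : ℕ} (h : i < n) : t i ∈ parabolic K t n :=
  Algebra.subset_adjoin ⟨i, h, rfl⟩

theorem parabolic_mono {m : ℕ} (h : m ≤ n) : parabolic K t m ≤ parabolic K t n :=
  Algebra.adjoin_mono (Set.image_mono (Set.Iio_subset_Iio h))

theorem commute_of_mem_parabolic {z b : R} (hz : ∀ i < n, Commute (t i) z)
    (hb : b ∈ parabolic K t n) : Commute b z := by
  induction hb using Algebra.adjoin_induction with
  | mem _ h => obtain ⟨i, hi, rfl⟩ := h; exact hz i hi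
  | algebraMap r => exact Algebra.commutes r z
  | add _ _ _ _ h h' => exact h.add_left h'
  | mul _ _ _ _ h h' => exact h.mul_left h'

theorem jm_mem_parabolic {k : ℕ} (h : k < n) : x k ∈ parabolic K t n := by
  induction k with
  | zero => exact gen_mem_parabolic h
  | succ k ih =>
    exact Subalgebra.smul_mem _ (mul_mem (mul_mem (gen_mem_parabolic h) (ih (by omega)))
      (gen_mem_parabolic h)) _

/-- A spanning subspace for the parabolic subalgebra of the next rank. -/
def parabolicSpan (q : K) (t : ℕ → R) (n : ℕ) : Submodule K R :=
  (parabolic K t n).toSubmodule ⊔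
    (parabolic K t n).toSubmodule * Submodule.span K {jucysMurphy q t n} ⊔
    (parabolic K t n).toSubmodule * Submodule.span K {t n} * (parabolic K t n).toSubmodule

theorem mem_parabolicSpan_left {a : R} (ha : a ∈ parabolic K t n) : a ∈ parabolicSpan q t n :=
  Submodule.mem_sup_left (Submodule.mem_sup_left ha)

theorem mem_parabolicSpan_jm {a : R} (ha : a ∈ parabolic K t n) :
    a * x n ∈ parabolicSpan q t n :=
  Submodule.mem_sup_left (Submodule.mem_sup_right
    (Submodule.mul_mem_mul ha (Submodule.mem_span_singleton_self _)))

theorem mem_parabolicSpan_gen {a b : R} (ha : a ∈ parabolic K t n) (hb : b ∈ parabolic K t n) :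
    a * t n * b ∈ parabolicSpan q t n :=
  Submodule.mem_sup_right (Submodule.mul_mem_mul (Submodule.mul_mem_mul ha
    (Submodule.mem_span_singleton_self _)) hb)

theorem parabolicSpan_le {S : Submodule K R} (h1 : ∀ a ∈ parabolic K t n, a ∈ S)
    (h2 : ∀ a ∈ parabolic K t n, a * x n ∈ S)
    (h3 : ∀ a ∈ parabolic K t n, ∀ b ∈ parabolic K t n, a * t n * b ∈ S) :
    parabolicSpan q t n ≤ S := by
  refine sup_le (sup_le h1 (Submodule.mul_le.2 fun a ha b hb => ?_))
    (Submodule.mul_le.2 fun c hc d hd => ?_)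
  · obtain ⟨r, rfl⟩ := Submodule.mem_span_singleton.1 hb
    rw [mul_smul_comm]
    exact S.smul_mem _ (h2 a ha)
  · induction hc using Submodule.mul_induction_on' with
    | mem_mul_mem a ha b hb =>
      obtain ⟨r, rfl⟩ := Submodule.mem_span_singleton.1 hb
      rw [mul_smul_comm, smul_mul_assoc]
      exact S.smul_mem _ (h3 a ha d hd)
    | add a _ b _ h h' => rw [add_mul]; exact S.add_mem h h'

theorem parabolicSpan_mul_mem {b y : R} (hx : ∀ i < n, Commute (t i) (x n))
    (hb : b ∈ parabolic K t n) (hy : y ∈ parabolicSpan q t n) : y * b ∈ parabolicSpan q t n := by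
  suffices parabolicSpan q t n ≤ (parabolicSpan q t n).comap (LinearMap.mulRight K b) from this hy
  refine parabolicSpan_le (fun a ha => ?_) (fun a ha => ?_) fun a ha c hc => ?_ <;>
    rw [Submodule.mem_comap, LinearMap.mulRight_apply]
  · exact mem_parabolicSpan_left (mul_mem ha hb)
  · rw [mul_assoc, ← (commute_of_mem_parabolic hx hb).eq, ← mul_assoc]
    exact mem_parabolicSpan_jm (mul_mem ha hb)
  · rw [mul_assoc]
    exact mem_parabolicSpan_gen ha (mul_mem hc hb)

theorem mul_parabolicSpan_mem {b y : R} (hb : b ∈ parabolic K t n)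
    (hy : y ∈ parabolicSpan q t n) : b * y ∈ parabolicSpan q t n := by
  suffices parabolicSpan q t n ≤ (parabolicSpan q t n).comap (LinearMap.mulLeft K b) from this hy
  refine parabolicSpan_le (fun a ha => ?_) (fun a ha => ?_) fun a ha c hc => ?_ <;>
    rw [Submodule.mem_comap, LinearMap.mulLeft_apply]
  · exact mem_parabolicSpan_left (mul_mem hb ha)
  · rw [← mul_assoc]
    exact mem_parabolicSpan_jm (mul_mem hb ha)
  · rw [← mul_assoc, ← mul_assoc]
    exact mem_parabolicSpan_gen (mul_mem hb ha) hc

theorem parabolic_le_of_gen (hx : ∀ i < n, Commute (t i) (x n))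
    (h1 : t n * x n ∈ parabolicSpan q t n)
    (h2 : ∀ b ∈ parabolic K t n, t n * b * t n ∈ parabolicSpan q t n) :
    (parabolic K t (n + 1)).toSubmodule ≤ parabolicSpan q t n := by
  intro a ha
  suffices ∀ y ∈ parabolicSpan q t n, a * y ∈ parabolicSpan q t n by
    simpa using this 1 (mem_parabolicSpan_left (one_mem _))
  rw [Subalgebra.mem_toSubmodule] at ha
  induction ha using Algebra.adjoin_induction with
  | algebraMap r =>
    intro y hy
    rw [← Algebra.smul_def]
    exact Submodule.smul_mem _ _ hy
  | add _ _ _ _ h h' =>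
    intro y hy
    rw [add_mul]
    exact Submodule.add_mem _ (h y hy) (h' y hy)
  | mul _ _ _ _ h h' =>
    intro y hy
    rw [mul_assoc]
    exact h _ (h' y hy)
  | mem _ h =>
    obtain ⟨i, hi, rfl⟩ := h
    intro y hy
    rcases Nat.lt_succ_iff_lt_or_eq.1 (Set.mem_Iio.1 hi) with h | rfl
    · exact mul_parabolicSpan_mem (gen_mem_parabolic h) hy
    suffices parabolicSpan q t i ≤ (parabolicSpan q t i).comap (LinearMap.mulLeft K (t i)) from
      this hy
    refine parabolicSpan_le (fun a ha => ?_) (fun a ha => ?_) fun a ha c hc => ?_ <;>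
      rw [Submodule.mem_comap, LinearMap.mulLeft_apply]
    · rw [← one_mul (t i)]
      exact mem_parabolicSpan_gen (one_mem _) ha
    · rw [(commute_of_mem_parabolic hx ha).eq, ← mul_assoc]
      exact parabolicSpan_mul_mem hx ha h1
    · rw [← mul_assoc, ← mul_assoc]
      exact parabolicSpan_mul_mem hx hc (h2 a ha)

theorem parabolic_le_parabolicSpan (H : HeckeSystem α β q (n + 1) t) (hq : q ≠ 0) :
    (parabolic K t (n + 1)).toSubmodule ≤ parabolicSpan q t n := by
  induction n with
  | zero =>
    have h0 : t 0 * t 0 ∈ parabolicSpan q t 0 := by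
      rw [H.sq_zero (by omega)]
      refine Submodule.sub_mem _ (Submodule.smul_mem _ _ ?_)
        (Submodule.smul_mem _ _ (mem_parabolicSpan_left (one_mem _)))
      simpa using mem_parabolicSpan_gen (q := q) (n := 0) (t := t) (K := K) (one_mem _) (one_mem _)
    refine parabolic_le_of_gen (fun i hi => by omega) h0 fun b hb => ?_
    have : b ∈ (⊥ : Subalgebra K R) := by simpa [parabolic] using hb
    obtain ⟨r, rfl⟩ := Algebra.mem_bot.1 this
    rw [Algebra.algebraMap_eq_smul_one, mul_smul_comm, mul_one, smul_mul_assoc]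
    exact Submodule.smul_mem _ _ h0
  | succ n ih =>
    have ht : t (n + 1) ∈ parabolicSpan q t (n + 1) := by
      simpa using mem_parabolicSpan_gen (q := q) (n := n + 1) (t := t) (K := K)
        (one_mem _) (one_mem _)
    have hx : x (n + 1) ∈ parabolicSpan q t (n + 1) := by
      simpa using mem_parabolicSpan_jm (q := q) (n := n + 1) (t := t) (K := K) (one_mem _)
    refine parabolic_le_of_gen (fun i hi => H.commute_jm_low hi (by omega)) ?_ fun b hb => ?_
    · rw [H.gen_mul_jm_succ hq (by omega)]
      refine Submodule.add_mem _ ?_ (Submodule.smul_mem _ _ hx)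
      simpa using mem_parabolicSpan_gen (q := q) (jm_mem_parabolic (q := q) (by omega : n < n + 1))
        (one_mem (parabolic K t (n + 1)))
    suffices parabolicSpan q t n ≤ (parabolicSpan q t (n + 1)).comap
        (LinearMap.mulLeftRight K (t (n + 1), t (n + 1))) by
      simpa using this (ih (H.mono (by omega)) hb)
    have hcomm (a : R) (ha : a ∈ parabolic K t n) : Commute a (t (n + 1)) :=
      commute_of_mem_parabolic (fun i hi => H.commute_far (by omega) (by omega)) ha
    have hle := parabolic_mono (K := K) (t := t) (Nat.le_succ n)
    have hax (a : R) (ha : a ∈ parabolic K t n) :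
        t (n + 1) * (a * x n) * t (n + 1) ∈ parabolicSpan q t (n + 1) := by
      have : t (n + 1) * (a * x n) * t (n + 1) = q • (a * x (n + 1)) := by
        rw [← mul_assoc, ← (hcomm a ha).eq, jm_succ, mul_smul_comm, smul_smul, mul_inv_cancel₀ hq,
          one_smul]
        simp only [mul_assoc]
      rw [this]
      exact Submodule.smul_mem _ _ (mem_parabolicSpan_jm (hle ha))
    refine parabolicSpan_le (fun a ha => ?_) hax fun a ha c hc => ?_ <;>
      rw [Submodule.mem_comap, LinearMap.mulLeftRight_apply]
    · rw [← (hcomm a ha).eq, mul_assoc, H.sq (by omega) (by omega)]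
      exact mul_parabolicSpan_mem (hle ha) (Submodule.add_mem _ (Submodule.smul_mem _ _ ht)
        (Submodule.smul_mem _ _ (mem_parabolicSpan_left (one_mem _))))
    · rcases n with _ | n
      · rw [mul_assoc a, ← (commute_of_mem_parabolic (fun i hi => by omega) hc).eq, ← mul_assoc a]
        exact hax _ (mul_mem ha hc)
      have : t (n + 1 + 1) * (a * t (n + 1) * c) * t (n + 1 + 1) =
          a * t (n + 1) * t (n + 1 + 1) * (t (n + 1) * c) := by
        have h1 := H.braid (n + 1) (by omega) (by omega)
        have h2 := (hcomm a ha).eq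
        have h3 := (hcomm c hc).eq
        calc _ = t (n + 1 + 1) * a * t (n + 1) * (c * t (n + 1 + 1)) := by simp only [mul_assoc]
          _ = a * (t (n + 1 + 1) * t (n + 1) * t (n + 1 + 1)) * c := by
            rw [h3, ← h2]; simp only [mul_assoc]
          _ = _ := by rw [h1]; simp only [mul_assoc]
      rw [this]
      exact mem_parabolicSpan_gen (mul_mem (hle ha) (gen_mem_parabolic (by omega)))
        (mul_mem (gen_mem_parabolic (by omega)) (hle hc))

theorem parabolic_fg (H : HeckeSystem α β q n t) (hq : q ≠ 0) :
    (parabolic K t n).toSubmodule.FG := by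
  induction n with
  | zero =>
    have : parabolic K t 0 = ⊥ := by simp [parabolic]
    rw [this, Algebra.toSubmodule_bot]
    rw [Submodule.one_eq_span]
    exact Submodule.fg_span_singleton _
  | succ n ih =>
    have h := ih (H.mono (by omega))
    have h1 (a : R) := Submodule.fg_span_singleton (R := K) a
    have h2 : (parabolicSpan q t n).FG :=
      (h.sup (h.mul (h1 _))).sup ((h.mul (h1 _)).mul h)
    have : IsNoetherian K (parabolicSpan q t n) := isNoetherian_of_fg_of_noetherian _ h2
    exact Submodule.FG.of_le h2 (parabolic_le_parabolicSpan H hq)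

end fg

end HeckeSystem

section universal

variable (K : Type) [Field K] (α β q : K) (n : ℕ)

/-- The generators of the Hecke algebra, extended by zero. -/
noncomputable def heckeGen (i : ℕ) : HeckeB K α β q n :=
  if h : i < n then RingQuot.mkAlgHom K (HeckeBRel K α β q n) (FreeAlgebra.ι K ⟨i, h⟩) else 0

variable {K α β q n}

theorem heckeGen_of_lt {i : ℕ} (h : i < n) : heckeGen K α β q n i =
    RingQuot.mkAlgHom K (HeckeBRel K α β q n) (FreeAlgebra.ι K ⟨i, h⟩) := dif_pos h

theorem heckeGen_system : HeckeSystem α β q n (heckeGen K α β q n) where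
  quad_zero h := by
    have := RingQuot.mkAlgHom_rel K (HeckeBRel.quad_zero (α := α) (β := β) (q := q) (⟨0, h⟩ : Fin n) rfl)
    simpa [heckeGen_of_lt h, map_mul, map_sub] using this
  quad i h h' := by
    have := RingQuot.mkAlgHom_rel K (HeckeBRel.quad (α := α) (β := β) (q := q) (⟨i, h'⟩ : Fin n) h)
    simpa [heckeGen_of_lt h', map_mul, map_sub] using this
  braid_zero h := by
    have := RingQuot.mkAlgHom_rel K (HeckeBRel.braid_zero (α := α) (β := β) (q := q) (⟨0, by omega⟩ : Fin n) ⟨1, h⟩ rfl rfl)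
    simpa [heckeGen_of_lt h, heckeGen_of_lt (show 0 < n by omega), map_mul, map_sub] using this
  braid i h h' := by
    have := RingQuot.mkAlgHom_rel K (HeckeBRel.braid (α := α) (β := β) (q := q) (⟨i, by omega⟩ : Fin n) ⟨i + 1, h'⟩ h rfl)
    simpa [heckeGen_of_lt h', heckeGen_of_lt (show i < n by omega), map_mul, map_sub] using this
  comm i j h h' := by
    have := RingQuot.mkAlgHom_rel K (HeckeBRel.comm (α := α) (β := β) (q := q) (⟨i, by omega⟩ : Fin n) ⟨j, h'⟩ h)
    simpa [heckeGen_of_lt h', heckeGen_of_lt (show i < n by omega), map_mul, map_sub] using this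

theorem HeckeSystem.exists_algHom {R : Type*} [Ring R] [Algebra K R] {t : ℕ → R}
    (H : HeckeSystem α β q n t) :
    ∃ ρ : HeckeB K α β q n →ₐ[K] R, ∀ i < n, ρ (heckeGen K α β q n i) = t i := by
  refine ⟨RingQuot.liftAlgHom K ⟨FreeAlgebra.lift K fun i : Fin n => t i, fun a b h => ?_⟩,
    fun i hi => by rw [heckeGen_of_lt hi, RingQuot.liftAlgHom_mkAlgHom_apply]; simp⟩
  cases h with
  | quad_zero i hi =>
    have := H.quad_zero (by omega)
    simpa [hi] using this
  | quad i hi => simpa using H.quad i hi i.2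
  | braid_zero i j hi hj => simpa [hi, hj] using H.braid_zero (by omega)
  | braid i j hi hij => simpa [hij] using H.braid i hi (by omega)
  | comm i j h => simpa using H.comm i j h j.2

theorem heckeGen_induction {p : HeckeB K α β q n → Prop} (h0 : ∀ r, p (algebraMap K _ r))
    (hadd : ∀ a b, p a → p b → p (a + b)) (hmul : ∀ a b, p a → p b → p (a * b))
    (hgen : ∀ i < n, p (heckeGen K α β q n i)) (a : HeckeB K α β q n) : p a := by
  obtain ⟨a, rfl⟩ := RingQuot.mkAlgHom_surjective K (HeckeBRel K α β q n) a
  induction a using FreeAlgebra.induction with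
  | grade0 r => rw [AlgHom.commutes]; exact h0 r
  | grade1 i => rw [← heckeGen_of_lt i.2]; exact hgen i i.2
  | mul a b h h' => rw [map_mul]; exact hmul _ _ h h'
  | add a b h h' => rw [map_add]; exact hadd _ _ h h'

theorem finiteDimensional_heckeB (hq : q ≠ 0) : FiniteDimensional K (HeckeB K α β q n) := by
  have h : HeckeSystem.parabolic K (heckeGen K α β q n) n = ⊤ := by
    rw [eq_top_iff]
    intro a _
    induction a using heckeGen_induction with
    | h0 r => exact Subalgebra.algebraMap_mem _ r
    | hadd _ _ h h' => exact add_mem (h trivial) (h' trivial)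
    | hmul _ _ h h' => exact mul_mem (h trivial) (h' trivial)
    | hgen i hi => exact HeckeSystem.gen_mem_parabolic hi
  have := HeckeSystem.parabolic_fg (heckeGen_system (K := K) (α := α) (β := β) (q := q) (n := n)) hq
  rw [h] at this
  exact ⟨by simpa using this⟩

end universal

/-- Finiteness of the number of indecomposable representations. -/
def FiniteType (K : Type) [Field K] (α β q : K) (n : ℕ) : Prop :=
  ∃ (ι : Type) (_ : Finite ι) (L : ι → HeckeRep K α β q n),
    ∀ M : HeckeRep K α β q n, IsIndecRep n M.t → ∃ i, M.Iso (L i)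

section trace

variable {K R S : Type*} [Field K] [Ring R] [Algebra K R] [Ring S] [Algebra K S] {α β q : K}

theorem jmTrace_map (φ : R →ₐ[K] S) {t : ℕ → R} (n : ℕ) (h : R) :
    φ (jmTrace α β q t n h) = jmTrace α β q (fun i => φ (t i)) n (φ h) := by
  induction n generalizing h with
  | zero => simp [HeckeSystem.jmTrace_zero]
  | succ n ih =>
    rw [HeckeSystem.jmTrace_succ, HeckeSystem.jmTrace_succ, map_add, ih, map_sub, HeckeSystem.jucysMurphy_map]
    simp only [map_smul, map_mul]

theorem jmTrace_prod {t : ℕ → R} {s : ℕ → S} (n : ℕ) (h : R × S) :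
    jmTrace α β q (fun i => (t i, s i)) n h =
      (jmTrace α β q t n h.1, jmTrace α β q s n h.2) :=
  Prod.ext (jmTrace_map (AlgHom.fst K R S) n h) (jmTrace_map (AlgHom.snd K R S) n h)

end trace

namespace HeckeRep

variable {K : Type} [Field K] {α β q : K} {n : ℕ}

/-- Coinduction from `Hₙ` to `Hₙ₊₁`. -/
theorem exists_coinduced (hq : q ≠ 0) (N : HeckeRep K α β q n) :
    ∃ (C : HeckeRep K α β q (n + 1)) (ev : C.V →ₗ[K] N.V), IsRepHom n C.t N.t ev ∧
      ∀ (M : HeckeRep K α β q (n + 1)) (b : M.V →ₗ[K] N.V), IsRepHom n M.t N.t b →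
        ∃ b' : M.V →ₗ[K] C.V, IsRepHom (n + 1) M.t C.t b' ∧ ev ∘ₗ b' = b := by
  set A := HeckeB K α β q (n + 1)
  have hA : FiniteDimensional K A := finiteDimensional_heckeB hq
  set T : ℕ → A := heckeGen K α β q (n + 1)
  let Ψ : A →ₐ[K] Module.End K (A →ₗ[K] N.V) := AlgHom.ofLinearMap
    ((LinearMap.llcomp K A A N.V).flip ∘ₗ (LinearMap.mul K A).flip)
    (by ext φ a; simp) (fun a b => by ext φ c; simp [mul_assoc])
  have hΨ (a : A) (φ : A →ₗ[K] N.V) (b : A) : Ψ a φ b = φ (b * a) := rfl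
  let C : Submodule K (A →ₗ[K] N.V) :=
    { carrier := {φ | ∀ i < n, ∀ a, φ (T i * a) = N.t i (φ a)}
      add_mem' := fun h h' i hi a => by simp [h i hi a, h' i hi a]
      zero_mem' := fun i _ a => by simp
      smul_mem' := fun c φ h i hi a => by simp [h i hi a] }
  have hC (φ : C) (i : ℕ) (hi : i < n) (a : A) : φ.1 (T i * a) = N.t i (φ.1 a) := φ.2 i hi a
  let t : ℕ → Module.End K C := fun i => (Ψ (T i)).restrict (p := C) (q := C)
    fun φ h j hj a => by rw [hΨ, hΨ, mul_assoc, h j hj]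
  have ht (i : ℕ) (φ : C) (a : A) : (t i φ).1 a = φ.1 (a * T i) := rfl
  have hsub : IsRepHom (n + 1) t (fun i => Ψ (T i)) C.subtype := fun i _ φ => rfl
  let ev : C →ₗ[K] N.V := LinearMap.applyₗ 1 ∘ₗ C.subtype
  have hev (φ : C) : ev φ = φ.1 1 := rfl
  refine ⟨⟨C, t, (heckeGen_system.map Ψ).of_injective hsub Subtype.val_injective⟩, ev,
    fun i hi φ => ?_, fun M b hb => ?_⟩
  · change ev (t i φ) = _
    rw [hev, ht, one_mul, ← mul_one (T i), hC φ i hi]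
    rfl
  · obtain ⟨ρ, hρ⟩ := M.sys.exists_algHom
    let b' : M.V →ₗ[K] C := LinearMap.codRestrict C
      ((LinearMap.llcomp K A M.V N.V b) ∘ₗ ρ.toLinearMap.flip) fun v i hi a => by
        simp only [LinearMap.comp_apply, LinearMap.llcomp_apply, LinearMap.flip_apply,
          AlgHom.toLinearMap_apply, map_mul, Module.End.mul_apply, T]
        rw [hρ i (by omega), hb i hi]
    have hb' (v : M.V) (a : A) : (b' v).1 a = b (ρ a v) := rfl
    refine ⟨b', fun i hi v => ?_, ?_⟩
    · refine Subtype.ext (LinearMap.ext fun a => ?_)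
      change (b' _).1 a = (t i (b' v)).1 a
      rw [ht, hb', hb', map_mul, hρ i hi]
      rfl
    · ext v
      change (b' v).1 1 = _
      rw [hb', map_one]
      rfl

theorem exists_trace_lift (hq : q ≠ 0) (hα : α * β ≠ 0) (C M : HeckeRep K α β q (n + 1))
    {a : C.V →ₗ[K] M.V} (ha : IsRepHom n C.t M.t a) :
    ∃ a' : C.V →ₗ[K] M.V, IsRepHom (n + 1) C.t M.t a' ∧ ∀ b : M.V →ₗ[K] C.V,
      IsRepHom (n + 1) M.t C.t b → a' ∘ₗ b = jmTrace α β q M.t (n + 1) (a ∘ₗ b) := by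
  let Φ := LinearMap.prodMapAlgHom K C.V M.V
  have H := (C.sys.prod M.sys).map Φ
  set s : ℕ → Module.End K (C.V × M.V) := fun i => Φ (C.t i, M.t i)
  have hs (i : ℕ) (v : C.V × M.V) : s i v = (C.t i v.1, M.t i v.2) := rfl
  let h : Module.End K (C.V × M.V) := LinearMap.inr K C.V M.V ∘ₗ a ∘ₗ LinearMap.fst K C.V M.V
  have hh : ∀ i, i + 1 < n + 1 → Commute (s i) h := fun i hi => by
    refine LinearMap.ext fun v => ?_
    simp [hs, h, ha i (by omega)]
  have htr := H.commute_jmTrace_gen hq hα hh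
  refine ⟨LinearMap.snd K _ _ ∘ₗ jmTrace α β q s (n + 1) h ∘ₗ LinearMap.inl K _ _,
    fun i hi v => ?_, fun b hb => ?_⟩
  · have := congrArg Prod.snd (LinearMap.congr_fun (htr i hi).eq (v, 0))
    simp only [Module.End.mul_apply, hs, map_zero] at this
    exact this.symm
  · let u : Module.End K (C.V × M.V) := LinearMap.inl K C.V M.V ∘ₗ b ∘ₗ LinearMap.snd K C.V M.V
    have hu : ∀ i < n + 1, Commute u (s i) := fun i hi => by
      refine LinearMap.ext fun v => ?_
      simp [hs, u, hb i hi]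
    have h1 : h * u = Φ (0, a ∘ₗ b) := by
      refine LinearMap.ext fun v => ?_
      simp [h, u, Φ]
    have h2 := HeckeSystem.jmTrace_mul_right (α := α) (β := β) (q := q) hu h
    rw [h1, ← jmTrace_map, jmTrace_prod] at h2
    ext v
    exact (congrArg Prod.snd (LinearMap.congr_fun h2 (0, v))).symm

theorem exists_decomposition_res (M : HeckeRep K α β q (n + 1)) :
    ∃ (ι : Type) (_ : Fintype ι) (N : ι → HeckeRep K α β q n) (a : ∀ k, (N k).V →ₗ[K] M.V)
      (b : ∀ k, M.V →ₗ[K] (N k).V), (∀ k, IsIndecRep n (N k).t) ∧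
      (∀ k, IsRepHom n (N k).t M.t (a k)) ∧ (∀ k, IsRepHom n M.t (N k).t (b k)) ∧
      ∑ k, a k ∘ₗ b k = LinearMap.id :=
  (M.res (Nat.le_succ n)).exists_decomposition

theorem exists_of_trace (hq : q ≠ 0) (hα : α * β ≠ 0) (h : FiniteType K α β q n) :
    ∃ (ι : Type) (_ : Finite ι) (L : ι → HeckeRep K α β q (n + 1)),
      ∀ M : HeckeRep K α β q (n + 1), IsIndecRep (n + 1) M.t →
        ∀ θ, IsRepHom n M.t M.t θ → ¬ IsNilpotent (jmTrace α β q M.t (n + 1) θ) →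
          ∃ i, M.Iso (L i) := by
  obtain ⟨ι, hι, L, hL⟩ := h
  choose C ev hev hC using fun i => (L i).exists_coinduced hq
  choose ι' hι' D a b hD ha hb hab using fun i => (C i).exists_decomposition
  refine ⟨Σ i, ι' i, inferInstance, fun i => D i.1 i.2, fun M hM θ hθ hn => ?_⟩
  obtain ⟨κ, hκ, N, a₀, b₀, hN, ha₀, hb₀, hab₀⟩ := M.exists_decomposition_res
  have htr (θ : Module.End K M.V) (hθ : IsRepHom n M.t M.t θ) :
      IsRepHom (n + 1) M.t M.t (jmTrace α β q M.t (n + 1) θ) :=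
    IsRepHom.iff_commute.2 (M.sys.commute_jmTrace_gen hq hα
      fun i hi => IsRepHom.iff_commute.1 hθ i (by omega))
  have hu := (hM.isNilpotent_or_isUnit (htr θ hθ)).resolve_left hn
  have hsum : jmTrace α β q M.t (n + 1) θ =
      ∑ k, jmTrace α β q M.t (n + 1) (θ ∘ₗ a₀ k ∘ₗ b₀ k) := by
    rw [← map_sum]
    congr 1
    ext v
    have := congrArg θ (LinearMap.congr_fun hab₀ v)
    simp only [LinearMap.sum_apply, LinearMap.comp_apply, map_sum, LinearMap.id_apply] at this ⊢
    exact this.symm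
  rw [hsum] at hu
  have hk₀ (k : κ) : IsRepHom n M.t M.t (θ ∘ₗ a₀ k ∘ₗ b₀ k) := hθ.comp ((ha₀ k).comp (hb₀ k))
  obtain ⟨k, -, hk⟩ := hM.isUnit_of_isUnit_sum (fun k _ => htr _ (hk₀ k)) hu
  obtain ⟨i, e, he⟩ := hL (N k) (hN k)
  obtain ⟨e', he'⟩ : ∃ e' : (L i).V ≃ₗ[K] (N k).V, IsRepHom n (L i).t (N k).t e' ∧
      ∀ v, e' (e v) = v := by
    refine ⟨e.symm, fun j hj v => ?_, fun v => e.symm_apply_apply v⟩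
    have := he j hj (e.symm v)
    simp only [LinearEquiv.coe_coe, LinearEquiv.apply_symm_apply] at this
    simp [← this]
  obtain ⟨b', hb', hev'⟩ := hC i M (e.toLinearMap ∘ₗ b₀ k) (he.comp (hb₀ k))
  obtain ⟨a', ha', hab'⟩ := exists_trace_lift hq hα (C i) M
    (a := (θ ∘ₗ a₀ k ∘ₗ e'.toLinearMap) ∘ₗ ev i)
    ((hθ.comp ((ha₀ k).comp he'.1)).comp (hev i))
  have h1 : ((θ ∘ₗ a₀ k ∘ₗ e'.toLinearMap) ∘ₗ ev i) ∘ₗ b' = θ ∘ₗ a₀ k ∘ₗ b₀ k := by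
    rw [LinearMap.comp_assoc, hev']
    ext v
    simp [he'.2]
  rw [← h1, ← hab' b' hb'] at hk
  have h2 : a' ∘ₗ b' = ∑ l, (a' ∘ₗ a i l) ∘ₗ (b i l ∘ₗ b') := by
    ext v
    have := congrArg a' (LinearMap.congr_fun (hab i) (b' v))
    simp only [LinearMap.sum_apply, LinearMap.comp_apply, map_sum, LinearMap.id_apply] at this ⊢
    exact this.symm
  rw [h2] at hk
  have hG (l) : IsRepHom (n + 1) (D i l).t M.t (a' ∘ₗ a i l) := ha'.comp (ha i l)
  have hF (l) : IsRepHom (n + 1) M.t (D i l).t (b i l ∘ₗ b') := (hb i l).comp hb'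
  obtain ⟨l, -, hl⟩ := hM.isUnit_of_isUnit_sum (fun l _ => (hG l).comp (hF l)) hk
  have := hM.1
  exact ⟨⟨i, l⟩, hM.exists_equiv (hD i l) (hF l) (hG l) fun h => h.not_isUnit hl⟩

end HeckeRep

section runs

variable {K : Type*} [Field K] {q : K} {n f : ℕ}

theorem injOn_mul_pow (hq : q ≠ 0) {m : ℕ} (h : ∀ k, 0 < k → k ≤ m → q ^ k ≠ 1) {y : K}
    (hy : y ≠ 0) : Set.InjOn (fun j : ℕ => y * q ^ j) (Finset.range (m + 1)) := by
  have key (i j : ℕ) (hij : i < j) (hj : j ≤ m) : y * q ^ i ≠ y * q ^ j := fun e => by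
    have e := mul_left_cancel₀ hy e
    refine h (j - i) (by omega) (by omega) ?_
    rw [show j = i + (j - i) by omega, pow_add] at e
    exact (mul_left_cancel₀ (pow_ne_zero i hq) ((mul_one _).trans e)).symm
  intro i hi j hj e
  simp only [Finset.coe_range, Set.mem_Iio] at hi hj
  rcases lt_trichotomy i j with h | h | h
  exacts [(key i j h (by omega) e).elim, h, (key j i h (by omega) e.symm).elim]

theorem sum_mul_pow_le {D : K → ℕ} (hD : ∀ S : Finset K, ∑ y ∈ S, D y ≤ n) (hq : q ≠ 0) {m : ℕ}
    (h : ∀ k, 0 < k → k ≤ m → q ^ k ≠ 1) {y : K} (hy : y ≠ 0) :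
    ∑ j ∈ Finset.range (m + 1), D (y * q ^ j) ≤ n := by
  classical
  rw [← Finset.sum_image (f := D) (g := fun j : ℕ => y * q ^ j)]
  · exact hD _
  · exact injOn_mul_pow hq h hy

/-- The maximal values of a multiplicity function form geometric progressions with prescribed
endpoints. -/
theorem exists_run {D : K → ℕ} (hD : ∀ S : Finset K, ∑ y ∈ S, D y ≤ n) (hq : q ≠ 0)
    (he : ∀ k, 0 < k → q ^ k = 1 → n < k ∧ 2 * f ≤ k) [DecidableEq K]
    (hc : ∀ y, y ≠ 0 → 2 * D y ≤ (if y = 1 then 1 else 0) + (if y = q ^ f then 1 else 0) +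
      (D (q⁻¹ * y) + D (q * y))) {d : ℕ} (hd : 0 < d) (hmax : ∀ y, D y ≤ d) {x : K} (hx : x ≠ 0)
    (hxd : D x = d) : ∃ (y : K) (g b : ℕ), y ≠ 0 ∧ b ≤ g ∧ x = y * q ^ b ∧
      (∀ j ≤ g, D (y * q ^ j) = d) ∧ D (y * q ^ (g + 1)) < d ∧ (g + 1) * d ≤ n ∧ f ≤ g ∧
      (y = 1 ∧ y * q ^ g = q ^ f ∨ y = q ^ f ∧ y * q ^ g = 1) ∧
      d ≤ D (q⁻¹ * y) + 1 ∧ d ≤ D (y * q ^ (g + 1)) + 1 := by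
  have he' : ∀ k, 0 < k → k ≤ n → q ^ k ≠ 1 := fun k h h' h1 => by
    have := he k h h1; omega
  have bound {m : ℕ} {y : K} (hy : y ≠ 0) (hm : ∀ j ≤ m, D (y * q ^ j) = d) : (m + 1) * d ≤ n := by
    have h1 (m : ℕ) (hmn : m ≤ n) (hm : ∀ j ≤ m, D (y * q ^ j) = d) : (m + 1) * d ≤ n := by
      have := sum_mul_pow_le hD hq (fun k h h' => he' k h (h'.trans hmn)) hy
      rwa [Finset.sum_congr rfl fun j hj => hm j (by simp at hj; omega), Finset.sum_const,
        Finset.card_range, smul_eq_mul] at this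
    rcases le_or_gt m n with h | h
    · exact h1 m h hm
    · have := h1 n le_rfl fun j hj => hm j (by omega)
      nlinarith
  have hup : ∃ i, D (x * q ^ (i + 1)) < d := by
    by_contra! h
    have : (n + 1) * d ≤ n := bound hx fun j hj => by
      rcases j with - | j
      · simpa using hxd
      · exact (hmax _).antisymm (h j)
    nlinarith
  have hdown : ∃ i, D (x * (q ^ (i + 1))⁻¹) < d := by
    by_contra! h
    have : (n + 1) * d ≤ n := bound (y := x * (q ^ n)⁻¹) (by simp [hx, hq]) fun j hj => by
      have e : x * (q ^ n)⁻¹ * q ^ j = x * (q ^ (n - j))⁻¹ := by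
        have : q ^ n = q ^ (n - j) * q ^ j := by rw [← pow_add]; congr 1; omega
        rw [this]; field_simp
      rw [e]
      rcases hi : n - j with - | i
      · simpa using hxd
      · exact (hmax _).antisymm (h i)
    nlinarith
  obtain ⟨a, ha, ha'⟩ : ∃ a, D (x * q ^ (a + 1)) < d ∧ ∀ i < a, D (x * q ^ (i + 1)) = d :=
    ⟨Nat.find hup, Nat.find_spec hup,
      fun i hi => (hmax _).antisymm (not_lt.1 (Nat.find_min hup hi))⟩
  obtain ⟨b, hb, hb'⟩ : ∃ b, D (x * (q ^ (b + 1))⁻¹) < d ∧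
      ∀ i < b, D (x * (q ^ (i + 1))⁻¹) = d :=
    ⟨Nat.find hdown, Nat.find_spec hdown,
      fun i hi => (hmax _).antisymm (not_lt.1 (Nat.find_min hdown hi))⟩
  obtain ⟨y, rfl⟩ : ∃ y, x = y * q ^ b := ⟨x * (q ^ b)⁻¹, by field_simp⟩
  have hy : y ≠ 0 := left_ne_zero_of_mul hx
  have hrun : ∀ j ≤ a + b, D (y * q ^ j) = d := fun j hj => by
    rcases lt_trichotomy j b with h | rfl | h
    · rw [← hb' (b - j - 1) (by omega), show b - j - 1 + 1 = b - j by omega]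
      congr 1
      have : q ^ b = q ^ (b - j) * q ^ j := by rw [← pow_add]; congr 1; omega
      rw [this]; field_simp
    · exact hxd
    · rw [← ha' (j - b - 1) (by omega), show j - b - 1 + 1 = j - b by omega, mul_assoc, ← pow_add]
      congr 3; omega
  have hlow : D (q⁻¹ * y) < d := by
    convert hb using 2
    field_simp; ring
  have hhigh : D (y * q ^ (a + b + 1)) < d := by
    convert ha using 2
    ring
  have hgn := bound hy hrun
  set g := a + b with hg
  clear_value g
  have h1 := hc y hy
  have h2 := hc (y * q ^ g) (by simp [hy, hq])
  rw [hrun g le_rfl, show q * (y * q ^ g) = y * q ^ (g + 1) by ring] at h2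
  rw [show D y = d by simpa using hrun 0 (by omega)] at h1
  have hgn' : g < n := by nlinarith
  refine ⟨y, g, b, hy, by omega, rfl, hrun, hhigh, hgn, ?_⟩
  rcases Nat.eq_zero_or_pos g with h0 | h0
  · rw [h0] at h2 hhigh ⊢
    simp only [pow_zero, mul_one, zero_add, pow_one] at h2 hhigh ⊢
    rw [mul_comm q y] at h1
    have hy1 : y = 1 := by by_contra h; rw [if_neg h] at h1; split_ifs at h1 <;> omega
    have hyf : y = q ^ f := by by_contra h; rw [if_neg h] at h1; split_ifs at h1; omega
    rw [if_pos hy1, if_pos hyf] at h1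
    refine ⟨?_, .inl ⟨hy1, hyf⟩, by omega, by omega⟩
    by_contra h
    have := he f (by omega) (hyf ▸ hy1)
    omega
  · have e1 : D (q * y) = d := by rw [mul_comm]; simpa using hrun 1 h0
    have e2 : D (q⁻¹ * (y * q ^ g)) = d := by
      rw [← hrun (g - 1) (by omega)]
      congr 1
      have : q ^ g = q ^ (g - 1) * q := by rw [← pow_succ]; congr 1; omega
      rw [this]; field_simp
    rw [e1] at h1
    rw [e2] at h2
    have hne : y * q ^ g ≠ y := fun h =>
      he' g h0 hgn'.le (mul_left_cancel₀ hy (h.trans (mul_one y).symm))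
    have hy1 : y = 1 ∨ y = q ^ f := by
      by_contra! h; rw [if_neg h.1, if_neg h.2] at h1; omega
    have hy2 : y * q ^ g = 1 ∨ y * q ^ g = q ^ f := by
      by_contra! h; rw [if_neg h.1, if_neg h.2] at h2; omega
    have hE : y = 1 ∧ y * q ^ g = q ^ f ∨ y = q ^ f ∧ y * q ^ g = 1 := by
      rcases hy1 with h | h <;> rcases hy2 with h' | h'
      · exact (hne (h'.trans h.symm)).elim
      · exact .inl ⟨h, h'⟩
      · exact .inr ⟨h, h'⟩
      · exact (hne (h'.trans h.symm)).elim
    have hne1 : (1 : K) ≠ q ^ f := by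
      rcases hE with h | h
      · intro h3; exact hne (by rw [h.2, ← h3, h.1])
      · intro h3; exact hne (by rw [h.2, h3, h.1])
    refine ⟨?_, hE, ?_, ?_⟩
    · rcases hE with ⟨h, h'⟩ | ⟨h, h'⟩
      · by_contra hlt
        rw [h, one_mul, show f = g + (f - g) by omega, pow_add] at h'
        have := he (f - g) (by omega)
          (mul_left_cancel₀ (pow_ne_zero g hq) (h'.symm.trans (mul_one _).symm))
        omega
      · rw [h, ← pow_add] at h'
        have := he (f + g) (by omega) h'
        omega
    · split_ifs at h1 with h3 h4
      · exact (hne1 (h3 ▸ h4)).elim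
      all_goals omega
    · split_ifs at h2 with h3 h4
      · exact (hne1 (h3 ▸ h4)).elim
      all_goals omega

theorem weights_eq_run (hq : q ≠ 0) (he : ∀ k, 0 < k → q ^ k = 1 → n < k ∧ 2 * f ≤ k)
    (hn : 0 < n) (hnf : n < 2 * f + 4) [DecidableEq K] {c : ℕ → K} (hc0 : ∀ k < n, c k ≠ 0)
    (hc : ∀ y, y ≠ 0 → 2 * ({k ∈ Finset.range n | c k = y} : Finset ℕ).card ≤
      (if y = 1 then 1 else 0) + (if y = q ^ f then 1 else 0) +
      (({k ∈ Finset.range n | c k = q⁻¹ * y} : Finset ℕ).card +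
        ({k ∈ Finset.range n | c k = q * y} : Finset ℕ).card)) :
    ∃ (r : K) (g : ℕ), n = g + 1 ∧ (r = 1 ∧ r * q ^ g = q ^ f ∨ r = q ^ f ∧ r * q ^ g = 1) ∧
      Set.InjOn c (Finset.range n) ∧ ∀ k < n, ∃ j ≤ g, c k = r * q ^ j := by
  let D : K → ℕ := fun y => ({k ∈ Finset.range n | c k = y} : Finset ℕ).card
  have hD (S : Finset K) : ∑ y ∈ S, D y ≤ n := by
    rw [← Finset.card_biUnion]
    · exact (Finset.card_le_card (Finset.biUnion_subset.2 fun _ _ => Finset.filter_subset _ _)).trans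
        (Finset.card_range n).le
    · intro a _ b _ hab
      rw [Function.onFun, Finset.disjoint_filter]
      rintro k - rfl
      exact hab
  have hDc (k : ℕ) (hk : k < n) : 0 < D (c k) :=
    Finset.card_pos.2 ⟨k, by simp [hk]⟩
  obtain ⟨k₀, hk₀, hmax⟩ := Finset.exists_max_image (Finset.range n) (fun k => D (c k))
    ⟨0, by simpa using hn⟩
  have hk₀ : k₀ < n := by simpa using hk₀
  have hmax (y : K) : D y ≤ D (c k₀) := by
    rcases Finset.eq_empty_or_nonempty ({k ∈ Finset.range n | c k = y} : Finset ℕ) with h | ⟨k, hk⟩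
    · simp [D, h]
    · simp only [Finset.mem_filter] at hk
      exact hk.2 ▸ hmax k hk.1
  obtain ⟨d, hd⟩ : ∃ d, D (c k₀) = d := ⟨_, rfl⟩
  have hpos : 0 < d := hd ▸ hDc k₀ hk₀
  rw [hd] at hmax
  obtain ⟨y, g, b, hy, hb, hxy, hrun, hhigh, hgn, hfg, hE, h1, h2⟩ :=
    exists_run hD hq he hc hpos hmax (hc0 k₀ hk₀) hd
  have hd1 : d = 1 := by
    by_contra hd1
    have hd2 : 2 ≤ d := by omega
    have h2gn : (g + 1) * 2 ≤ n := (Nat.mul_le_mul_left _ hd2).trans hgn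
    have h3 := sum_mul_pow_le hD hq (m := g + 2) (fun k h h' h1 => by
      have := he k h h1; omega) (mul_ne_zero (inv_ne_zero hq) hy)
    have e (j : ℕ) : q⁻¹ * y * q ^ (j + 1) = y * q ^ j := by
      rw [pow_succ]; field_simp
    rw [Finset.sum_range_succ, Finset.sum_range_succ', e, pow_zero, mul_one] at h3
    rw [Finset.sum_congr rfl fun j hj => (congrArg D (e j)).trans (hrun j (by simp at hj; omega)),
      Finset.sum_const, Finset.card_range, smul_eq_mul] at h3
    nlinarith
  subst hd1
  have hinj : Set.InjOn c (Finset.range n) := fun i hi j hj hij =>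
    Finset.card_le_one.1 (hmax (c i)) i (by simpa using hi) j (by simpa [hij] using hj)
  have hval : ∀ k < n, ∃ j ≤ g, c k = y * q ^ j := fun k hk => by
    have hk1 : D (c k) = 1 := le_antisymm (hmax _) (hDc k hk)
    obtain ⟨y', g', b', hy', hb', hxy', hrun', -, -, -, hE', -⟩ :=
      exists_run hD hq he hc hpos hmax (hc0 k hk) hk1
    have : y' = y ∨ y' = y * q ^ g := by
      rcases hE with ⟨h, h'⟩ | ⟨h, h'⟩ <;> rcases hE' with ⟨h3, -⟩ | ⟨h3, -⟩ <;>
        simp [h, h3] <;> simp_all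
    rcases this with rfl | rfl
    · refine ⟨b', ?_, hxy'⟩
      by_contra hlt
      exact hhigh.ne (hrun' (g + 1) (by omega))
    · rcases Nat.eq_zero_or_pos g' with h0 | h0
      · refine ⟨g, le_rfl, ?_⟩
        rw [hxy', show b' = 0 by omega, pow_zero, mul_one]
      · exfalso
        apply hhigh.ne
        rw [pow_succ, ← mul_assoc]
        simpa using hrun' 1 h0
  refine ⟨y, g, ?_, hE, hinj, hval⟩
  refine le_antisymm ?_ (by omega)
  have := Finset.card_le_card_of_injOn (s := Finset.range n)
    (t := (Finset.range (g + 1)).image fun j => y * q ^ j) c (fun k hk => by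
      obtain ⟨j, hj, h⟩ := hval k (by simpa using hk)
      simp only [Finset.coe_image, Set.mem_image, Finset.mem_coe, Finset.mem_range]
      exact ⟨j, by omega, h.symm⟩) hinj
  rw [Finset.card_range] at this
  exact this.trans (Finset.card_image_le.trans (Finset.card_range _).le)

end runs

/-- The number of `false` among the first `k` bits. -/
def zeros (b : ℕ → Bool) : ℕ → ℕ
  | 0 => 0
  | k + 1 => zeros b k + if b k then 0 else 1

/-- The `k`-th letter of the word on `0, …, g` obtained by removing letters from the left or from
the right end of the interval, as prescribed by the bits. -/
def letter (g : ℕ) (b : ℕ → Bool) (k : ℕ) : ℕ := if b k then g - (k - zeros b k) else zeros b k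

section bits

variable {b : ℕ → Bool} {g : ℕ}

theorem zeros_succ_true {k : ℕ} (h : b k = true) : zeros b (k + 1) = zeros b k := by
  simp [zeros, h]

theorem zeros_succ_false {k : ℕ} (h : b k = false) : zeros b (k + 1) = zeros b k + 1 := by
  simp [zeros, h]

theorem zeros_le (k : ℕ) : zeros b k ≤ k := by
  induction k with
  | zero => exact le_rfl
  | succ k ih => rw [zeros]; split_ifs <;> omega

theorem zeros_congr {b' : ℕ → Bool} {m : ℕ} (h : ∀ k < m, b k = b' k) : zeros b m = zeros b' m := by
  induction m with
  | zero => rfl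
  | succ m ih => rw [zeros, zeros, ih fun k hk => h k (by omega), h m (by omega)]

theorem letter_true {k : ℕ} (h : b k = true) : letter g b k = g - (k - zeros b k) := by
  simp [letter, h]

theorem letter_false {k : ℕ} (h : b k = false) : letter g b k = zeros b k := by
  simp [letter, h]

theorem letter_le {k : ℕ} (hk : k ≤ g) : letter g b k ≤ g := by
  have := zeros_le (b := b) k
  rw [letter]; split_ifs <;> omega

theorem exists_letter_eq {m i : ℕ} (h : i < zeros b m) : ∃ k < m, letter g b k = i := by
  induction m with
  | zero => simp [zeros] at h
  | succ m ih =>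
    by_cases hi : i < zeros b m
    · obtain ⟨k, hk, e⟩ := ih hi
      exact ⟨k, by omega, e⟩
    · cases hb : b m with
      | true => rw [zeros_succ_true hb] at h; omega
      | false =>
        rw [zeros_succ_false hb] at h
        exact ⟨m, by omega, by rw [letter_false hb]; omega⟩

theorem exists_letter_eq_sub {m i : ℕ} (h : i < m - zeros b m) : ∃ k < m, letter g b k = g - i := by
  induction m with
  | zero => simp at h
  | succ m ih =>
    by_cases hi : i < m - zeros b m
    · obtain ⟨k, hk, e⟩ := ih hi
      exact ⟨k, by omega, e⟩
    · have := zeros_le (b := b) m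
      cases hb : b m with
      | false => rw [zeros_succ_false hb] at h; omega
      | true =>
        rw [zeros_succ_true hb] at h
        exact ⟨m, by omega, by rw [letter_true hb]; congr 1; omega⟩

/-- Exchange of the bits `k` and `k + 1`. -/
def swapBits (k : ℕ) (b : ℕ → Bool) (i : ℕ) : Bool := b (Equiv.swap k (k + 1) i)

theorem swapBits_left (k : ℕ) : swapBits k b k = b (k + 1) := by simp [swapBits]

theorem swapBits_right (k : ℕ) : swapBits k b (k + 1) = b k := by simp [swapBits]

theorem swapBits_of_ne {k i : ℕ} (h : i ≠ k) (h' : i ≠ k + 1) : swapBits k b i = b i := by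
  rw [swapBits, Equiv.swap_apply_of_ne_of_ne h h']

theorem zeros_swapBits {k i : ℕ} (h : i ≠ k + 1) : zeros (swapBits k b) i = zeros b i := by
  rcases Nat.lt_or_ge k i with hk | hk
  · obtain ⟨j, rfl⟩ : ∃ j, i = k + 2 + j := ⟨i - (k + 2), by omega⟩
    induction j with
    | zero =>
      rw [add_zero, zeros, zeros, zeros, zeros, swapBits_left, swapBits_right,
        zeros_congr (b' := b) fun i hi => swapBits_of_ne (by omega) (by omega)]
      omega
    | succ j ih =>
      rw [show k + 2 + (j + 1) = k + 2 + j + 1 by omega, zeros, zeros, ih (by omega) (by omega),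
        swapBits_of_ne (by omega) (by omega)]
  · exact zeros_congr fun i hi => swapBits_of_ne (by omega) (by omega)

theorem letter_swapBits {k : ℕ} (h : b k ≠ b (k + 1)) (i : ℕ) :
    letter g (swapBits k b) i = letter g b (Equiv.swap k (k + 1) i) := by
  have hz := zeros_le (b := b) k
  rcases eq_or_ne i k with rfl | h1
  · rw [Equiv.swap_apply_left, letter, letter, swapBits_left, zeros_swapBits (by omega)]
    cases hb : b (i + 1) with
    | true =>
      rw [zeros_succ_false (by simpa [hb] using h)]
      simp only [if_true]; congr 1; omega
    | false => rw [zeros_succ_true (by simpa [hb] using h)]; simp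
  rcases eq_or_ne i (k + 1) with rfl | h2
  · rw [Equiv.swap_apply_right, letter, letter, swapBits_right, zeros, swapBits_left,
      zeros_swapBits (by omega)]
    cases hb : b k with
    | true =>
      have hb' : b (k + 1) = false := by simpa [hb] using h.symm
      simp only [hb', if_true]; congr 1; simp
    | false =>
      have hb' : b (k + 1) = true := by simpa [hb] using h.symm
      simp [hb']
  · rw [Equiv.swap_apply_of_ne_of_ne h1 h2, letter, letter, swapBits_of_ne h1 h2, zeros_swapBits h2]

end bits

section weights

variable {K V : Type*} [Field K] [AddCommGroup V] [Module K V]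

/-- Joint eigenspaces of the first `m` Jucys-Murphy elements. -/
def wtSpace (q : K) (t : ℕ → Module.End K V) (m : ℕ) (c : ℕ → K) : Submodule K V where
  carrier := {v | ∀ k < m, jucysMurphy q t k v = c k • v}
  add_mem' h h' k hk := by rw [map_add, h k hk, h' k hk, smul_add]
  zero_mem' k _ := by simp
  smul_mem' a v h k hk := by rw [map_smul, h k hk, smul_comm]

/-- The weight space for the weight prescribed by a sequence of bits. -/
abbrev bitSpace (q r : K) (g : ℕ) (t : ℕ → Module.End K V) (m : ℕ) (b : ℕ → Bool) :
    Submodule K V := wtSpace q t m fun k => r * q ^ letter g b k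

variable {q : K} {t : ℕ → Module.End K V} {m : ℕ} {c : ℕ → K}

theorem wtSpace_congr {c' : ℕ → K} (h : ∀ k < m, c k = c' k) :
    wtSpace q t m c = wtSpace q t m c' := by
  ext v
  exact forall₂_congr fun k hk => by rw [h k hk]

theorem wtSpace_anti {m' : ℕ} (h : m ≤ m') : wtSpace q t m' c ≤ wtSpace q t m c :=
  fun _ hv k hk => hv k (hk.trans_le h)

theorem mem_wtSpace_succ {v : V} :
    v ∈ wtSpace q t (m + 1) c ↔ v ∈ wtSpace q t m c ∧ jucysMurphy q t m v = c m • v := by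
  refine ⟨fun h => ⟨wtSpace_anti m.le_succ h, h m (by omega)⟩, fun h k hk => ?_⟩
  rcases Nat.lt_succ_iff_lt_or_eq.1 hk with h' | rfl
  exacts [h.1 k h', h.2]

namespace HeckeSystem

variable {α β : K} {n : ℕ}

theorem jm_mem_wtSpace (H : HeckeSystem α β q n t) {j : ℕ} (hm : m ≤ n) (hj : j < n) {v : V}
    (hv : v ∈ wtSpace q t m c) : jucysMurphy q t j v ∈ wtSpace q t m c := fun k hk => by
  have := LinearMap.congr_fun (H.commute_jm (show k < n by omega) hj).eq v
  simp only [Module.End.mul_apply] at this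
  rw [this, hv k hk, map_smul]

theorem intertwiner_mem_wtSpace (H : HeckeSystem α β q n t) (hq : q ≠ 0) {k : ℕ} (hm : m ≤ n)
    (hk : k + 1 < m) {v : V} (hv : v ∈ wtSpace q t m c) :
    intertwiner q t k v ∈ wtSpace q t m fun i => c (Equiv.swap k (k + 1) i) := fun i hi => by
  have hkn : k + 1 < n := by omega
  rcases eq_or_ne i k with rfl | h1
  · have := LinearMap.congr_fun (H.intertwiner_mul_jm_succ hq hkn) v
    simp only [Module.End.mul_apply] at this
    simp only [Equiv.swap_apply_left]
    rw [← this, hv _ hk, map_smul]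
  rcases eq_or_ne i (k + 1) with rfl | h2
  · have := LinearMap.congr_fun (H.intertwiner_mul_jm hq hkn) v
    simp only [Module.End.mul_apply] at this
    simp only [Equiv.swap_apply_right]
    rw [← this, hv _ (by omega), map_smul]
  · have := LinearMap.congr_fun (H.commute_jm_intertwiner hkn (show i < n by omega) h1 h2).eq v
    simp only [Module.End.mul_apply] at this
    simp only [Equiv.swap_apply_of_ne_of_ne h1 h2]
    rw [this, hv i hi, map_smul]

theorem intertwiner_mem_wtSpace_of_le (H : HeckeSystem α β q n t) {k : ℕ}
    (hkn : k + 1 < n) (hk : m ≤ k) {v : V} (hv : v ∈ wtSpace q t m c) :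
    intertwiner q t k v ∈ wtSpace q t m c := fun i hi => by
  have := LinearMap.congr_fun
    (H.commute_jm_intertwiner hkn (show i < n by omega) (by omega) (by omega)).eq v
  simp only [Module.End.mul_apply] at this
  rw [this, hv i hi, map_smul]

theorem intertwiner_sq_apply (H : HeckeSystem α β q n t) (hq : q ≠ 0) {k : ℕ}
    (hkn : k + 1 < n) {v : V} {a b : K} (ha : jucysMurphy q t k v = a • v)
    (hb : jucysMurphy q t (k + 1) v = b • v) :
    intertwiner q t k (intertwiner q t k v) = ((q * b - a) * (q * a - b)) • v := by
  have := LinearMap.congr_fun (H.intertwiner_sq hq hkn) v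
  simp only [Module.End.mul_apply, LinearMap.sub_apply, LinearMap.smul_apply, ha, hb, map_sub,
    map_smul] at this
  rw [this]; module

end HeckeSystem

end weights

/-- A representation all of whose weights are orderings of `r, r q, …, r q ^ g`, where `r` and
`r q ^ g` are the parameters of the first generator. -/
structure IsBaseBlock {K V : Type*} [Field K] [AddCommGroup V] [Module K V] (α β q r : K) (g : ℕ)
    (t : ℕ → Module.End K V) : Prop where
  sys : HeckeSystem α β q (g + 1) t
  q_ne : q ≠ 0
  r_ne : r ≠ 0
  ends : α = r ∧ β = r * q ^ g ∨ β = r ∧ α = r * q ^ g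
  pow_ne : ∀ k, 0 < k → k ≤ g + 1 → q ^ k ≠ 1
  sq_ne : q ^ 2 ≠ 1
  inj : ∀ v ≠ 0, ∀ c : ℕ → K, (∀ k < g + 1, jucysMurphy q t k v = c k • v) →
    Set.InjOn c (Finset.range (g + 1))
  mem : ∀ v ≠ 0, ∀ c : ℕ → K, (∀ k < g + 1, jucysMurphy q t k v = c k • v) →
    ∀ k < g + 1, ∃ j ≤ g, c k = r * q ^ j

namespace IsBaseBlock

variable {K V : Type*} [Field K] [AddCommGroup V] [Module K V] {α β q r : K} {g : ℕ}
  {t : ℕ → Module.End K V}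

local notation "x" => jucysMurphy q t

theorem letter_ne (B : IsBaseBlock α β q r g t) {i j : ℕ} (h : i < j) (h' : j ≤ i + g + 1) :
    r * q ^ i ≠ r * q ^ j := fun e => by
  have e := mul_left_cancel₀ B.r_ne e
  refine B.pow_ne (j - i) (by omega) (by omega) ?_
  rw [show j = i + (j - i) by omega, pow_add] at e
  exact (mul_left_cancel₀ (pow_ne_zero i B.q_ne) ((mul_one _).trans e)).symm

theorem letter_ne' (B : IsBaseBlock α β q r g t) {i j : ℕ} (h : i ≠ j) (h1 : j ≤ i + g + 1)
    (h2 : i ≤ j + g + 1) : r * q ^ i ≠ r * q ^ j := by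
  rcases lt_or_gt_of_ne h with h | h
  · exact B.letter_ne h h1
  · exact (B.letter_ne h h2).symm

theorem params_ne (B : IsBaseBlock α β q r g t) : α ≠ 0 ∧ β ≠ 0 := by
  have := mul_ne_zero B.r_ne (pow_ne_zero g B.q_ne)
  rcases B.ends with ⟨rfl, rfl⟩ | ⟨rfl, rfl⟩ <;> exact ⟨by simp_all [B.r_ne], by simp_all [B.r_ne]⟩

theorem exists_weight (B : IsBaseBlock α β q r g t) {U : Submodule K V} (hU : U ≠ ⊥)
    (hx : ∀ j < g + 1, ∀ u ∈ U, x j u ∈ U) : ∃ u ∈ U, u ≠ 0 ∧ ∃ c : ℕ → K,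
      ∀ k < g + 1, x k u = c k • u := by
  obtain ⟨u, hu, hu0, c, hc⟩ := B.sys.exists_weight_vector B.q_ne B.params_ne.1 B.params_ne.2 U hU hx
  exact ⟨u, hu, hu0, c, fun k hk => (hc k hk).2⟩

/-- A letter that is repeated or not among `r, …, r q ^ g` does not occur. -/
theorem eq_zero_of_letter (B : IsBaseBlock α β q r g t) {m : ℕ} (hm : m < g + 1) {c : ℕ → K} {v : V}
    (hv : v ∈ wtSpace q t m c) {a : K} (hav : x m v = a • v)
    (ha : (∃ k < m, c k = a) ∨ ∀ j ≤ g, a ≠ r * q ^ j) : v = 0 := by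
  by_contra hv0
  set c' := Function.update c m a
  have hvc : v ∈ wtSpace q t (m + 1) c' := mem_wtSpace_succ.2 ⟨by
    rwa [wtSpace_congr (c' := c) fun k hk => Function.update_of_ne hk.ne _ _], by simpa [c'] using hav⟩
  obtain ⟨u, hu, hu0, d, hd⟩ := B.exists_weight (U := wtSpace q t (m + 1) c')
    (fun h => hv0 (by simpa [h] using hvc))
    fun j hj u hu => B.sys.jm_mem_wtSpace hm hj hu
  have hdc (k : ℕ) (hk : k < m + 1) : d k = c' k :=
    smul_left_injective K hu0 ((hd k (by omega)).symm.trans (hu k hk))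
  have hdm : d m = a := by rw [hdc m (by omega)]; simp [c']
  rcases ha with ⟨k, hk, e⟩ | ha
  · have := B.inj u hu0 d hd (x₁ := k) (x₂ := m) (by simp; omega) (by simpa using hm) (by
      rw [hdm, hdc k (by omega), ← e]
      exact Function.update_of_ne hk.ne _ _)
    omega
  · obtain ⟨j, hj, e⟩ := B.mem u hu0 d hd m hm
    exact ha j hj (hdm ▸ e)

theorem sub_eq_zero_of_mul (B : IsBaseBlock α β q r g t) {m : ℕ} (hm : m < g + 1) {c : ℕ → K} {v : V}
    (hv : v ∈ wtSpace q t m c) {a b : K} (hav : x m (x m v) = (a + b) • x m v - (a * b) • v)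
    (ha : (∃ k < m, c k = a) ∨ ∀ j ≤ g, a ≠ r * q ^ j) : x m v = b • v := by
  refine sub_eq_zero.1 (B.eq_zero_of_letter hm (v := x m v - b • v)
    (sub_mem (B.sys.jm_mem_wtSpace hm.le hm hv) (Submodule.smul_mem _ _ hv)) (a := a) ?_ ha)
  rw [map_sub, hav, map_smul]
  module

end IsBaseBlock

namespace IsBaseBlock

variable {K V : Type*} [Field K] [AddCommGroup V] [Module K V] {α β q r : K} {g : ℕ}
  {t : ℕ → Module.End K V}

local notation "x" => jucysMurphy q t
local notation "τ" => intertwiner q t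
local notation "P" => bitSpace q r g t

theorem quadratic_step (B : IsBaseBlock α β q r g t) {m : ℕ} (hm : m + 1 < g + 1) {c : ℕ → K}
    {a a' b l : K} (hl : c m = l) (h : ∀ v ∈ wtSpace q t m c, x m (x m v) = (l + b) • x m v - (l * b) • v)
    (h1 : a + a' = q * l + q⁻¹ * l) (h2 : a * a' = l * l)
    (ha : (∃ k < m + 1, c k = a) ∨ ∀ j ≤ g, a ≠ r * q ^ j) {v : V} (hv : v ∈ wtSpace q t (m + 1) c) :
    x (m + 1) (x (m + 1) v) = (a' + b) • x (m + 1) v - (a' * b) • v := by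
  have hq := B.q_ne
  set w := x (m + 1) (x (m + 1) v) - (l + b) • x (m + 1) v + (l * b) • v with hw
  have hXv := B.sys.jm_mem_wtSpace hm.le hm hv
  have hwm : w ∈ wtSpace q t (m + 1) c := add_mem (sub_mem (B.sys.jm_mem_wtSpace hm.le hm hXv)
    (Submodule.smul_mem _ _ hXv)) (Submodule.smul_mem _ _ hv)
  have hτX (u : V) : τ m (x (m + 1) u) = x m (τ m u) :=
    LinearMap.congr_fun (B.sys.intertwiner_mul_jm_succ hq hm) u
  have hτw : τ m w = 0 := by
    have := h _ (B.sys.intertwiner_mem_wtSpace_of_le hm le_rfl (wtSpace_anti m.le_succ hv))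
    rw [hw, map_add, map_sub, map_smul, map_smul, hτX, hτX, this]
    module
  have hsq := LinearMap.congr_fun (B.sys.intertwiner_sq hq hm) w
  have hxw : x m w = l • w := hl ▸ hwm m (by omega)
  have hxXw : x m (x (m + 1) w) = l • x (m + 1) w :=
    hl ▸ B.sys.jm_mem_wtSpace hm.le hm hwm m (by omega)
  simp only [Module.End.mul_apply, LinearMap.sub_apply, LinearMap.smul_apply, hxw, map_sub,
    map_smul, hτw, map_zero, hxXw] at hsq
  have hw' := B.sub_eq_zero_of_mul (a := a) (b := a') hm hwm (by
    rw [h1, h2]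
    have e : x (m + 1) (x (m + 1) w) - ((q * l + q⁻¹ * l) • x (m + 1) w - (l * l) • w) =
      (-q⁻¹) • (q • l • (q • x (m + 1) w - l • w) -
        (q • x (m + 1) (x (m + 1) w) - l • x (m + 1) w)) := by
      match_scalars <;> field_simp; ring
    rw [← sub_eq_zero, e, ← hsq, smul_zero]) ha
  set w' := x (m + 1) (x (m + 1) v) - (a' + b) • x (m + 1) v + (a' * b) • v with hw'def
  have hwm' : w' ∈ wtSpace q t (m + 1) c := add_mem (sub_mem (B.sys.jm_mem_wtSpace hm.le hm hXv)
    (Submodule.smul_mem _ _ hXv)) (Submodule.smul_mem _ _ hv)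
  have h0 := B.eq_zero_of_letter hm hwm' (a := l) (by
    rw [hw, map_add, map_sub, map_smul, map_smul] at hw'
    rw [hw'def, map_add, map_sub, map_smul, map_smul, ← sub_eq_zero]
    rw [← sub_eq_zero] at hw'
    rw [← hw']
    module) (.inl ⟨m, by omega, hl⟩)
  rw [← sub_eq_zero, ← h0, hw'def]
  module

theorem two_letters (B : IsBaseBlock α β q r g t) {m : ℕ} (hm : m < g + 1) {b : ℕ → Bool} {v : V}
    (hv : v ∈ P m b) : x m (x m v) =
      (r * q ^ zeros b m + r * q ^ (g - (m - zeros b m))) • x m v -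
        (r * q ^ zeros b m * (r * q ^ (g - (m - zeros b m)))) • v := by
  have hq := B.q_ne
  induction m generalizing v with
  | zero =>
    have := LinearMap.congr_fun (B.sys.sq_zero (by omega)) v
    have e : α + β = r + r * q ^ g ∧ α * β = r * (r * q ^ g) := by
      rcases B.ends with ⟨h, h'⟩ | ⟨h, h'⟩ <;> rw [h, h'] <;> constructor <;> ring
    rw [e.1, e.2] at this
    simpa [zeros, jucysMurphy] using this
  | succ m ih =>
    have hz := zeros_le (b := b) m
    cases hb : b m with
    | false =>
      rw [zeros_succ_false hb, Nat.add_sub_add_right]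
      refine B.quadratic_step hm (l := r * q ^ zeros b m) (a := q⁻¹ * (r * q ^ zeros b m))
        (by simp only [letter_false hb]) (fun v hv => ih (by omega) hv)
        (by rw [pow_succ]; ring) (by rw [pow_succ]; field_simp) ?_ hv
      rcases Nat.eq_zero_or_pos (zeros b m) with h | h
      · right
        rintro j hj e
        rw [h, pow_zero, mul_one, inv_mul_eq_iff_eq_mul₀ hq] at e
        refine B.letter_ne (i := 0) (j := j + 1) (by omega) (by omega) ?_
        rw [pow_zero, mul_one, pow_succ]
        exact e.trans (by ring)
      · left
        obtain ⟨k, hk, e⟩ := exists_letter_eq (g := g) (b := b) (m := m) (i := zeros b m - 1) (by omega)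
        refine ⟨k, by omega, ?_⟩
        rw [e]
        nth_rewrite 2 [show zeros b m = zeros b m - 1 + 1 by omega]
        rw [pow_succ]; field_simp
    | true =>
      have e1 : r * q ^ (g - (m - zeros b m)) = r * q ^ (g - (m + 1 - zeros b m)) * q := by
        rw [mul_assoc, ← pow_succ]; congr 2; omega
      rw [zeros_succ_true hb, add_comm (r * q ^ zeros b m), mul_comm (r * q ^ zeros b m)]
      refine B.quadratic_step hm (l := r * q ^ (g - (m - zeros b m)))
        (a := q * (r * q ^ (g - (m - zeros b m))))
        (by simp only [letter_true hb]) (fun v hv => by rw [ih (by omega) hv]; module)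
        ?_ ?_ ?_ hv
      · rw [e1]; field_simp
      · rw [e1]; field_simp
      rw [show q * (r * q ^ (g - (m - zeros b m))) = r * q ^ (g - (m - zeros b m) + 1) by ring]
      rcases Nat.eq_zero_or_pos (m - zeros b m) with h | h
      · right
        rintro j hj e
        exact B.letter_ne (i := j) (j := g - (m - zeros b m) + 1) (by omega) (by omega) e.symm
      · left
        obtain ⟨k, hk, e⟩ := exists_letter_eq_sub (g := g) (b := b) (m := m)
          (i := m - zeros b m - 1) (by omega)
        refine ⟨k, by omega, ?_⟩
        rw [e]
        congr 2; omega

/-- The bit spaces span. -/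
theorem eq_top_of_bitSpace_le (B : IsBaseBlock α β q r g t) {S : Submodule K V}
    (hS : ∀ b, P g b ≤ S) : S = ⊤ := by
  suffices h : ∀ m ≤ g, ∀ b, P m b ≤ S by
    rw [eq_top_iff]
    exact fun v _ => h 0 (by omega) (fun _ => false) fun k hk => by omega
  intro m hm
  induction hm using Nat.decreasingInduction with
  | self => exact hS
  | of_succ m hm ih =>
    intro b v hv
    have hz := zeros_le (b := b) m
    set a₁ := r * q ^ zeros b m
    set a₂ := r * q ^ (g - (m - zeros b m))
    have hne : a₁ - a₂ ≠ 0 := sub_ne_zero.2 (B.letter_ne (by omega) (by omega))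
    have hxv := B.sys.jm_mem_wtSpace (show m ≤ g + 1 by omega) (show m < g + 1 by omega) hv
    have h2 := B.two_letters (by omega) hv
    have key (c : Bool) {a a' : K} (ha : r * q ^ letter g (Function.update b m c) m = a)
        (haa : x m (x m v) = (a + a') • x m v - (a * a') • v) : x m v - a' • v ∈ S := by
      refine ih (Function.update b m c) (mem_wtSpace_succ.2 ⟨?_, ?_⟩)
      · have : P m (Function.update b m c) = P m b := wtSpace_congr fun k hk => by
          have h1 : Function.update b m c k = b k := Function.update_of_ne hk.ne _ _
          rw [letter, letter, h1, zeros_congr (b' := b) fun i hi =>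
            Function.update_of_ne (by omega) _ _]
        change _ ∈ P m (Function.update b m c)
        rw [this]
        exact sub_mem hxv (Submodule.smul_mem _ _ hv)
      · rw [map_sub, haa, map_smul]
        simp only [ha]
        module
    have hzu (c : Bool) : zeros (Function.update b m c) m = zeros b m :=
      zeros_congr fun i hi => Function.update_of_ne (by omega) _ _
    have k1 := key false (a := a₁) (a' := a₂) (by rw [letter_false (by simp), hzu]) h2
    have k2 := key true (a := a₂) (a' := a₁) (by rw [letter_true (by simp), hzu])
      (by rw [h2]; module)
    have : v = (a₁ - a₂)⁻¹ • ((x m v - a₂ • v) - (x m v - a₁ • v)) := by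
      rw [eq_inv_smul_iff₀ hne]; module
    rw [this]
    exact S.smul_mem _ (sub_mem k1 k2)

theorem mem_swapBits (B : IsBaseBlock α β q r g t) {m k : ℕ} (hm : m ≤ g) (hk : k + 1 < m)
    {b : ℕ → Bool} (hb : b k ≠ b (k + 1)) {v : V} (hv : v ∈ P m b) :
    τ k v ∈ P m (swapBits k b) := by
  have := B.sys.intertwiner_mem_wtSpace B.q_ne (by omega) hk hv
  have e : P m (swapBits k b) = wtSpace q t m fun i => r * q ^ letter g b (Equiv.swap k (k + 1) i) :=
    wtSpace_congr fun i _ => by rw [letter_swapBits hb]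
  rwa [e]

theorem exists_intertwiner_sq (B : IsBaseBlock α β q r g t) {k : ℕ} (hk : k + 1 < g)
    {b : ℕ → Bool} (hb : b k ≠ b (k + 1)) :
    ∃ a : K, a ≠ 0 ∧ ∀ m ≤ g, k + 1 < m → ∀ v ∈ P m b, τ k (τ k v) = a • v := by
  have hz := zeros_le (b := b) k
  refine ⟨_, ?_, fun m hm hkm v hv => B.sys.intertwiner_sq_apply B.q_ne (by omega)
    (hv k (by omega)) (hv (k + 1) hkm)⟩
  have hlt : ∃ i j, i + g = j + k ∧ j ≤ g ∧ (letter g b k = i ∧ letter g b (k + 1) = j ∨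
      letter g b k = j ∧ letter g b (k + 1) = i) := by
    cases h : b k with
    | false =>
      have h' : b (k + 1) = true := by simpa [h] using hb.symm
      exact ⟨_, _, by rw [letter_false h, letter_true h', zeros_succ_false h]; omega,
        letter_le (by omega), .inl ⟨rfl, rfl⟩⟩
    | true =>
      have h' : b (k + 1) = false := by simpa [h] using hb.symm
      exact ⟨_, _, by rw [letter_true h, letter_false h', zeros_succ_true h]; omega,
        letter_le (by omega), .inr ⟨rfl, rfl⟩⟩
  obtain ⟨i, j, hij, hj, h⟩ := hlt
  have h1 : q * (r * q ^ j) - r * q ^ i ≠ 0 := by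
    rw [show q * (r * q ^ j) = r * q ^ (j + 1) by ring, sub_ne_zero]
    exact (B.letter_ne (by omega) (by omega)).symm
  have h2 : q * (r * q ^ i) - r * q ^ j ≠ 0 := by
    rw [show q * (r * q ^ i) = r * q ^ (i + 1) by ring, sub_ne_zero]
    exact B.letter_ne (by omega) (by omega)
  rcases h with ⟨h, h'⟩ | ⟨h, h'⟩ <;> simp only [h, h']
  exacts [mul_ne_zero h1 h2, mul_ne_zero h2 h1]

theorem intertwiner_eq_zero (B : IsBaseBlock α β q r g t) {m k : ℕ} (hm : m ≤ g) (hk : k + 1 < m)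
    {b : ℕ → Bool} (hb : b k = b (k + 1)) {v : V} (hv : v ∈ P m b) : τ k v = 0 := by
  have hz := zeros_le (b := b) k
  have h1 := B.sys.intertwiner_mem_wtSpace B.q_ne (by omega) hk hv k (by omega)
  have h2 := B.two_letters (m := k) (by omega) (v := τ k v) (b := b)
    (B.sys.intertwiner_mem_wtSpace_of_le (by omega) le_rfl (wtSpace_anti (by omega) hv))
  simp only [Equiv.swap_apply_left] at h1
  rw [h1, map_smul, h1] at h2
  set a₁ := r * q ^ zeros b k
  set a₂ := r * q ^ (g - (k - zeros b k))
  set a := r * q ^ letter g b (k + 1) with ha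
  have h3 : ((a - a₁) * (a - a₂)) • τ k v = 0 := by
    rw [← sub_eq_zero] at h2
    rw [← h2]; module
  refine (smul_eq_zero.1 h3).resolve_left (mul_ne_zero ?_ ?_) <;> rw [sub_ne_zero, ha] <;>
    refine B.letter_ne' ?_ ?_ ?_ <;> rw [letter] <;>
    cases h : b k <;> rw [← hb, h] <;>
    first | rw [zeros_succ_false h] | rw [zeros_succ_true h]
  all_goals simp; try omega

end IsBaseBlock

/-- The product of intertwiners that moves the position `z` to the right, to `z + ℓ`. -/
def moveRight {K R : Type*} [Field K] [Ring R] [Algebra K R] (q : K) (t : ℕ → R) (z : ℕ) : ℕ → R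
  | 0 => 1
  | l + 1 => intertwiner q t (z + l) * moveRight q t z l

/-- The product of intertwiners that moves the position `z + ℓ` to the left, to `z`. -/
def moveLeft {K R : Type*} [Field K] [Ring R] [Algebra K R] (q : K) (t : ℕ → R) (z : ℕ) : ℕ → R
  | 0 => 1
  | l + 1 => moveLeft q t z l * intertwiner q t (z + l)

/-- The product of intertwiners that carries the sorted sequence of bits to the first `m` bits
of `b`. -/
def transport {K R : Type*} [Field K] [Ring R] [Algebra K R] (q : K) (t : ℕ → R) (b : ℕ → Bool) :
    ℕ → R
  | 0 => 1
  | m + 1 => if b m then transport q t b m else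
      transport q t b m * moveRight q t (zeros b m) (m - zeros b m)

/-- The bits `0 … 0 1 1 …` starting with `z` zeros. -/
def sortedBits (z i : ℕ) : Bool := decide (z ≤ i)

/-- The bits `0 … 0 1 … 1 0 1 1 …` starting with `z` zeros followed by `l` ones. -/
def hookBits (z l i : ℕ) : Bool := decide (z ≤ i ∧ i ≠ z + l)

section words

variable {K R : Type*} [Field K] [Ring R] [Algebra K R] {q : K} {t : ℕ → R} {a : R} {M : ℕ}

theorem commute_moveRight (h : ∀ k, k + 1 < M → Commute a (intertwiner q t k)) {z l : ℕ}
    (hl : z + l < M) : Commute a (moveRight q t z l) := by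
  induction l with
  | zero => exact Commute.one_right a
  | succ l ih => exact (h _ (by omega)).mul_right (ih (by omega))

theorem commute_moveLeft (h : ∀ k, k + 1 < M → Commute a (intertwiner q t k)) {z l : ℕ}
    (hl : z + l < M) : Commute a (moveLeft q t z l) := by
  induction l with
  | zero => exact Commute.one_right a
  | succ l ih => exact (ih (by omega)).mul_right (h _ (by omega))

theorem commute_transport (h : ∀ k, k + 1 < M → Commute a (intertwiner q t k)) {b : ℕ → Bool}
    {m : ℕ} (hm : m ≤ M) : Commute a (transport q t b m) := by
  induction m with
  | zero => exact Commute.one_right a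
  | succ m ih =>
    have := zeros_le (b := b) m
    rw [transport]
    split_ifs
    · exact ih (by omega)
    · exact (ih (by omega)).mul_right (commute_moveRight h (by omega))

theorem transport_true {b : ℕ → Bool} {m : ℕ} (h : b m = true) :
    transport q t b (m + 1) = transport q t b m := by simp [transport, h]

theorem transport_false {b : ℕ → Bool} {m : ℕ} (h : b m = false) :
    transport q t b (m + 1) = transport q t b m * moveRight q t (zeros b m) (m - zeros b m) := by
  simp [transport, h]

theorem transport_congr {b b' : ℕ → Bool} {m : ℕ} (h : ∀ k < m, b k = b' k) :
    transport q t b m = transport q t b' m := by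
  induction m with
  | zero => rfl
  | succ m ih =>
    rw [transport, transport, ih fun k hk => h k (by omega), h m (by omega),
      zeros_congr fun k hk => h k (by omega)]

end words

theorem zeros_sortedBits (z m : ℕ) : zeros (sortedBits z) m = min z m := by
  induction m with
  | zero => simp [zeros]
  | succ m ih =>
    by_cases h : z ≤ m
    · rw [zeros_succ_true (by simpa [sortedBits] using h), ih]; omega
    · rw [zeros_succ_false (by simpa [sortedBits] using h), ih]; omega

theorem transport_sortedBits {K R : Type*} [Field K] [Ring R] [Algebra K R] {q : K} {t : ℕ → R}
    (z m : ℕ) : transport q t (sortedBits z) m = 1 := by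
  induction m with
  | zero => rfl
  | succ m ih =>
    by_cases h : z ≤ m
    · rw [transport_true (by simpa [sortedBits] using h), ih]
    · rw [transport_false (by simpa [sortedBits] using h), ih, zeros_sortedBits,
        show m - min z m = 0 by omega]
      exact one_mul _

theorem swapBits_hookBits (z l : ℕ) : swapBits (z + l) (hookBits z l) = hookBits z (l + 1) := by
  funext i
  by_cases h1 : i = z + l
  · subst h1; rw [swapBits_left]; simp [hookBits, add_assoc]
  by_cases h2 : i = z + l + 1
  · subst h2; rw [swapBits_right]; simp [hookBits]; omega
  · rw [swapBits_of_ne h1 h2, hookBits, hookBits, decide_eq_decide]; omega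

theorem hookBits_ne (z l : ℕ) : hookBits z l (z + l) ≠ hookBits z l (z + l + 1) := by
  simp [hookBits]; omega

theorem swapBits_swapBits (k : ℕ) (b : ℕ → Bool) : swapBits k (swapBits k b) = b := by
  funext i; simp [swapBits]

theorem bitSpace_congr {K V : Type*} [Field K] [AddCommGroup V] [Module K V] {q r : K} {g : ℕ}
    {t : ℕ → Module.End K V} {m : ℕ} {b b' : ℕ → Bool} (h : ∀ k < m, b k = b' k) :
    bitSpace q r g t m b = bitSpace q r g t m b' :=
  wtSpace_congr fun k hk => by
    rw [letter, letter, h k hk, zeros_congr fun i hi => h i (by omega)]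

theorem hookBits_zero (z : ℕ) : hookBits z 0 = sortedBits (z + 1) := by
  funext i; simp only [hookBits, sortedBits, decide_eq_decide]; omega

theorem hookBits_of_lt {z l i : ℕ} (h : i < z + l) : hookBits z l i = sortedBits z i := by
  simp only [hookBits, sortedBits, decide_eq_decide]; omega

namespace HeckeSystem

section

variable {K R : Type*} [Field K] [Ring R] [Algebra K R] {α β q : K} {n : ℕ} {t : ℕ → R}

theorem gen_mul_intertwiner_mul_intertwiner (H : HeckeSystem α β q n t) (hq : q ≠ 0) {k : ℕ}
    (hk : k + 2 < n) : t (k + 2) * (intertwiner q t k * intertwiner q t (k + 1)) =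
      intertwiner q t k * intertwiner q t (k + 1) * t (k + 1) := by
  set a := jucysMurphy q t k with ha
  set b := jucysMurphy q t (k + 1) with hb
  set c := jucysMurphy q t (k + 2) with hc
  set s := t (k + 1)
  set u := t (k + 2)
  have hba (z : R) : b * (a * z) = a * (b * z) := by
    rw [← mul_assoc, ← mul_assoc, (H.commute_jm (show k + 1 < n by omega) (show k < n by omega)).eq]
  have hca (z : R) : c * (a * z) = a * (c * z) := by
    rw [← mul_assoc, ← mul_assoc, (H.commute_jm (show k + 2 < n by omega) (show k < n by omega)).eq]
  have hcb (z : R) : c * (b * z) = b * (c * z) := by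
    rw [← mul_assoc, ← mul_assoc,
      (H.commute_jm (show k + 2 < n by omega) (show k + 1 < n by omega)).eq]
  have hcs (z : R) : c * (s * z) = s * (c * z) := by
    rw [← mul_assoc, ← mul_assoc,
      (H.commute_gen_jm (i := k + 1) (k := k + 2) (by omega) (by omega) (by omega) hk).eq]
  have hau (z : R) : a * (u * z) = u * (a * z) := by
    rw [← mul_assoc, ← mul_assoc,
      (H.commute_gen_jm (i := k + 2) (k := k) (by omega) (by omega) hk (by omega)).eq]
  have has (z : R) : a * (s * z) = s * (b * z) - (q - 1) • (b * z) := by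
    rw [← mul_assoc, H.jm_mul_gen hq (by omega), sub_mul, smul_mul_assoc, mul_assoc]
  have hbs (z : R) : b * (s * z) = s * (a * z) + (q - 1) • (b * z) := by
    rw [← mul_assoc, H.jm_succ_mul_gen hq (by omega), add_mul, smul_mul_assoc, mul_assoc]
  have hbu (z : R) : b * (u * z) = u * (c * z) - (q - 1) • (c * z) := by
    rw [← mul_assoc, H.jm_mul_gen hq hk, sub_mul, smul_mul_assoc, mul_assoc]
  have hss (z : R) : s * (s * z) = (q - 1) • (s * z) + q • z := H.sq_mul (by omega) (by omega) z
  have huu (z : R) : u * (u * z) = (q - 1) • (u * z) + q • z := H.sq_mul (by omega) hk z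
  have hsus (z : R) : u * (s * (u * z)) = s * (u * (s * z)) := by
    have := H.braid (k + 1) (by omega) hk
    simp only [← mul_assoc]
    rw [this]
  have hτ (z : R) : intertwiner q t k * z = s * (b * z) - s * (a * z) - (q - 1) • (b * z) := by
    rw [intertwiner, sub_mul, mul_assoc, sub_mul, mul_sub, smul_mul_assoc]
  have hτ' (z : R) : intertwiner q t (k + 1) * z =
      u * (c * z) - u * (b * z) - (q - 1) • (c * z) := by
    rw [intertwiner, sub_mul, mul_assoc, sub_mul, mul_sub, smul_mul_assoc]
  suffices h : ∀ z, u * (intertwiner q t k * (intertwiner q t (k + 1) * z)) =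
      intertwiner q t k * (intertwiner q t (k + 1) * (s * z)) by simpa [mul_assoc] using h 1
  intro z
  simp only [hτ, hτ', mul_sub, mul_add, mul_smul_comm, hba, hca, hcb, hcs, hau, has, hbs, hbu, hss,
    huu, hsus]
  module

end

section

variable {K V : Type*} [Field K] [AddCommGroup V] [Module K V] {α β q : K} {n : ℕ}
  {t : ℕ → Module.End K V}

theorem intertwiner_cube_eq_zero (H : HeckeSystem α β q n t) (hq : q ≠ 0) {k : ℕ}
    (hk : k + 2 < n) {v : V} {a b : K} (ha : jucysMurphy q t k v = a • v)
    (hb : jucysMurphy q t (k + 1) v = b • v) (hv : intertwiner q t k v = 0) :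
    intertwiner q t (k + 1) (intertwiner q t k (intertwiner q t (k + 1) v)) = 0 := by
  set w := intertwiner q t k (intertwiner q t (k + 1) v) with hw
  have hs : (b - a) • t (k + 1) v = ((q - 1) * b) • v := by
    have : intertwiner q t k v = (b - a) • t (k + 1) v - ((q - 1) * b) • v := by
      simp only [intertwiner, LinearMap.sub_apply, Module.End.mul_apply, LinearMap.smul_apply, ha,
        hb, map_sub, map_smul]
      module
    rw [hv] at this
    exact sub_eq_zero.1 this.symm
  have hxw : jucysMurphy q t (k + 1) w = a • w := by
    have h1 := LinearMap.congr_fun (H.intertwiner_mul_jm hq (show k + 1 < n by omega))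
      (intertwiner q t (k + 1) v)
    have h2 := LinearMap.congr_fun (H.commute_jm_intertwiner (j := k) (k := k + 1) hk (by omega)
      (by omega) (by omega)).eq v
    simp only [Module.End.mul_apply] at h1 h2
    rw [hw, ← h1, h2, ha, map_smul, map_smul]
  have hXw : jucysMurphy q t (k + 2) w = b • w := by
    have h1 := LinearMap.congr_fun (H.commute_jm_intertwiner (j := k + 2) (k := k) (by omega) hk
      (by omega) (by omega)).eq (intertwiner q t (k + 1) v)
    have h2 := LinearMap.congr_fun (H.intertwiner_mul_jm hq (k := k + 1) hk) v
    simp only [Module.End.mul_apply] at h1 h2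
    rw [hw, h1, ← h2, hb, map_smul, map_smul]
  have htw : t (k + 2) w = intertwiner q t k (intertwiner q t (k + 1) (t (k + 1) v)) :=
    LinearMap.congr_fun (H.gen_mul_intertwiner_mul_intertwiner hq hk) v
  have e : intertwiner q t (k + 1) w = (b - a) • t (k + 2) w - ((q - 1) * b) • w := by
    simp only [intertwiner, LinearMap.sub_apply, Module.End.mul_apply, LinearMap.smul_apply, hxw,
      hXw, map_sub, map_smul]
    module
  rw [e, htw, ← map_smul, ← map_smul, hs, map_smul, map_smul, sub_self]

end

end HeckeSystem

namespace IsBaseBlock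

variable {K V : Type*} [Field K] [AddCommGroup V] [Module K V] {α β q r : K} {g : ℕ}
  {t : ℕ → Module.End K V}

local notation "x" => jucysMurphy q t
local notation "τ" => intertwiner q t
local notation "P" => bitSpace q r g t

theorem moveRight_mem (B : IsBaseBlock α β q r g t) {m z l : ℕ} (hm : m ≤ g) (h : z + l < m) {v : V}
    (hv : v ∈ P m (hookBits z 0)) : moveRight q t z l v ∈ P m (hookBits z l) := by
  induction l with
  | zero => exact hv
  | succ l ih =>
    rw [← swapBits_hookBits]
    exact B.mem_swapBits hm (by omega) (hookBits_ne z l) (ih (by omega))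

theorem moveLeft_mem (B : IsBaseBlock α β q r g t) {m z l : ℕ} (hm : m ≤ g) (h : z + l < m) {v : V}
    (hv : v ∈ P m (hookBits z l)) : moveLeft q t z l v ∈ P m (hookBits z 0) := by
  induction l generalizing v with
  | zero => exact hv
  | succ l ih =>
    refine ih (by omega) (v := τ (z + l) v) ?_
    rw [← swapBits_swapBits (z + l) (hookBits z l), swapBits_hookBits]
    refine B.mem_swapBits hm (by omega) ?_ hv
    rw [← swapBits_hookBits, swapBits_left, swapBits_right]
    exact (hookBits_ne z l).symm

theorem exists_intertwiner_sq' (B : IsBaseBlock α β q r g t) {m k : ℕ} (hm : m ≤ g)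
    (hk : k + 1 < m) {b : ℕ → Bool} (hb : b k ≠ b (k + 1)) :
    ∃ a : K, a ≠ 0 ∧ (∀ v ∈ P m b, τ k (τ k v) = a • v) ∧
      ∀ v ∈ P m (swapBits k b), τ k (τ k v) = a • v := by
  obtain ⟨a, ha, h⟩ := B.exists_intertwiner_sq (by omega) hb
  have hb' : swapBits k b k ≠ swapBits k b (k + 1) := by
    rw [swapBits_left, swapBits_right]; exact hb.symm
  obtain ⟨d, hd, h'⟩ := B.exists_intertwiner_sq (by omega) hb'
  refine ⟨a, ha, h m hm hk, fun v hv => ?_⟩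
  have h1 := h m hm hk (τ k v) (by simpa only [swapBits_swapBits] using B.mem_swapBits hm hk hb' hv)
  rw [h' m hm hk v hv, map_smul] at h1
  have h2 := congrArg (τ k) h1
  rw [map_smul, map_smul, h' m hm hk v hv, smul_comm a] at h2
  rw [h' m hm hk v hv, smul_right_injective V hd h2]

theorem exists_move (B : IsBaseBlock α β q r g t) {m z l : ℕ} (hm : m ≤ g) (h : z + l < m) :
    ∃ a : K, a ≠ 0 ∧
      (∀ v ∈ P m (hookBits z 0), moveLeft q t z l (moveRight q t z l v) = a • v) ∧
      ∀ v ∈ P m (hookBits z l), moveRight q t z l (moveLeft q t z l v) = a • v := by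
  induction l with
  | zero => exact ⟨1, one_ne_zero, fun v _ => (one_smul K v).symm, fun v _ => (one_smul K v).symm⟩
  | succ l ih =>
    obtain ⟨a, ha, h1, h2⟩ := ih (by omega)
    obtain ⟨c, hc, h3, h4⟩ := B.exists_intertwiner_sq' hm (k := z + l) (by omega) (hookBits_ne z l)
    have hb : swapBits (z + l) (hookBits z l) (z + l) ≠ swapBits (z + l) (hookBits z l) (z + l + 1) := by
      rw [swapBits_left, swapBits_right]; exact (hookBits_ne z l).symm
    rw [← swapBits_hookBits]
    refine ⟨a * c, mul_ne_zero ha hc, fun v hv => ?_, fun v hv => ?_⟩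
    · change moveLeft q t z l (τ (z + l) (τ (z + l) (moveRight q t z l v))) = _
      rw [h3 _ (B.moveRight_mem hm (by omega) hv), map_smul, h1 v hv, smul_smul, mul_comm]
    · change τ (z + l) (moveRight q t z l (moveLeft q t z l (τ (z + l) v))) = _
      rw [h2 _ (by simpa only [swapBits_swapBits] using B.mem_swapBits hm (by omega) hb hv),
        map_smul, h4 v hv, smul_smul]

theorem mem_bitSpace_succ {m : ℕ} {b : ℕ → Bool} {v : V} :
    v ∈ P (m + 1) b ↔ v ∈ P m b ∧ x m v = (r * q ^ letter g b m) • v := mem_wtSpace_succ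

theorem commute_jm_intertwiner_of_lt (B : IsBaseBlock α β q r g t) {m j : ℕ} (hj : m ≤ j)
    (hjg : j < g + 1) : ∀ k, k + 1 < m → Commute (x j) (τ k) := fun k hk =>
  B.sys.commute_jm_intertwiner (by omega) hjg (by omega) (by omega)

theorem commute_intertwiner_of_lt (B : IsBaseBlock α β q r g t) {m : ℕ} (hm : m < g) :
    ∀ k, k + 1 < m → Commute (τ m) (τ k) := fun k hk =>
  (B.sys.commute_intertwiner (k := m) (by omega) (by omega)).symm

theorem mem_hookBits_of_false (B : IsBaseBlock α β q r g t) {m : ℕ} (hm : m < g) {b : ℕ → Bool}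
    (hb : b m = false) {v : V} (hv : v ∈ P (m + 1) (sortedBits (zeros b (m + 1)))) :
    moveRight q t (zeros b m) (m - zeros b m) v ∈
      P (m + 1) (hookBits (zeros b m) (m - zeros b m)) := by
  have := zeros_le (b := b) m
  refine B.moveRight_mem (by omega) (by omega) ?_
  rwa [hookBits_zero, ← zeros_succ_false hb]

theorem transport_mem (B : IsBaseBlock α β q r g t) {m : ℕ} (hm : m ≤ g) (b : ℕ → Bool) {v : V}
    (hv : v ∈ P m (sortedBits (zeros b m))) : transport q t b m v ∈ P m b := by
  induction m generalizing v with
  | zero => exact fun k hk => by omega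
  | succ m ih =>
    have hz := zeros_le (b := b) m
    have hc := commute_transport (B.commute_jm_intertwiner_of_lt (j := m) le_rfl (by omega)) (b := b)
      le_rfl
    suffices h : ∀ w, w ∈ P m (sortedBits (zeros b m)) → x m w = (r * q ^ letter g b m) • w →
        transport q t b m w ∈ P (m + 1) b by
      cases hb : b m with
      | true =>
        rw [zeros_succ_true hb] at hv
        rw [transport_true hb]
        refine h v (wtSpace_anti m.le_succ hv) ?_
        rw [(mem_bitSpace_succ.1 hv).2, letter_true hb, letter_true (by simpa [sortedBits] using hz),
          zeros_sortedBits, min_eq_left hz]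
      | false =>
        rw [transport_false hb]
        have h1 := mem_bitSpace_succ.1 (B.mem_hookBits_of_false (by omega) hb hv)
        refine h _ ?_ ?_
        · rw [← bitSpace_congr (b := hookBits (zeros b m) (m - zeros b m)) fun k hk =>
            hookBits_of_lt (by omega)]
          exact h1.1
        · rw [h1.2, letter_false hb, letter_false (by simp [hookBits]; omega),
            zeros_congr (b' := sortedBits (zeros b m)) fun k hk => hookBits_of_lt (by omega),
            zeros_sortedBits, min_eq_left hz]
    intro w hw hxw
    refine mem_bitSpace_succ.2 ⟨ih (by omega) hw, ?_⟩
    have := LinearMap.congr_fun hc.eq w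
    simp only [Module.End.mul_apply] at this
    rw [this, hxw, map_smul]

theorem exists_transport_swapBits (B : IsBaseBlock α β q r g t) {m k : ℕ} (hm : m ≤ g)
    (hk : k + 1 < m) {b : ℕ → Bool} (hb : b k ≠ b (k + 1)) :
    ∃ a : K, ∀ v ∈ P m (sortedBits (zeros b m)),
      τ k (transport q t b m v) = a • transport q t (swapBits k b) m v := by
  induction m with
  | zero => omega
  | succ m ih =>
    have hz := zeros_le (b := b) m
    rcases Nat.lt_or_ge (k + 1) m with hkm | hkm
    · obtain ⟨a, h⟩ := ih (by omega) hkm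
      refine ⟨a, fun v hv => ?_⟩
      have hs : swapBits k b m = b m := swapBits_of_ne (by omega) (by omega)
      cases hbm : b m with
      | true =>
        rw [transport_true hbm, transport_true (by rw [hs, hbm])]
        rw [zeros_succ_true hbm] at hv
        exact h v (wtSpace_anti m.le_succ hv)
      | false =>
        rw [transport_false hbm, transport_false (by rw [hs, hbm]), zeros_swapBits (by omega)]
        refine h _ ?_
        rw [← bitSpace_congr (b := hookBits (zeros b m) (m - zeros b m)) fun k hk =>
            hookBits_of_lt (by omega)]
        exact wtSpace_anti m.le_succ (B.mem_hookBits_of_false (by omega) hbm hv)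
    · obtain rfl : m = k + 1 := by omega
      have key (c : ℕ → Bool) (h1 : c k = false) (h2 : c (k + 1) = true) :
          transport q t (swapBits k c) (k + 2) = τ k * transport q t c (k + 2) := by
        have hz := zeros_le (b := c) k
        have hcz : zeros (swapBits k c) (k + 1) = zeros c k := by
          rw [zeros_succ_true (by rwa [swapBits_left]), zeros_swapBits (by omega)]
        rw [transport_true h2, transport_false h1, transport_false (by rwa [swapBits_right]),
          transport_true (by rwa [swapBits_left]), hcz,
          show k + 1 - zeros c k = k - zeros c k + 1 by omega, moveRight,
          show zeros c k + (k - zeros c k) = k by omega,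
          transport_congr (b' := c) fun i hi => swapBits_of_ne (by omega) (by omega),
          ← mul_assoc, ← mul_assoc,
          (commute_transport (B.commute_intertwiner_of_lt (by omega)) le_rfl).eq]
      cases hbk : b k with
      | false =>
        refine ⟨1, fun v _ => ?_⟩
        rw [key b hbk (by simpa [hbk] using hb.symm), one_smul]; rfl
      | true =>
        have hbk' : b (k + 1) = false := by simpa [hbk] using hb.symm
        obtain ⟨a, -, -, h⟩ := B.exists_intertwiner_sq' hm (k := k) (by omega) hb
        refine ⟨a, fun v hv => ?_⟩
        have e := key (swapBits k b) (by rwa [swapBits_left]) (by rwa [swapBits_right])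
        rw [swapBits_swapBits] at e
        rw [e]
        exact h _ (B.transport_mem hm _ (by rwa [zeros_swapBits (by omega)]))

theorem transport_injective (B : IsBaseBlock α β q r g t) {m : ℕ} (hm : m ≤ g) {b : ℕ → Bool} {v : V}
    (hv : v ∈ P m (sortedBits (zeros b m))) (h : transport q t b m v = 0) : v = 0 := by
  induction m generalizing v with
  | zero => exact h
  | succ m ih =>
    have hz := zeros_le (b := b) m
    cases hb : b m with
    | true =>
      rw [zeros_succ_true hb] at hv
      rw [transport_true hb] at h
      exact ih (by omega) (wtSpace_anti m.le_succ hv) h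
    | false =>
      rw [transport_false hb] at h
      obtain ⟨a, ha, h1, -⟩ := B.exists_move hm (z := zeros b m) (l := m - zeros b m) (by omega)
      have h2 := ih (by omega) (v := moveRight q t (zeros b m) (m - zeros b m) v) (by
        rw [← bitSpace_congr (b := hookBits (zeros b m) (m - zeros b m)) fun k hk =>
          hookBits_of_lt (by omega)]
        exact wtSpace_anti m.le_succ (B.mem_hookBits_of_false (by omega) hb hv)) h
      have h3 := h1 v (by rwa [hookBits_zero, ← zeros_succ_false hb])
      rw [h2, map_zero] at h3
      exact (smul_eq_zero.1 h3.symm).resolve_left ha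

theorem exists_transport_eq (B : IsBaseBlock α β q r g t) {m : ℕ} (hm : m ≤ g) (b : ℕ → Bool) {v : V}
    (hv : v ∈ P m b) : ∃ w ∈ P m (sortedBits (zeros b m)), transport q t b m w = v := by
  induction m generalizing v with
  | zero => exact ⟨v, fun k hk => by omega, rfl⟩
  | succ m ih =>
    have hz := zeros_le (b := b) m
    have hc := commute_transport (B.commute_jm_intertwiner_of_lt (j := m) le_rfl (by omega)) (b := b)
      le_rfl
    have hv' := mem_bitSpace_succ.1 hv
    obtain ⟨w, hw, e⟩ := ih (by omega) hv'.1
    have hxw : x m w = (r * q ^ letter g b m) • w := by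
      refine sub_eq_zero.1 (B.transport_injective (show m ≤ g by omega) (b := b) (sub_mem
        (B.sys.jm_mem_wtSpace (by omega) (by omega) hw) (Submodule.smul_mem _ _ hw)) ?_)
      have := LinearMap.congr_fun hc.eq w
      simp only [Module.End.mul_apply] at this
      rw [map_sub, ← this, map_smul, e, hv'.2, sub_self]
    cases hb : b m with
    | true =>
      refine ⟨w, mem_bitSpace_succ.2 ⟨?_, ?_⟩, by rw [transport_true hb, e]⟩
      · rwa [zeros_succ_true hb]
      · rw [hxw, zeros_succ_true hb, letter_true hb, letter_true (by simpa [sortedBits] using hz),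
          zeros_sortedBits, min_eq_left hz]
    | false =>
      have hw1 : w ∈ P (m + 1) (hookBits (zeros b m) (m - zeros b m)) := by
        refine mem_bitSpace_succ.2 ⟨?_, ?_⟩
        · rwa [bitSpace_congr (b' := sortedBits (zeros b m)) fun k hk => hookBits_of_lt (by omega)]
        · rw [hxw, letter_false hb, letter_false (by simp [hookBits]; omega),
            zeros_congr (b' := sortedBits (zeros b m)) fun k hk => hookBits_of_lt (by omega),
            zeros_sortedBits, min_eq_left hz]
      obtain ⟨a, ha, -, h1⟩ := B.exists_move hm (z := zeros b m) (l := m - zeros b m) (by omega)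
      refine ⟨a⁻¹ • moveLeft q t (zeros b m) (m - zeros b m) w, Submodule.smul_mem _ _ ?_, ?_⟩
      · rw [zeros_succ_false hb, ← hookBits_zero]
        exact B.moveLeft_mem hm (by omega) hw1
      · rw [transport_false hb, Module.End.mul_apply, map_smul, h1 w hw1, smul_smul,
          inv_mul_cancel₀ ha, one_smul, e]

end IsBaseBlock

/-- The maps `V j → V (j + 1)` of the zigzag attached to a base block. -/
def climb {K R : Type*} [Field K] [Ring R] [Algebra K R] (q : K) (t : ℕ → R) (g j : ℕ) : R :=
  if j < g then moveLeft q t j (g - 1 - j) * intertwiner q t (g - 1) else 0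

/-- The maps `V (j + 1) → V j` of the zigzag attached to a base block. -/
def descend {K R : Type*} [Field K] [Ring R] [Algebra K R] (q : K) (t : ℕ → R) (g j : ℕ) : R :=
  if j < g then intertwiner q t (g - 1) * moveRight q t j (g - 1 - j) else 0

/-- The spaces `V j` of the zigzag attached to a base block. -/
def sortedSpace {K V : Type*} [Field K] [AddCommGroup V] [Module K V] (q r : K) (g : ℕ)
    (t : ℕ → Module.End K V) (j : ℕ) : Submodule K V :=
  if j ≤ g then bitSpace q r g t g (sortedBits j) else ⊥

/-- The loops of the zigzag attached to a base block. -/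
def loop {K R : Type*} [Field K] [Ring R] [Algebra K R] (q r : K) (t : ℕ → R) (g j : ℕ) : R :=
  jucysMurphy q t g - (r * q ^ j) • 1

/-- Representations of the zigzag algebra of type `A`, with `g + 1` vertices. -/
structure IsZigzag {K V : Type*} [Field K] [AddCommGroup V] [Module K V] (g : ℕ) (κ μ : ℕ → K)
    (A : ℕ → Submodule K V) (u d y : ℕ → Module.End K V) : Prop where
  du_ne : ∀ j, κ j ≠ 0
  ud_ne : ∀ j, μ j ≠ 0
  eq_bot : ∀ j, g < j → A j = ⊥
  u_mem : ∀ j, ∀ v ∈ A j, u j v ∈ A (j + 1)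
  d_mem : ∀ j, ∀ v ∈ A (j + 1), d j v ∈ A j
  y_mem : ∀ j, ∀ v ∈ A j, y j v ∈ A j
  y_y : ∀ j, ∀ v ∈ A j, y j (y j v) = 0
  u_y : ∀ j, ∀ v ∈ A j, u j (y j v) = 0
  y_u : ∀ j, ∀ v ∈ A j, y (j + 1) (u j v) = 0
  d_y : ∀ j, ∀ v ∈ A (j + 1), d j (y (j + 1) v) = 0
  y_d : ∀ j, ∀ v ∈ A (j + 1), y j (d j v) = 0
  u_u : ∀ j, ∀ v ∈ A j, u (j + 1) (u j v) = 0
  d_d : ∀ j, ∀ v ∈ A (j + 2), d j (d (j + 1) v) = 0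
  d_u : ∀ j < g, ∀ v ∈ A j, d j (u j v) = κ j • y j v
  u_d : ∀ j, ∀ v ∈ A (j + 1), u j (d j v) = μ j • y (j + 1) v

section

variable {K V : Type*} [Field K] [AddCommGroup V] [Module K V] {q r : K} {g : ℕ}
  {t : ℕ → Module.End K V}

theorem sortedSpace_of_le {j : ℕ} (h : j ≤ g) :
    sortedSpace q r g t j = bitSpace q r g t g (sortedBits j) := if_pos h

theorem sortedSpace_of_lt {j : ℕ} (h : g < j) : sortedSpace q r g t j = ⊥ := if_neg (by omega)

theorem le_of_mem_sortedSpace {j : ℕ} {v : V} (h : v ∈ sortedSpace q r g t j) (hv : v ≠ 0) :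
    j ≤ g := by
  by_contra hj
  rw [sortedSpace_of_lt (by omega)] at h
  exact hv h

end

namespace IsBaseBlock

variable {K V : Type*} [Field K] [AddCommGroup V] [Module K V] {α β q r : K} {g k : ℕ}
  {t : ℕ → Module.End K V}

local notation "x" => jucysMurphy q t
local notation "τ" => intertwiner q t
local notation "P" => bitSpace q r g t

theorem jm_last_intertwiner (B : IsBaseBlock α β q r g t) (hk : k + 1 = g) {b : ℕ → Bool} {v : V}
    (hv : v ∈ P g b) : x g (τ k v) = (r * q ^ letter g b k) • τ k v := by
  have := LinearMap.congr_fun (B.sys.intertwiner_mul_jm B.q_ne (show k + 1 < g + 1 by omega)) v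
  simp only [Module.End.mul_apply] at this
  rw [← hk, ← this, hv k (by omega), map_smul, hk]

theorem letters_last (hk : k + 1 = g) (b : ℕ → Bool) :
    (letter g b k = zeros b k ∧ zeros b g = zeros b k + 1 ∧ b k = false) ∨
      letter g b k = zeros b k + 1 ∧ zeros b g = zeros b k ∧ b k = true := by
  have hz := zeros_le (b := b) k
  subst hk
  cases h : b k with
  | false => exact .inl ⟨letter_false h, zeros_succ_false h, rfl⟩
  | true => exact .inr ⟨by rw [letter_true h]; omega, zeros_succ_true h, rfl⟩

theorem intertwiner_last_jm (B : IsBaseBlock α β q r g t) (hk : k + 1 = g) {b : ℕ → Bool} {v : V}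
    (hv : v ∈ P g b) : τ k (x g v) = (r * q ^ zeros b g) • τ k v ∧
      x k (τ k v) = (r * q ^ zeros b g) • τ k v := by
  have hz := zeros_le (b := b) k
  have h1 := LinearMap.congr_fun (B.sys.intertwiner_mul_jm_succ B.q_ne (show k + 1 < g + 1 by omega)) v
  simp only [Module.End.mul_apply] at h1
  rw [hk] at h1
  rw [h1]
  suffices h : x k (τ k v) = (r * q ^ zeros b g) • τ k v from ⟨h, h⟩
  have hm : τ k v ∈ P k b := B.sys.intertwiner_mem_wtSpace_of_le (by omega) le_rfl
    (wtSpace_anti (by omega) hv)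
  have h2 := B.two_letters (by omega) hm
  have hX := B.jm_last_intertwiner hk hv
  set a := r * q ^ letter g b k with ha
  set a' := r * q ^ zeros b g with ha'
  have h3 : x k (x k (τ k v)) = (a + a') • x k (τ k v) - (a * a') • τ k v := by
    rw [h2, ha, ha', show g - (k - zeros b k) = zeros b k + 1 by omega]
    rcases letters_last hk b with ⟨e1, e2, -⟩ | ⟨e1, e2, -⟩ <;> rw [e1, e2]; module
  have hw : x k (τ k v) - a' • τ k v ∈ P k b :=
    sub_mem (B.sys.jm_mem_wtSpace (by omega) (by omega) hm) (Submodule.smul_mem _ _ hm)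
  refine sub_eq_zero.1 (B.eq_zero_of_letter (m := g) (by omega)
    (c := Function.update (fun i => r * q ^ letter g b i) k a) (a := a) (fun i hi => ?_) ?_
    (.inl ⟨k, by omega, Function.update_self ..⟩))
  · rcases Nat.lt_or_ge i k with h | h
    · rw [Function.update_of_ne (by omega)]
      exact hw i h
    · obtain rfl : i = k := by omega
      rw [Function.update_self, map_sub, h3, map_smul]; module
  · have h4 := LinearMap.congr_fun (B.sys.commute_jm (show g < g + 1 by omega)
      (show k < g + 1 by omega)).eq (τ k v)
    simp only [Module.End.mul_apply] at h4
    rw [map_sub, h4, map_smul, hX, map_smul, smul_sub, smul_comm a']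

theorem intertwiner_last_mem (B : IsBaseBlock α β q r g t) (hk : k + 1 = g) {b : ℕ → Bool} {v : V}
    (hv : v ∈ P g b) : τ k v ∈ P g (Function.update b k (!b k)) := by
  have h1 : ∀ i < k, Function.update b k (!b k) i = b i :=
    fun i hi => Function.update_of_ne (by omega) _ _
  have hm : τ k v ∈ P k b := B.sys.intertwiner_mem_wtSpace_of_le (by omega) le_rfl
    (wtSpace_anti (by omega) hv)
  rw [← bitSpace_congr h1] at hm
  have h2 := (B.intertwiner_last_jm hk hv).2
  have e : zeros b g = letter g (Function.update b k (!b k)) k := by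
    have hz := zeros_le (b := b) k
    rcases letters_last hk b with ⟨-, e, h⟩ | ⟨-, e, h⟩
    · rw [e, letter_true (by simp [h]), zeros_congr h1]; omega
    · rw [e, letter_false (by simp [h]), zeros_congr h1]
  rw [e] at h2
  have := mem_bitSpace_succ.2 ⟨hm, h2⟩
  rwa [hk] at this

theorem loop_sq (B : IsBaseBlock α β q r g t) {b : ℕ → Bool} {v : V} (hv : v ∈ P g b) :
    loop q r t g (zeros b g) (loop q r t g (zeros b g) v) = 0 := by
  have h := B.two_letters (show g < g + 1 by omega) hv
  have hz := zeros_le (b := b) g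
  rw [show g - (g - zeros b g) = zeros b g by omega] at h
  simp only [loop, LinearMap.sub_apply, LinearMap.smul_apply, Module.End.one_apply, map_sub,
    map_smul, h]
  module

theorem exists_intertwiner_last_sq (B : IsBaseBlock α β q r g t) (hk : k + 1 = g) (b : ℕ → Bool) :
    ∃ a : K, a ≠ 0 ∧ ∀ v ∈ P g b, τ k (τ k v) = a • loop q r t g (zeros b g) v := by
  have h1 : q ^ 2 - 1 ≠ 0 := sub_ne_zero.2 B.sq_ne
  have key (v : V) (hv : v ∈ P g b) : τ k (τ k v) =
      q • x g (q • (r * q ^ letter g b k) • v - x g v) -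
        (r * q ^ letter g b k) • (q • (r * q ^ letter g b k) • v - x g v) ∧
      x g (x g v) = (2 * (r * q ^ zeros b g)) • x g v - (r * q ^ zeros b g) ^ 2 • v := by
    have h2 := LinearMap.congr_fun (B.sys.intertwiner_sq B.q_ne (show k + 1 < g + 1 by omega)) v
    have h3 := LinearMap.congr_fun (B.sys.commute_jm (show g < g + 1 by omega)
      (show k < g + 1 by omega)).eq v
    have h5 := B.loop_sq hv
    simp only [loop, LinearMap.sub_apply, LinearMap.smul_apply, Module.End.one_apply, map_sub,
      map_smul] at h5
    simp only [Module.End.mul_apply] at h3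
    simp only [Module.End.mul_apply, LinearMap.sub_apply, LinearMap.smul_apply, hk,
      map_sub, map_smul, hv k (show k < g by omega), ← h3] at h2
    refine ⟨?_, ?_⟩
    · rw [h2, map_sub, map_smul, map_smul]; module
    · rw [← sub_eq_zero, ← h5]; module
  set a := r * q ^ zeros b k
  have ha : a ≠ 0 := mul_ne_zero B.r_ne (pow_ne_zero _ B.q_ne)
  rcases letters_last hk b with ⟨e1, e2, -⟩ | ⟨e1, e2, -⟩
  · refine ⟨-((q ^ 2 - 1) * a), neg_ne_zero.2 (mul_ne_zero h1 ha), fun v hv => ?_⟩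
    obtain ⟨h2, h3⟩ := key v hv
    rw [e2, show r * q ^ (zeros b k + 1) = q * a by rw [pow_succ]; ring] at h3
    rw [e1] at h2
    rw [h2, map_sub, h3, loop, e2, show r * q ^ (zeros b k + 1) = q * a by rw [pow_succ]; ring]
    simp only [LinearMap.sub_apply, LinearMap.smul_apply, Module.End.one_apply, map_smul]
    module
  · refine ⟨q * ((q ^ 2 - 1) * a), mul_ne_zero B.q_ne (mul_ne_zero h1 ha), fun v hv => ?_⟩
    obtain ⟨h2, h3⟩ := key v hv
    rw [e2] at h3
    rw [e1, show r * q ^ (zeros b k + 1) = q * a by rw [pow_succ]; ring] at h2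
    rw [h2, map_sub, h3, loop, e2]
    simp only [LinearMap.sub_apply, LinearMap.smul_apply, Module.End.one_apply, map_smul]
    module

end IsBaseBlock

namespace IsBaseBlock

variable {K V : Type*} [Field K] [AddCommGroup V] [Module K V] {α β q r : K} {g j l : ℕ}
  {t : ℕ → Module.End K V}

local notation "x" => jucysMurphy q t
local notation "τ" => intertwiner q t
local notation "P" => bitSpace q r g t

theorem zeros_hookBits (j l : ℕ) : zeros (hookBits j l) (j + l) = j := by
  rw [zeros_congr (b' := sortedBits j) fun k hk => by rw [hookBits_of_lt hk], zeros_sortedBits]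
  omega

theorem hookBits_self (j l : ℕ) : hookBits j l (j + l) = false := by simp [hookBits]

theorem sortedBits_add (j l : ℕ) : sortedBits j (j + l) = true := by simp [sortedBits]

theorem mem_hookBits_of_sortedBits (B : IsBaseBlock α β q r g t) (hg : j + l + 1 = g) {v : V}
    (hv : v ∈ P g (sortedBits j)) : τ (j + l) v ∈ P g (hookBits j l) := by
  have h := B.intertwiner_last_mem hg hv
  rwa [bitSpace_congr (b' := hookBits j l) fun k hk => ?_] at h
  rcases eq_or_ne k (j + l) with rfl | hk'
  · rw [Function.update_self, sortedBits_add, hookBits_self]; rfl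
  · rw [Function.update_of_ne hk', hookBits_of_lt (by omega)]

theorem mem_sortedBits_of_hookBits (B : IsBaseBlock α β q r g t) (hg : j + l + 1 = g) {v : V}
    (hv : v ∈ P g (hookBits j l)) : τ (j + l) v ∈ P g (sortedBits j) := by
  have h := B.intertwiner_last_mem hg hv
  rwa [bitSpace_congr (b' := sortedBits j) fun k hk => ?_] at h
  rcases eq_or_ne k (j + l) with rfl | hk'
  · rw [Function.update_self, sortedBits_add, hookBits_self]; rfl
  · rw [Function.update_of_ne hk', hookBits_of_lt (by omega)]

theorem commute_loop_moveLeft (B : IsBaseBlock α β q r g t) (hg : j + l < g) (i : ℕ) (v : V) :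
    loop q r t g i (moveLeft q t j l v) = moveLeft q t j l (loop q r t g i v) := by
  have := commute_moveLeft (B.commute_jm_intertwiner_of_lt le_rfl (by omega)) hg
  exact LinearMap.congr_fun (this.sub_left ((Commute.one_left _).smul_left _)).eq v

theorem commute_loop_moveRight (B : IsBaseBlock α β q r g t) (hg : j + l < g) (i : ℕ) (v : V) :
    loop q r t g i (moveRight q t j l v) = moveRight q t j l (loop q r t g i v) := by
  have := commute_moveRight (B.commute_jm_intertwiner_of_lt le_rfl (by omega)) hg
  exact LinearMap.congr_fun (this.sub_left ((Commute.one_left _).smul_left _)).eq v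

theorem loop_mem (B : IsBaseBlock α β q r g t) {b : ℕ → Bool} (i : ℕ) {v : V} (hv : v ∈ P g b) :
    loop q r t g i v ∈ P g b :=
  sub_mem (B.sys.jm_mem_wtSpace (by omega) (by omega) hv) (Submodule.smul_mem _ _ hv)

theorem intertwiner_loop (B : IsBaseBlock α β q r g t) {k : ℕ} (hk : k + 1 = g) {b : ℕ → Bool}
    {i : ℕ} (hi : zeros b g = i) {v : V} (hv : v ∈ P g b) : τ k (loop q r t g i v) = 0 := by
  simp [loop, (B.intertwiner_last_jm hk hv).1, hi]

theorem loop_intertwiner (B : IsBaseBlock α β q r g t) {k : ℕ} (hk : k + 1 = g) {b : ℕ → Bool}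
    {i : ℕ} (hi : letter g b k = i) {v : V} (hv : v ∈ P g b) : loop q r t g i (τ k v) = 0 := by
  simp [loop, B.jm_last_intertwiner hk hv, hi]

theorem zeros_sortedBits_last (hg : j + l + 1 = g) : zeros (sortedBits j) g = j := by
  rw [zeros_sortedBits]; omega

theorem letter_sortedBits_last (hg : j + l + 1 = g) : letter g (sortedBits j) (j + l) = j + 1 := by
  rw [letter_true (sortedBits_add j l), zeros_sortedBits]; omega

theorem zeros_hookBits_last (hg : j + l + 1 = g) : zeros (hookBits j l) g = j + 1 := by
  rw [← hg, zeros_succ_false (hookBits_self j l), zeros_hookBits]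

theorem letter_hookBits_last : letter g (hookBits j l) (j + l) = j := by
  rw [letter_false (hookBits_self j l), zeros_hookBits]

theorem climb_apply (hg : j + l + 1 = g) (v : V) :
    climb q t g j v = moveLeft q t j l (τ (j + l) v) := by
  rw [climb, if_pos (by omega), show g - 1 - j = l by omega, show g - 1 = j + l by omega]; rfl

theorem descend_apply (hg : j + l + 1 = g) (v : V) :
    descend q t g j v = τ (j + l) (moveRight q t j l v) := by
  rw [descend, if_pos (by omega), show g - 1 - j = l by omega, show g - 1 = j + l by omega]; rfl

theorem exists_edge (B : IsBaseBlock α β q r g t) (hg : j + l + 1 = g) :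
    ∃ κ μ : K, κ ≠ 0 ∧ μ ≠ 0 ∧
      (∀ v ∈ P g (sortedBits j),
        descend q t g j (climb q t g j v) = κ • loop q r t g j v) ∧
      ∀ v ∈ P g (sortedBits (j + 1)),
        climb q t g j (descend q t g j v) = μ • loop q r t g (j + 1) v := by
  obtain ⟨a, ha, h1, h2⟩ := B.exists_move le_rfl (show j + l < g by omega)
  obtain ⟨c, hc, h3⟩ := B.exists_intertwiner_last_sq hg (sortedBits j)
  obtain ⟨d, hd, h4⟩ := B.exists_intertwiner_last_sq hg (hookBits j l)
  refine ⟨a * c, d * a, mul_ne_zero ha hc, mul_ne_zero hd ha, fun v hv => ?_, fun v hv => ?_⟩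
  · rw [descend_apply hg, climb_apply hg, h2 _ (B.mem_hookBits_of_sortedBits hg hv), map_smul,
      h3 v hv, zeros_sortedBits_last hg, smul_smul]
  · rw [← hookBits_zero] at hv
    rw [descend_apply hg, climb_apply hg, h4 _ (B.moveRight_mem le_rfl (by omega) hv),
      zeros_hookBits_last hg, map_smul, B.commute_loop_moveRight (by omega),
      h1 _ (B.loop_mem _ hv), smul_smul]

theorem climb_climb (B : IsBaseBlock α β q r g t) (hg : j + l + 2 = g) {v : V}
    (hv : v ∈ P g (sortedBits j)) : climb q t g (j + 1) (climb q t g j v) = 0 := by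
  rw [climb_apply (show j + (l + 1) + 1 = g by omega),
    climb_apply (show j + 1 + l + 1 = g by omega), show j + 1 + l = j + l + 1 by omega,
    show j + (l + 1) = j + l + 1 by omega]
  have hc := LinearMap.congr_fun (commute_moveLeft (z := j) (l := l)
    (B.commute_intertwiner_of_lt (m := j + l + 1) (by omega)) (by omega)).eq
    (τ (j + l) (τ (j + l + 1) v))
  change moveLeft q t (j + 1) l (τ (j + l + 1)
    (moveLeft q t j l (τ (j + l) (τ (j + l + 1) v)))) = 0
  simp only [Module.End.mul_apply] at hc
  rw [hc, B.sys.intertwiner_cube_eq_zero B.q_ne (by omega) (hv _ (by omega)) (hv _ (by omega)),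
    map_zero, map_zero]
  exact B.intertwiner_eq_zero le_rfl (by omega)
    (by rw [sortedBits_add, add_assoc, sortedBits_add]) hv

theorem descend_descend (B : IsBaseBlock α β q r g t) (hg : j + l + 2 = g) {v : V}
    (hv : v ∈ P g (sortedBits (j + 2))) : descend q t g j (descend q t g (j + 1) v) = 0 := by
  rw [descend_apply (show j + (l + 1) + 1 = g by omega),
    descend_apply (show j + 1 + l + 1 = g by omega), show j + 1 + l = j + l + 1 by omega,
    show j + (l + 1) = j + l + 1 by omega]
  rw [← hookBits_zero] at hv
  have hv1 := B.moveRight_mem le_rfl (show j + 1 + l < g by omega) hv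
  set v1 := moveRight q t (j + 1) l v
  have hc := LinearMap.congr_fun (commute_moveRight (z := j) (l := l)
    (B.commute_intertwiner_of_lt (m := j + l + 1) (by omega)) (by omega)).eq v1
  change τ (j + l + 1) (τ (j + l) (moveRight q t j l (τ (j + l + 1) v1))) = 0
  simp only [Module.End.mul_apply] at hc
  rw [← hc]
  set w := moveRight q t j l v1
  have e : j + l + 1 = j + 1 + l := by omega
  have hw1 : w ∈ P (j + l + 1) (hookBits j l) := by
    refine B.moveRight_mem (by omega) (by omega) ?_
    rw [hookBits_zero, ← bitSpace_congr (b := hookBits (j + 1) l) fun i hi =>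
      hookBits_of_lt (by omega)]
    exact wtSpace_anti (by omega) hv1
  have hw2 : x (j + l + 1) w = (r * q ^ (j + 1)) • w := by
    have hx := LinearMap.congr_fun (commute_moveRight (z := j) (l := l)
      (B.commute_jm_intertwiner_of_lt (m := j + l + 1) (j := j + l + 1) le_rfl (by omega))
      (by omega)).eq v1
    simp only [Module.End.mul_apply] at hx
    have hv2 := hv1 (j + 1 + l) (by omega)
    simp only [letter_hookBits_last] at hv2
    rw [hx, e, hv2, map_smul]
  let b i := if i = j + l + 1 then false else hookBits j l i
  have hb : ∀ k < j + l + 1, hookBits j l k = b k := fun k hk => (if_neg (by omega)).symm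
  have hw : w ∈ P (j + l + 1 + 1) b := by
    refine mem_bitSpace_succ.2 ⟨by rwa [← bitSpace_congr hb], ?_⟩
    rw [hw2, letter_false (if_pos rfl), ← zeros_congr hb,
      zeros_hookBits_last (g := j + l + 1) rfl]
  have hz := B.intertwiner_eq_zero (k := j + l) (by omega) (by omega)
    (by rw [← hb _ (by omega), hookBits_self]; exact (if_pos rfl).symm) hw
  exact B.sys.intertwiner_cube_eq_zero B.q_ne (by omega) (hw _ (by omega)) (hw _ (by omega)) hz

theorem exists_isZigzag (B : IsBaseBlock α β q r g t) : ∃ κ μ : ℕ → K,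
    IsZigzag g κ μ (sortedSpace q r g t) (climb q t g) (descend q t g) (loop q r t g) := by
  have h (j : ℕ) : ∃ κ μ : K, κ ≠ 0 ∧ μ ≠ 0 ∧ (∀ l, j + l + 1 = g →
      (∀ v ∈ P g (sortedBits j),
        descend q t g j (climb q t g j v) = κ • loop q r t g j v) ∧
      ∀ v ∈ P g (sortedBits (j + 1)),
        climb q t g j (descend q t g j v) = μ • loop q r t g (j + 1) v) := by
    by_cases hj : j < g
    · obtain ⟨l, rfl⟩ : ∃ l, g = j + l + 1 := ⟨g - j - 1, by omega⟩
      obtain ⟨κ, μ, h1, h2, h⟩ := B.exists_edge rfl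
      exact ⟨κ, μ, h1, h2, fun l' hl => h⟩
    · exact ⟨1, 1, one_ne_zero, one_ne_zero, fun l hl => by omega⟩
  choose κ μ hκ hμ h using h
  have lo {j : ℕ} (hj : j < g) : sortedSpace q r g t j = P g (sortedBits j) :=
    sortedSpace_of_le hj.le
  have hi {j : ℕ} (hj : j < g) : sortedSpace q r g t (j + 1) = P g (sortedBits (j + 1)) :=
    sortedSpace_of_le hj
  have ex {j : ℕ} (hj : j < g) : ∃ l, j + l + 1 = g := ⟨g - j - 1, by omega⟩
  have hu {j : ℕ} (hj : ¬ j < g) : climb q t g j = 0 := if_neg hj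
  have hd {j : ℕ} (hj : ¬ j < g) : descend q t g j = 0 := if_neg hj
  have hY {j : ℕ} {v : V} (hv : v ∈ sortedSpace q r g t j) :
      loop q r t g j v ∈ sortedSpace q r g t j := by
    by_cases hj : j ≤ g
    · rw [sortedSpace_of_le hj] at *; exact B.loop_mem _ hv
    · rw [sortedSpace_of_lt (by omega)] at *; simp_all
  refine ⟨κ, μ, hκ, hμ, fun j hj => sortedSpace_of_lt hj, fun j v hv => ?_, fun j v hv => ?_,
    fun j v hv => hY hv, fun j v hv => ?_, fun j v hv => ?_, fun j v hv => ?_, fun j v hv => ?_,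
    fun j v hv => ?_, fun j v hv => ?_, fun j v hv => ?_, fun j hj v hv => ?_, fun j v hv => ?_⟩
  · by_cases hj : j < g
    · obtain ⟨l, hl⟩ := ex hj
      rw [lo hj] at hv
      rw [hi hj, climb_apply hl, ← hookBits_zero]
      exact B.moveLeft_mem le_rfl (by omega) (B.mem_hookBits_of_sortedBits hl hv)
    · rw [hu hj]; exact zero_mem _
  · by_cases hj : j < g
    · obtain ⟨l, hl⟩ := ex hj
      rw [hi hj, ← hookBits_zero] at hv
      rw [lo hj, descend_apply hl]
      exact B.mem_sortedBits_of_hookBits hl (B.moveRight_mem le_rfl (by omega) hv)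
    · rw [hd hj]; exact zero_mem _
  · by_cases hj : j ≤ g
    · rw [sortedSpace_of_le hj] at hv
      have := B.loop_sq hv
      rwa [zeros_sortedBits, min_eq_left hj] at this
    · rw [sortedSpace_of_lt (by omega), Submodule.mem_bot] at hv
      simp [hv]
  · by_cases hj : j < g
    · obtain ⟨l, hl⟩ := ex hj
      rw [lo hj] at hv
      rw [climb_apply hl, B.intertwiner_loop hl (zeros_sortedBits_last hl) hv, map_zero]
    · rw [hu hj]; rfl
  · by_cases hj : j < g
    · obtain ⟨l, hl⟩ := ex hj
      rw [lo hj] at hv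
      rw [climb_apply hl, B.commute_loop_moveLeft (by omega),
        B.loop_intertwiner hl (letter_sortedBits_last hl) hv, map_zero]
    · rw [hu hj]; simp
  · by_cases hj : j < g
    · obtain ⟨l, hl⟩ := ex hj
      rw [hi hj, ← hookBits_zero] at hv
      rw [descend_apply hl, ← B.commute_loop_moveRight (by omega), B.intertwiner_loop hl
        (zeros_hookBits_last hl) (B.moveRight_mem le_rfl (by omega) hv)]
    · rw [hd hj]; rfl
  · by_cases hj : j < g
    · obtain ⟨l, hl⟩ := ex hj
      rw [hi hj, ← hookBits_zero] at hv
      rw [descend_apply hl, B.loop_intertwiner hl letter_hookBits_last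
        (B.moveRight_mem le_rfl (by omega) hv)]
    · rw [hd hj]; simp
  · by_cases hj : j + 1 < g
    · rw [lo (by omega)] at hv
      exact B.climb_climb (l := g - j - 2) (by omega) hv
    · rw [hu hj]; rfl
  · by_cases hj : j + 1 < g
    · rw [sortedSpace_of_le (by omega)] at hv
      exact B.descend_descend (l := g - j - 2) (by omega) hv
    · rw [hd hj]; simp
  · obtain ⟨l, hl⟩ := ex hj
    rw [lo hj] at hv
    exact (h j l hl).1 v hv
  · by_cases hj : j < g
    · obtain ⟨l, hl⟩ := ex hj
      rw [hi hj] at hv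
      exact (h j l hl).2 v hv
    · rw [sortedSpace_of_lt (by omega), Submodule.mem_bot] at hv
      simp [hv]

end IsBaseBlock

section equivariance

variable {K V W : Type*} [Field K] [AddCommGroup V] [Module K V] [AddCommGroup W] [Module K W]
  {n : ℕ} {q r : K} {t : ℕ → Module.End K V} {s : ℕ → Module.End K W} {φ : V →ₗ[K] W}

namespace IsRepHom

theorem jm (h : IsRepHom n t s φ) {k : ℕ} (hk : k < n) (v : V) :
    φ (jucysMurphy q t k v) = jucysMurphy q s k (φ v) := by
  induction k generalizing v with
  | zero => exact h 0 hk v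
  | succ k ih =>
    simp only [jucysMurphy, LinearMap.smul_apply, Module.End.mul_apply, map_smul, h _ hk,
      ih (by omega)]

theorem intertwiner (h : IsRepHom n t s φ) {k : ℕ} (hk : k + 1 < n) (v : V) :
    φ (_root_.intertwiner q t k v) = _root_.intertwiner q s k (φ v) := by
  simp only [_root_.intertwiner, LinearMap.sub_apply, LinearMap.smul_apply, Module.End.mul_apply,
    map_sub, map_smul, h _ hk, h.jm hk, h.jm (show k < n by omega)]

theorem moveRight (h : IsRepHom n t s φ) {z l : ℕ} (hk : z + l < n) (v : V) :
    φ (_root_.moveRight q t z l v) = _root_.moveRight q s z l (φ v) := by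
  induction l with
  | zero => rfl
  | succ l ih => simp only [_root_.moveRight, Module.End.mul_apply, ← ih (by omega),
      h.intertwiner (show z + l + 1 < n by omega)]

theorem moveLeft (h : IsRepHom n t s φ) {z l : ℕ} (hk : z + l < n) (v : V) :
    φ (_root_.moveLeft q t z l v) = _root_.moveLeft q s z l (φ v) := by
  induction l generalizing v with
  | zero => rfl
  | succ l ih => simp only [_root_.moveLeft, Module.End.mul_apply, ih (by omega),
      h.intertwiner (show z + l + 1 < n by omega)]

theorem transport (h : IsRepHom n t s φ) {b : ℕ → Bool} {m : ℕ} (hm : m ≤ n) (v : V) :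
    φ (_root_.transport q t b m v) = _root_.transport q s b m (φ v) := by
  induction m generalizing v with
  | zero => rfl
  | succ m ih =>
    have := zeros_le (b := b) m
    cases hb : b m with
    | true => rw [transport_true hb, transport_true hb, ih (by omega)]
    | false =>
      rw [transport_false hb, transport_false hb, Module.End.mul_apply, Module.End.mul_apply,
        ih (by omega), h.moveRight (by omega)]

theorem climb {g : ℕ} (h : IsRepHom (g + 1) t s φ) (j : ℕ) (v : V) :
    φ (_root_.climb q t g j v) = _root_.climb q s g j (φ v) := by
  by_cases hj : j < g
  · rw [_root_.climb, _root_.climb, if_pos hj, if_pos hj, Module.End.mul_apply,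
      Module.End.mul_apply, h.moveLeft (by omega), h.intertwiner (by omega)]
  · rw [_root_.climb, _root_.climb, if_neg hj, if_neg hj]; simp

theorem descend {g : ℕ} (h : IsRepHom (g + 1) t s φ) (j : ℕ) (v : V) :
    φ (_root_.descend q t g j v) = _root_.descend q s g j (φ v) := by
  by_cases hj : j < g
  · rw [_root_.descend, _root_.descend, if_pos hj, if_pos hj, Module.End.mul_apply,
      Module.End.mul_apply, h.intertwiner (by omega), h.moveRight (by omega)]
  · rw [_root_.descend, _root_.descend, if_neg hj, if_neg hj]; simp

theorem loop {g : ℕ} (h : IsRepHom (g + 1) t s φ) (j : ℕ) (v : V) :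
    φ (_root_.loop q r t g j v) = _root_.loop q r s g j (φ v) := by
  simp [_root_.loop, h.jm]

theorem mem_bitSpace {g m : ℕ} (h : IsRepHom n t s φ) (hm : m ≤ n) {b : ℕ → Bool} {v : V}
    (hv : v ∈ bitSpace q r g t m b) : φ v ∈ bitSpace q r g s m b := fun k hk => by
  rw [← h.jm (by omega), hv k hk, map_smul]

theorem mem_sortedSpace {g j : ℕ} (h : IsRepHom (g + 1) t s φ) {v : V}
    (hv : v ∈ sortedSpace q r g t j) : φ v ∈ sortedSpace q r g s j := by
  by_cases hj : j ≤ g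
  · rw [sortedSpace_of_le hj] at *
    exact h.mem_bitSpace (by omega) hv
  · rw [sortedSpace_of_lt (by omega)] at *
    simp_all

theorem fst : IsRepHom n (fun i => (t i).prodMap (s i)) t (LinearMap.fst K V W) :=
  fun _ _ _ => rfl

theorem snd : IsRepHom n (fun i => (t i).prodMap (s i)) s (LinearMap.snd K V W) :=
  fun _ _ _ => rfl

theorem inl : IsRepHom n t (fun i => (t i).prodMap (s i)) (LinearMap.inl K V W) :=
  fun _ _ _ => by simp

theorem inr : IsRepHom n s (fun i => (t i).prodMap (s i)) (LinearMap.inr K V W) :=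
  fun _ _ _ => by simp

end IsRepHom

theorem HeckeSystem.prodMap {α β : K} (H : HeckeSystem α β q n t) (H' : HeckeSystem α β q n s) :
    HeckeSystem α β q n (fun i => (t i).prodMap (s i)) :=
  (H.prod H').map (LinearMap.prodMapAlgHom K V W)

end equivariance

namespace IsBaseBlock

variable {K V W : Type*} [Field K] [AddCommGroup V] [Module K V] [AddCommGroup W] [Module K W]
  {α β q r : K} {g : ℕ} {t : ℕ → Module.End K V} {s : ℕ → Module.End K W}

theorem prodMap (B : IsBaseBlock α β q r g t) (B' : IsBaseBlock α β q r g s) :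
    IsBaseBlock α β q r g (fun i => (t i).prodMap (s i)) := by
  have key (v : V × W) (hv : v ≠ 0) (c : ℕ → K) (hc : ∀ k < g + 1,
      jucysMurphy q (fun i => (t i).prodMap (s i)) k v = c k • v) :
      Set.InjOn c (Finset.range (g + 1)) ∧ ∀ k < g + 1, ∃ j ≤ g, c k = r * q ^ j := by
    by_cases h : v.1 = 0
    · have h2 : v.2 ≠ 0 := fun h2 => hv (Prod.ext h h2)
      have h3 (k : ℕ) (hk : k < g + 1) : jucysMurphy q s k v.2 = c k • v.2 := by
        have := (IsRepHom.snd (t := t) (s := s)).jm (q := q) hk v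
        rw [hc k hk, map_smul] at this
        exact this.symm
      exact ⟨B'.inj _ h2 c h3, B'.mem _ h2 c h3⟩
    · have h3 (k : ℕ) (hk : k < g + 1) : jucysMurphy q t k v.1 = c k • v.1 := by
        have := (IsRepHom.fst (t := t) (s := s)).jm (q := q) hk v
        rw [hc k hk, map_smul] at this
        exact this.symm
      exact ⟨B.inj _ h c h3, B.mem _ h c h3⟩
  exact ⟨B.sys.prodMap B'.sys, B.q_ne, B.r_ne, B.ends, B.pow_ne, B.sq_ne,
    fun v hv c hc => (key v hv c hc).1, fun v hv c hc => (key v hv c hc).2⟩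

local notation "x" => jucysMurphy q t
local notation "τ" => intertwiner q t
local notation "P" => bitSpace q r g t

theorem letter_injective {b b' : ℕ → Bool} {m : ℕ} (hm : m ≤ g)
    (h : ∀ k < m, letter g b k = letter g b' k) : ∀ k < m, b k = b' k := by
  intro k
  induction k using Nat.strong_induction_on with
  | _ k ih =>
    intro hk
    have hz := zeros_le (b := b) k
    have e := zeros_congr fun i hi => ih i hi (by omega)
    have h1 := h k hk
    cases hb : b k <;> cases hb' : b' k
    · rfl
    · rw [letter_false hb, letter_true hb'] at h1; omega
    · rw [letter_true hb, letter_false hb'] at h1; omega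
    · rfl

/-- Extension of finitely many bits by `true`. -/
def extendBits (b : Fin g → Bool) (i : ℕ) : Bool := if h : i < g then b ⟨i, h⟩ else true

theorem extendBits_restrict (b : ℕ → Bool) : ∀ k < g, extendBits (fun i : Fin g => b i) k = b k :=
  fun _ hk => dif_pos hk

theorem iSupIndep_bitSpace (B : IsBaseBlock α β q r g t) :
    iSupIndep fun b : Fin g → Bool => P g (extendBits b) := by
  have h := Module.End.independent_iInf_maxGenEigenspace_of_forall_mapsTo
    (fun i : Fin g => x i) fun i j φ => Module.End.mapsTo_maxGenEigenspace_of_comm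
      (B.sys.commute_jm (by omega) (by omega)).symm φ
  have hinj : Function.Injective fun (b : Fin g → Bool) (i : Fin g) =>
      r * q ^ letter g (extendBits b) i := fun b b' e => by
    have h1 (k : ℕ) (hk : k < g) : letter g (extendBits b) k = letter g (extendBits b') k := by
      by_contra hne
      have h2 := letter_le (b := extendBits b) hk.le
      have h3 := letter_le (b := extendBits b') hk.le
      exact B.letter_ne' hne (by omega) (by omega) (congrFun e ⟨k, hk⟩)
    funext i
    simpa [extendBits] using letter_injective le_rfl h1 i i.2
  refine (h.comp hinj).mono fun b v hv => ?_
  simp only [Function.comp_apply, Submodule.mem_iInf]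
  intro i
  exact Module.End.mem_maxGenEigenspace _ _ _ |>.2 ⟨1, by simp [hv i i.2]⟩

/-- The subspace generated by subspaces of the sorted weight spaces. -/
def sweep (q : K) (g : ℕ) (t : ℕ → Module.End K V) (Γ : ℕ → Submodule K V) : Submodule K V :=
  ⨆ b : Fin g → Bool, (Γ (zeros (extendBits b) g)).map (transport q t (extendBits b) g)

theorem transport_mem_sweep {Γ : ℕ → Submodule K V} {b : ℕ → Bool} {v : V}
    (hv : v ∈ Γ (zeros b g)) : transport q t b g v ∈ sweep q g t Γ := by
  have h := extendBits_restrict (g := g) b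
  rw [← transport_congr h]
  rw [← zeros_congr h] at hv
  exact Submodule.mem_iSup_of_mem _ (Submodule.mem_map_of_mem hv)

theorem sweep_invariant {Γ : ℕ → Submodule K V} {f : Module.End K V}
    (h : ∀ b, ∀ v ∈ Γ (zeros b g), f (transport q t b g v) ∈ sweep q g t Γ) :
    ∀ v ∈ sweep q g t Γ, f v ∈ sweep q g t Γ := by
  suffices h : sweep q g t Γ ≤ (sweep q g t Γ).comap f from h
  refine iSup_le fun b => ?_
  rintro _ ⟨v, hv, rfl⟩
  exact h _ v hv

theorem sub_injective (B : IsBaseBlock α β q r g t) {k : ℕ} (hk : k + 1 < g + 1) :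
    Function.Injective (x (k + 1) - x k) := by
  rw [← LinearMap.ker_eq_bot]
  by_contra hne
  obtain ⟨u, hu, hu0, c, hc⟩ := B.exists_weight hne fun j hj u hu => by
    have h1 := (B.sys.commute_jm hk hj).sub_left (B.sys.commute_jm (show k < g + 1 by omega) hj)
    have h2 := LinearMap.congr_fun h1.eq u
    simp only [Module.End.mul_apply] at h2
    rw [LinearMap.mem_ker] at hu ⊢
    rw [h2, hu, map_zero]
  rw [LinearMap.mem_ker, LinearMap.sub_apply, hc _ hk, hc k (by omega), ← sub_smul] at hu
  have := B.inj u hu0 c hc (x₁ := k + 1) (x₂ := k) (by simpa using hk) (by simp; omega)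
    (sub_eq_zero.1 ((smul_eq_zero.1 hu).resolve_right hu0))
  omega

theorem sweep_intertwiner (B : IsBaseBlock α β q r g t) {Γ : ℕ → Submodule K V}
    (hΓ : ∀ j ≤ g, Γ j ≤ P g (sortedBits j))
    (hu : ∀ j, ∀ v ∈ Γ j, climb q t g j v ∈ Γ (j + 1))
    (hd : ∀ j, ∀ v ∈ Γ (j + 1), descend q t g j v ∈ Γ j) {k : ℕ} (hk : k + 1 < g + 1) :
    ∀ v ∈ sweep q g t Γ, τ k v ∈ sweep q g t Γ := by
  refine sweep_invariant fun b v hv => ?_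
  have hv' := hΓ _ (zeros_le g) hv
  by_cases hkg : k + 1 < g
  · by_cases hb : b k = b (k + 1)
    · rw [B.intertwiner_eq_zero le_rfl hkg hb (B.transport_mem le_rfl b hv')]
      exact zero_mem _
    · obtain ⟨a, ha⟩ := B.exists_transport_swapBits le_rfl hkg hb
      rw [ha v hv']
      exact Submodule.smul_mem _ _ (transport_mem_sweep (by rwa [zeros_swapBits (by omega)]))
  · obtain rfl : g = k + 1 := by omega
    have hz := zeros_le (b := b) k
    have hc (w : V) : τ k (transport q t b k w) = transport q t b k (τ k w) :=
      LinearMap.congr_fun (commute_transport (B.commute_intertwiner_of_lt (by omega)) le_rfl).eq w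
    obtain ⟨l, hl⟩ : ∃ l, k = zeros b k + l := ⟨k - zeros b k, by omega⟩
    have hup (e : Bool) : ∀ i < k, b i = Function.update b k e i :=
      fun i hi => (Function.update_of_ne (by omega) _ _).symm
    cases hb : b k with
    | true =>
      rw [transport_true hb, hc]
      rw [zeros_succ_true hb] at hv hv'
      obtain ⟨a, ha, -, h⟩ := B.exists_move le_rfl (show zeros b k + l < k + 1 by omega)
      have h1 := h (τ k v) (by
        have := B.mem_hookBits_of_sortedBits (l := l) (by omega) hv'
        rwa [← hl] at this)
      have h2 := climb_apply (q := q) (t := t) (g := k + 1) (j := zeros b k) (l := l) (by omega) v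
      rw [← hl] at h2
      rw [← h2] at h1
      have h3 := transport_mem_sweep (q := q) (t := t) (g := k + 1) (Γ := Γ)
        (b := Function.update b k false) (v := climb q t (k + 1) (zeros b k) v) (by
          rw [zeros_succ_false (Function.update_self ..), ← zeros_congr (hup false)]
          exact hu _ v hv)
      rw [transport_false (Function.update_self ..), ← zeros_congr (hup false),
        ← transport_congr (hup false), Module.End.mul_apply, show k - zeros b k = l by omega, h1,
        map_smul] at h3
      simpa [smul_smul, ha] using Submodule.smul_mem _ a⁻¹ h3
    | false =>
      rw [zeros_succ_false hb] at hv
      rw [transport_false hb, Module.End.mul_apply, hc, show k - zeros b k = l by omega]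
      have h2 := descend_apply (q := q) (t := t) (g := k + 1) (j := zeros b k) (l := l) (by omega) v
      rw [← hl] at h2
      rw [← h2]
      have h3 := transport_mem_sweep (q := q) (t := t) (g := k + 1) (Γ := Γ)
        (b := Function.update b k true) (v := descend q t (k + 1) (zeros b k) v) (by
          rw [zeros_succ_true (Function.update_self ..), ← zeros_congr (hup true)]
          exact hd _ v hv)
      rwa [transport_true (Function.update_self ..), ← transport_congr (hup true)] at h3

theorem sweep_jm (B : IsBaseBlock α β q r g t) {Γ : ℕ → Submodule K V}
    (hΓ : ∀ j ≤ g, Γ j ≤ P g (sortedBits j)) (hx : ∀ j, ∀ v ∈ Γ j, x g v ∈ Γ j)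
    {k : ℕ} (hk : k < g + 1) : ∀ v ∈ sweep q g t Γ, x k v ∈ sweep q g t Γ := by
  refine sweep_invariant fun b v hv => ?_
  by_cases hkg : k < g
  · rw [B.transport_mem le_rfl b (hΓ _ (zeros_le g) hv) k hkg]
    exact Submodule.smul_mem _ _ (transport_mem_sweep hv)
  · obtain rfl : k = g := by omega
    have h1 := LinearMap.congr_fun (commute_transport (b := b)
      (B.commute_jm_intertwiner_of_lt le_rfl (by omega)) le_rfl).eq v
    simp only [Module.End.mul_apply] at h1
    rw [h1]
    exact transport_mem_sweep (hx _ v hv)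

theorem sweep_gen [FiniteDimensional K V] (B : IsBaseBlock α β q r g t) {Γ : ℕ → Submodule K V}
    (hΓ : ∀ j ≤ g, Γ j ≤ P g (sortedBits j)) (hx : ∀ j, ∀ v ∈ Γ j, x g v ∈ Γ j)
    (hu : ∀ j, ∀ v ∈ Γ j, climb q t g j v ∈ Γ (j + 1))
    (hd : ∀ j, ∀ v ∈ Γ (j + 1), descend q t g j v ∈ Γ j) {k : ℕ} (hk : k < g + 1) :
    ∀ v ∈ sweep q g t Γ, t k v ∈ sweep q g t Γ := by
  intro v hv
  cases k with
  | zero => exact B.sweep_jm hΓ hx hk v hv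
  | succ k =>
    have hS : ∀ v ∈ sweep q g t Γ, (x (k + 1) - x k) v ∈ sweep q g t Γ := fun v hv =>
      sub_mem (B.sweep_jm hΓ hx hk v hv) (B.sweep_jm hΓ hx (by omega) v hv)
    have hinj : Function.Injective ((x (k + 1) - x k).restrict hS) := fun a b e =>
      Subtype.ext (B.sub_injective hk (congrArg Subtype.val e))
    obtain ⟨w, hw⟩ := (LinearMap.injective_iff_surjective.1 hinj) ⟨v, hv⟩
    have hw : (x (k + 1) - x k) w = v := congrArg Subtype.val hw
    have h1 : t (k + 1) v = τ k w + (q - 1) • x (k + 1) w := by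
      rw [← hw]; simp [intertwiner]
    rw [h1]
    exact add_mem (B.sweep_intertwiner hΓ hu hd hk w w.2)
      (Submodule.smul_mem _ _ (B.sweep_jm hΓ hx hk w w.2))

end IsBaseBlock

namespace IsBaseBlock

variable {K V W : Type*} [Field K] [AddCommGroup V] [Module K V] [AddCommGroup W] [Module K W]
  {α β q r : K} {g : ℕ} {t : ℕ → Module.End K V} {s : ℕ → Module.End K W}

local notation "P" => bitSpace q r g t

/-- Morphisms of zigzag representations lift to morphisms of base blocks. -/
theorem exists_lift [FiniteDimensional K V] [FiniteDimensional K W] (B : IsBaseBlock α β q r g t)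
    (B' : IsBaseBlock α β q r g s) (f : ℕ → V →ₗ[K] W)
    (hf : ∀ j, ∀ v ∈ sortedSpace q r g t j, f j v ∈ sortedSpace q r g s j)
    (hx : ∀ j, ∀ v ∈ sortedSpace q r g t j, f j (loop q r t g j v) = loop q r s g j (f j v))
    (hu : ∀ j, ∀ v ∈ sortedSpace q r g t j, f (j + 1) (climb q t g j v) = climb q s g j (f j v))
    (hd : ∀ j, ∀ v ∈ sortedSpace q r g t (j + 1),
      f j (descend q t g j v) = descend q s g j (f (j + 1) v)) :
    ∃ F : V →ₗ[K] W, IsRepHom (g + 1) t s F ∧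
      ∀ j, ∀ v ∈ sortedSpace q r g t j, F v = f j v := by
  obtain ⟨κ, μ, Z⟩ := B.exists_isZigzag
  let T i := (t i).prodMap (s i)
  let Γ j : Submodule K (V × W) := (sortedSpace q r g t j).map (LinearMap.id.prod (f j))
  have hΓ (j : ℕ) (v : V) (hv : v ∈ sortedSpace q r g t j) : (v, f j v) ∈ Γ j :=
    ⟨v, hv, rfl⟩
  have hfst : IsRepHom (g + 1) T t (LinearMap.fst K V W) := IsRepHom.fst
  have hsnd : IsRepHom (g + 1) T s (LinearMap.snd K V W) := IsRepHom.snd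
  have BT : IsBaseBlock α β q r g T := B.prodMap B'
  have hΓle (j : ℕ) (hj : j ≤ g) : Γ j ≤ bitSpace q r g T g (sortedBits j) := by
    rintro _ ⟨v, hv, rfl⟩
    have h2 := hf j v hv
    rw [sortedSpace_of_le hj] at h2
    replace hv : v ∈ sortedSpace q r g t j := hv
    rw [sortedSpace_of_le hj] at hv
    intro k hk
    refine Prod.ext ((hfst.jm (by omega) _).trans (hv k hk))
      ((hsnd.jm (by omega) _).trans (h2 k hk))
  have hS : ∀ k < g + 1, ∀ z ∈ sweep q g T Γ, T k z ∈ sweep q g T Γ := fun k hk => by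
    refine BT.sweep_gen hΓle ?_ ?_ ?_ hk
    · rintro j _ ⟨v, hv, rfl⟩
      have h := Submodule.add_mem _ (hΓ j _ (Z.y_mem j v hv)) (Submodule.smul_mem _ (r * q ^ j)
        (hΓ j v hv))
      convert h using 1
      refine Prod.ext ((hfst.jm (by omega) _).trans ?_) ((hsnd.jm (by omega) _).trans ?_)
      · simp [loop]
      · simp [hx j v hv]
        simp [loop]
    · rintro j _ ⟨v, hv, rfl⟩
      convert hΓ _ _ (Z.u_mem j v hv) using 1
      exact Prod.ext (hfst.climb _ _) ((hsnd.climb _ _).trans (hu j v hv).symm)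
    · rintro j _ ⟨v, hv, rfl⟩
      convert hΓ _ _ (Z.d_mem j v hv) using 1
      exact Prod.ext (hfst.descend _ _) ((hsnd.descend _ _).trans (hd j v hv).symm)
  set S := sweep q g T Γ
  let p : S →ₗ[K] V := LinearMap.fst K V W ∘ₗ S.subtype
  have hsurj : Function.Surjective p := by
    have h : S.map (LinearMap.fst K V W) = ⊤ := by
      refine B.eq_top_of_bitSpace_le fun b v hv => ?_
      obtain ⟨w, hw, rfl⟩ := B.exists_transport_eq le_rfl b hv
      rw [← sortedSpace_of_le (zeros_le g)] at hw
      exact ⟨_, transport_mem_sweep (hΓ _ w hw), hfst.transport (by omega) _⟩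
    intro v
    obtain ⟨z, hz, e⟩ := h.ge (Submodule.mem_top (x := v))
    exact ⟨⟨z, hz⟩, e⟩
  have hinj : Function.Injective p := by
    refine (injective_iff_map_eq_zero p).2 ?_
    rintro ⟨z, hz⟩ (h0 : z.1 = 0)
    obtain ⟨c, hc, rfl⟩ := (Submodule.mem_iSup_iff_exists_finsupp _ _).1 hz
    have hc' (b : Fin g → Bool) : ∃ v ∈ sortedSpace q r g t (zeros (extendBits b) g),
        transport q T (extendBits b) g (v, f (zeros (extendBits b) g) v) = c b := by
      obtain ⟨_, ⟨v, hv, rfl⟩, h⟩ := hc b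
      exact ⟨v, hv, h⟩
    choose v hv e using hc'
    have e1 (b : Fin g → Bool) : (c b).1 = transport q t (extendBits b) g (v b) := by
      rw [← e b]; exact hfst.transport (by omega) _
    have hz := (iSupIndep_iff_finsetSum_eq_zero_imp_eq_zero _).1 B.iSupIndep_bitSpace c.support
      (fun b => (c b).1) (fun b _ => by
        have h3 := hv b
        rw [sortedSpace_of_le (zeros_le g)] at h3
        change (c b).1 ∈ P g (extendBits b)
        rw [e1]
        exact B.transport_mem le_rfl _ h3) (by
        rw [← h0]; simp [Finsupp.sum, Prod.fst_sum])
    refine Subtype.ext (Finset.sum_eq_zero fun b hb => ?_)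
    have h3 := hv b
    rw [sortedSpace_of_le (zeros_le g)] at h3
    have h4 := B.transport_injective le_rfl h3 ((e1 b).symm.trans (hz b hb))
    rw [← e b, h4, map_zero]
    exact map_zero _
  let E := LinearEquiv.ofBijective p ⟨hinj, hsurj⟩
  have hE (z : V × W) (hz : z ∈ S) : ((E.symm z.1 : S) : V × W) = z :=
    congrArg Subtype.val (E.symm_apply_apply ⟨z, hz⟩)
  refine ⟨LinearMap.snd K V W ∘ₗ S.subtype ∘ₗ E.symm.toLinearMap, fun i hi v => ?_,
    fun j v hv => ?_⟩
  · obtain ⟨⟨z, hz⟩, rfl⟩ := hsurj v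
    change ((E.symm (T i z).1 : S) : V × W).2 = s i ((E.symm z.1 : S) : V × W).2
    rw [hE _ hz, hE _ (hS i hi z hz)]
    rfl
  · by_cases hj : j ≤ g
    · have h1 := transport_mem_sweep (q := q) (t := T) (Γ := Γ) (g := g) (b := sortedBits j)
        (v := (v, f j v)) (by rw [zeros_sortedBits, min_eq_left hj]; exact hΓ j v hv)
      rw [transport_sortedBits] at h1
      exact congrArg Prod.snd (hE _ h1)
    · rw [sortedSpace_of_lt (by omega), Submodule.mem_bot] at hv
      simp [hv]

end IsBaseBlock

section strings

variable {K V : Type*} [Field K] [AddCommGroup V] [Module K V]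

/-- Sequences of vectors along which `u` and `d` act as prescribed by the signs `ε` and `δ`. -/
def IsZigzagChain (A : ℕ → Submodule K V) (u d : ℕ → Module.End K V) (ε δ : ℕ → Bool) (k : ℕ)
    (v : ℕ → V) : Prop :=
  (∀ j ≤ k, v j ∈ A j) ∧ ∀ j < k, u j (v j) = (if ε j then v (j + 1) else 0) ∧
    d j (v (j + 1)) = if δ j then v j else 0

/-- Sequences of functionals along which `u` and `d` act as prescribed by the signs. -/
def IsZigzagCochain (A : ℕ → Submodule K V) (u d : ℕ → Module.End K V) (ε δ : ℕ → Bool) (k : ℕ)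
    (ξ : ℕ → V →ₗ[K] K) : Prop :=
  ∀ j < k, (∀ w ∈ A j, ξ (j + 1) (u j w) = if ε j then ξ j w else 0) ∧
    ∀ w ∈ A (j + 1), ξ j (d j w) = if δ j then ξ (j + 1) w else 0

/-- A chain and a cochain that pair to `1` at the vertex `i`. -/
def HasString (A : ℕ → Submodule K V) (u d : ℕ → Module.End K V) (ε δ : ℕ → Bool) (k i : ℕ) :
    Prop :=
  ∃ v ξ, IsZigzagChain A u d ε δ k v ∧ IsZigzagCochain A u d ε δ k ξ ∧ ξ i (v i) = 1

variable {A : ℕ → Submodule K V} {u d : ℕ → Module.End K V} {ε δ : ℕ → Bool} {k : ℕ}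

theorem IsZigzagChain.extend {v : ℕ → V} (h : IsZigzagChain A u d ε δ k v) {w : V} {a b : Bool}
    (hw : w ∈ A (k + 1)) (hu : u k (v k) = if a then w else 0)
    (hd : d k w = if b then v k else 0) :
    IsZigzagChain A u d (Function.update ε k a) (Function.update δ k b) (k + 1)
      (Function.update v (k + 1) w) := by
  have hv (j : ℕ) (hj : j ≤ k) : Function.update v (k + 1) w j = v j :=
    Function.update_of_ne (by omega) _ _
  refine ⟨fun j hj => ?_, fun j hj => ?_⟩
  · rcases Nat.lt_or_ge k j with h1 | h1
    · obtain rfl : j = k + 1 := by omega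
      rwa [Function.update_self]
    · rw [hv j h1]; exact h.1 j h1
  · rcases Nat.lt_or_ge j k with h1 | h1
    · rw [hv j (by omega), hv (j + 1) (by omega), Function.update_of_ne h1.ne,
        Function.update_of_ne h1.ne]
      exact h.2 j h1
    · obtain rfl : j = k := by omega
      rw [hv j le_rfl, Function.update_self, Function.update_self, Function.update_self]
      exact ⟨hu, hd⟩

theorem IsZigzagCochain.extend {ξ : ℕ → V →ₗ[K] K} (h : IsZigzagCochain A u d ε δ k ξ) {η : V →ₗ[K] K}
    {a b : Bool} (hu : ∀ w ∈ A k, η (u k w) = if a then ξ k w else 0)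
    (hd : ∀ w ∈ A (k + 1), ξ k (d k w) = if b then η w else 0) :
    IsZigzagCochain A u d (Function.update ε k a) (Function.update δ k b) (k + 1)
      (Function.update ξ (k + 1) η) := by
  have hv (j : ℕ) (hj : j ≤ k) : Function.update ξ (k + 1) η j = ξ j :=
    Function.update_of_ne (by omega) _ _
  intro j hj
  rcases Nat.lt_or_ge j k with h1 | h1
  · rw [hv j (by omega), hv (j + 1) (by omega), Function.update_of_ne h1.ne,
      Function.update_of_ne h1.ne]
    exact h j h1
  · obtain rfl : j = k := by omega
    rw [hv j le_rfl, Function.update_self, Function.update_self, Function.update_self]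
    exact ⟨hu, hd⟩

theorem HasString.congr {ε' δ' : ℕ → Bool} {i : ℕ} (h : HasString A u d ε δ k i)
    (hε : ∀ j < k, ε' j = ε j) (hδ : ∀ j < k, δ' j = δ j) : HasString A u d ε' δ' k i := by
  obtain ⟨v, ξ, hv, hξ, h1⟩ := h
  refine ⟨v, ξ, ⟨hv.1, fun j hj => ?_⟩, fun j hj => ?_, h1⟩
  · rw [hε j hj, hδ j hj]; exact hv.2 j hj
  · rw [hε j hj, hδ j hj]; exact hξ j hj

/-- A string that ends at the vertex `k` can be prolonged by zero. -/
theorem exists_hasString {v : ℕ → V} {ξ : ℕ → V →ₗ[K] K} (hv : IsZigzagChain A u d ε δ k v)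
    (hξ : IsZigzagCochain A u d ε δ k ξ) {i : ℕ} (hi : i ≤ k) (h1 : ξ i (v i) = 1)
    (hu : u k (v k) = 0) (hd : ∀ w ∈ A (k + 1), ξ k (d k w) = 0) {m : ℕ} (hm : k ≤ m) :
    ∃ ε δ, HasString A u d ε δ m i := by
  suffices h : ∃ ε δ v ξ, IsZigzagChain A u d ε δ m v ∧ IsZigzagCochain A u d ε δ m ξ ∧
      u m (v m) = 0 ∧ (∀ w ∈ A (m + 1), ξ m (d m w) = 0) ∧ ξ i (v i) = 1 by
    obtain ⟨ε, δ, v, ξ, hv, hξ, -, -, h1⟩ := h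
    exact ⟨ε, δ, v, ξ, hv, hξ, h1⟩
  induction m, hm using Nat.le_induction with
  | base => exact ⟨ε, δ, v, ξ, hv, hξ, hu, hd, h1⟩
  | succ m hm ih =>
    obtain ⟨ε, δ, v, ξ, hv, hξ, hu, hd, h1⟩ := ih
    refine ⟨_, _, _, _, hv.extend (a := false) (b := false) (zero_mem _) (by simpa using hu)
      (by simp), hξ.extend (a := false) (b := false) (η := 0) (by simp) (by simpa using hd),
      by simp, by simp, ?_⟩
    rwa [Function.update_of_ne (by omega), Function.update_of_ne (by omega)]

/-- A string up to the vertex `k` that is not yet determined at `k`. -/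
structure IsPartialString (A : ℕ → Submodule K V) (u d : ℕ → Module.End K V) (ε δ : ℕ → Bool)
    (k : ℕ) (C D : Submodule K V) : Prop where
  le : D ≤ C
  le_space : C ≤ A k
  not_le : ¬ C ≤ D
  lift : ∀ w ∈ C, ∃ v, v k = w ∧ IsZigzagChain A u d ε δ k v
  colift : ∀ η : V →ₗ[K] K, (∀ w ∈ D, η w = 0) → ∃ ξ, ξ k = η ∧ IsZigzagCochain A u d ε δ k ξ

namespace IsPartialString

variable {C D : Submodule K V}

theorem finish (S : IsPartialString A u d ε δ k C D) {w : V} (hw : w ∈ C) (hu : u k w = 0)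
    (hn : w ∉ D ⊔ (A (k + 1)).map (d k)) {m : ℕ} (hm : k ≤ m) :
    ∃ ε δ, HasString A u d ε δ m k := by
  obtain ⟨f, hf, hf0⟩ := Submodule.exists_dual_map_eq_bot_of_notMem hn inferInstance
  have hf1 (a : V) (ha : a ∈ D ⊔ (A (k + 1)).map (d k)) : f a = 0 := by
    have := Submodule.mem_map_of_mem (f := f) ha
    rwa [hf0] at this
  obtain ⟨v, rfl, hv⟩ := S.lift w hw
  obtain ⟨ξ, hξk, hξ⟩ := S.colift ((f (v k))⁻¹ • f) fun a ha => by
    rw [LinearMap.smul_apply, hf1 a (Submodule.mem_sup_left ha), smul_zero]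
  refine exists_hasString hv hξ le_rfl ?_ hu (fun a ha => ?_) hm
  · rw [hξk, LinearMap.smul_apply, smul_eq_mul, inv_mul_cancel₀ hf]
  · rw [hξk, LinearMap.smul_apply,
      hf1 _ (Submodule.mem_sup_right (Submodule.mem_map_of_mem ha)), smul_zero]

theorem climb (S : IsPartialString A u d ε δ k C D)
    (hum : ∀ v ∈ A k, u k v ∈ A (k + 1)) (hdu : ∀ v ∈ A k, d k (u k v) = 0)
    (hud : ∀ v ∈ A (k + 1), u k (d k v) = 0) (h : ∀ w ∈ C, u k w = 0 → w ∈ D) :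
    IsPartialString A u d (Function.update ε k true) (Function.update δ k false) (k + 1)
      (C.map (u k)) (D.map (u k)) where
  le := Submodule.map_mono S.le
  le_space := by
    rintro _ ⟨w, hw, rfl⟩
    exact hum w (S.le_space hw)
  not_le hle := S.not_le fun w hw => by
    obtain ⟨w', hw', e⟩ := hle (Submodule.mem_map_of_mem hw)
    have := h (w - w') (sub_mem hw (S.le hw')) (by rw [map_sub, e, sub_self])
    simpa using add_mem this hw'
  lift := by
    rintro _ ⟨w, hw, rfl⟩
    obtain ⟨v, rfl, hv⟩ := S.lift w hw
    exact ⟨_, Function.update_self .., hv.extend (a := true) (b := false)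
      (hum _ (S.le_space hw)) (by simp) (by simpa using hdu _ (S.le_space hw))⟩
  colift η hη := by
    obtain ⟨ξ, hk, hξ⟩ := S.colift (η ∘ₗ u k) fun w hw => hη _ (Submodule.mem_map_of_mem hw)
    exact ⟨_, Function.update_self .., hξ.extend (a := true) (b := false) (by simp [hk])
      fun w hw => by simp [hk, hud w hw]⟩

theorem descend (S : IsPartialString A u d ε δ k C D)
    (hum : ∀ v ∈ A k, u k v ∈ A (k + 1)) (hdu : ∀ v ∈ A k, d k (u k v) = 0)
    (hC : ∀ w ∈ C, u k w = 0) (h : C ≤ D ⊔ (A (k + 1)).map (d k)) :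
    IsPartialString A u d (Function.update ε k false) (Function.update δ k true) (k + 1)
      (A (k + 1) ⊓ C.comap (d k)) (A (k + 1) ⊓ D.comap (d k)) where
  le := inf_le_inf_left _ (Submodule.comap_mono S.le)
  le_space := inf_le_left
  not_le hle := S.not_le fun w hw => by
    obtain ⟨a, ha, _, ⟨x, hx, rfl⟩, rfl⟩ := Submodule.mem_sup.1 (h hw)
    have hdx : d k x ∈ C := by simpa using sub_mem hw (S.le ha)
    exact add_mem ha (hle ⟨hx, hdx⟩).2
  lift x hx := by
    obtain ⟨v, hk, hv⟩ := S.lift (d k x) hx.2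
    exact ⟨_, Function.update_self .., hv.extend (a := false) (b := true) hx.1
      (by simpa [hk] using hC _ hx.2) (by simp [hk])⟩
  colift η hη := by
    obtain ⟨θ, hθ⟩ : ∃ θ : V ⧸ D →ₗ[K] K,
        θ ∘ₗ (D.mkQ ∘ₗ d k ∘ₗ (A (k + 1)).subtype) = η ∘ₗ (A (k + 1)).subtype := by
      have : η ∘ₗ (A (k + 1)).subtype ∈
          LinearMap.range (D.mkQ ∘ₗ d k ∘ₗ (A (k + 1)).subtype).dualMap := by
        rw [LinearMap.range_dualMap_eq_dualAnnihilator_ker, Submodule.mem_dualAnnihilator]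
        intro x hx
        exact hη _ ⟨x.2, by simpa using hx⟩
      exact this
    obtain ⟨ξ, hk, hξ⟩ := S.colift (θ ∘ₗ D.mkQ) fun w hw => by
      simp [(Submodule.Quotient.mk_eq_zero D).2 hw]
    refine ⟨_, Function.update_self .., hξ.extend (a := false) (b := true) (fun w hw => ?_)
      fun w hw => ?_⟩
    · simpa using hη _ ⟨hum w hw, by simp [hdu w hw]⟩
    · rw [hk]
      exact LinearMap.congr_fun hθ ⟨w, hw⟩

theorem exists_hasString {g : ℕ} (hbot : A (g + 1) = ⊥)
    (hum : ∀ j, ∀ v ∈ A j, u j v ∈ A (j + 1)) (huu : ∀ j, ∀ v ∈ A j, u (j + 1) (u j v) = 0)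
    (hdd : ∀ j, ∀ v ∈ A (j + 2), d j (d (j + 1) v) = 0) (hdm : ∀ j, ∀ v ∈ A (j + 1), d j v ∈ A j)
    (hdu : ∀ j, ∀ v ∈ A j, d j (u j v) = 0) (hud : ∀ j, ∀ v ∈ A (j + 1), u j (d j v) = 0)
    (S : IsPartialString A u d ε δ k C D) (hk : k ≤ g + 1)
    (h : (∀ x ∈ A (k + 1), d k x ∈ D) ∨ ∀ w ∈ C, u k w = 0) :
    ∃ ε δ i, i ≤ g ∧ HasString A u d ε δ g i := by
  obtain ⟨m, hm⟩ := Nat.exists_eq_add_of_le hk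
  induction m generalizing k ε δ C D with
  | zero =>
    have := S.le_space
    rw [show k = g + 1 by omega, hbot, le_bot_iff] at this
    exact absurd (this ▸ bot_le) S.not_le
  | succ m ih =>
    rcases h with h | h
    · by_cases h1 : ∀ w ∈ C, u k w = 0 → w ∈ D
      · refine ih (S.climb (hum k) (hdu k) (hud k) h1) (by omega) (.inr ?_) (by omega)
        rintro _ ⟨w, hw, rfl⟩
        exact huu k w (S.le_space hw)
      · push Not at h1
        obtain ⟨w, hw, hu, hn⟩ := h1
        have hle : D ⊔ (A (k + 1)).map (d k) ≤ D := by
          refine sup_le le_rfl ?_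
          rintro _ ⟨x, hx, rfl⟩
          exact h x hx
        obtain ⟨ε, δ, hs⟩ := S.finish hw hu (m := g) (fun hw' => hn (hle hw')) (by omega)
        exact ⟨ε, δ, k, by omega, hs⟩
    · by_cases h1 : C ≤ D ⊔ (A (k + 1)).map (d k)
      · exact ih (S.descend (hum k) (hdu k) h h1) (by omega)
          (.inl fun x hx => ⟨hdm _ x hx, by simp [hdd k x hx]⟩) (by omega)
      · obtain ⟨w, hw, hn⟩ := SetLike.not_le_iff_exists.1 h1
        obtain ⟨ε, δ, hs⟩ := S.finish hw (h w hw) (m := g) hn (by omega)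
        exact ⟨ε, δ, k, by omega, hs⟩

theorem initial (h : ∀ j < k, A j = ⊥) (hd : ∀ j, ∀ v ∈ A (j + 1), d j v ∈ A j)
    (hle : D ≤ A k) (hn : ¬ A k ≤ D) :
    IsPartialString A u d (fun _ => false) (fun _ => false) k (A k) D where
  le := hle
  le_space := le_rfl
  not_le := hn
  lift w hw := by
    have h1 (j : ℕ) (hj : j ≤ k) : Function.update (0 : ℕ → V) k w j ∈ A j := by
      rcases eq_or_ne j k with rfl | h2
      · rwa [Function.update_self]
      · rw [Function.update_of_ne h2]; exact zero_mem _
    refine ⟨_, Function.update_self .., h1, fun j hj => ⟨?_, ?_⟩⟩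
    · rw [Function.update_of_ne hj.ne]; simp
    · have := hd j _ (h1 (j + 1) hj)
      rw [h j hj, Submodule.mem_bot] at this
      simpa using this
  colift η _ := by
    refine ⟨Function.update 0 k η, Function.update_self .., fun j hj => ⟨fun w hw => ?_,
      fun w hw => ?_⟩⟩
    · rw [h j hj, Submodule.mem_bot] at hw
      simp [hw]
    · rw [Function.update_of_ne hj.ne]; simp

end IsPartialString

/-- A nonzero representation of the zigzag algebra on which the loops vanish has a string as a
direct summand. -/
theorem IsZigzag.exists_hasString {g : ℕ} {κ μ : ℕ → K} {y : ℕ → Module.End K V}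
    (Z : IsZigzag g κ μ A u d y) (hy : ∀ j, ∀ v ∈ A j, y j v = 0) (hne : ∃ j, A j ≠ ⊥) :
    ∃ ε δ i, i ≤ g ∧ HasString A u d ε δ g i := by
  classical
  have ha := Nat.find_spec hne
  have hlt (j : ℕ) (hj : j < Nat.find hne) : A j = ⊥ := not_not.1 (Nat.find_min hne hj)
  set a := Nat.find hne
  have hag : a ≤ g := by
    by_contra hag
    exact ha (Z.eq_bot a (by omega))
  have hdu (j : ℕ) (v : V) (hv : v ∈ A j) : d j (u j v) = 0 := by
    rcases Nat.lt_or_ge j g with h | h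
    · rw [Z.d_u j h v hv, hy j v hv, smul_zero]
    · have := Z.u_mem j v hv
      rw [Z.eq_bot (j + 1) (by omega), Submodule.mem_bot] at this
      rw [this, map_zero]
  have hud (j : ℕ) (v : V) (hv : v ∈ A (j + 1)) : u j (d j v) = 0 := by
    rw [Z.u_d j v hv, hy _ v hv, smul_zero]
  by_cases h : A a ≤ (A (a + 1)).map (d a)
  · refine IsPartialString.exists_hasString (Z.eq_bot _ (by omega)) Z.u_mem Z.u_u Z.d_d Z.d_mem
      hdu hud (.initial (D := ⊥) hlt Z.d_mem bot_le (by rwa [le_bot_iff])) (by omega) (.inr ?_)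
    intro w hw
    obtain ⟨x, hx, rfl⟩ := h hw
    exact hud a x hx
  · refine IsPartialString.exists_hasString (Z.eq_bot _ (by omega)) Z.u_mem Z.u_u Z.d_d Z.d_mem
      hdu hud (.initial hlt Z.d_mem ?_ h) (by omega)
      (.inl fun x hx => Submodule.mem_map_of_mem hx)
    rintro _ ⟨x, hx, rfl⟩
    exact Z.d_mem a x hx

end strings

section zigzagHom

variable {K V W : Type*} [Field K] [AddCommGroup V] [Module K V] [AddCommGroup W] [Module K W]
  {g : ℕ} {κ μ κ' μ' : ℕ → K} {A : ℕ → Submodule K V} {u d y : ℕ → Module.End K V}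
  {A' : ℕ → Submodule K W} {u' d' y' : ℕ → Module.End K W}

/-- Homomorphisms between representations of the zigzag algebra. -/
structure IsZigzagHom (A : ℕ → Submodule K V) (u d y : ℕ → Module.End K V)
    (A' : ℕ → Submodule K W) (u' d' y' : ℕ → Module.End K W) (f : ℕ → V →ₗ[K] W) : Prop where
  mem : ∀ j, ∀ v ∈ A j, f j v ∈ A' j
  loop : ∀ j, ∀ v ∈ A j, f j (y j v) = y' j (f j v)
  climb : ∀ j, ∀ v ∈ A j, f (j + 1) (u j v) = u' j (f j v)
  descend : ∀ j, ∀ v ∈ A (j + 1), f j (d j v) = d' j (f (j + 1) v)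

namespace IsZigzag

theorem of_injective (Z : IsZigzag g κ μ A u d y) (Z' : IsZigzag g κ' μ' A' u' d' y')
    {φ : V →ₗ[K] W} (hφ : Function.Injective φ) (hA : ∀ j, ∀ v ∈ A j, φ v ∈ A' j)
    (hu : ∀ j v, φ (u j v) = u' j (φ v)) (hd : ∀ j v, φ (d j v) = d' j (φ v))
    (hy : ∀ j v, φ (y j v) = y' j (φ v)) : IsZigzag g κ' μ' A u d y :=
  { Z with
    du_ne := Z'.du_ne
    ud_ne := Z'.ud_ne
    d_u := fun j hj v hv => hφ (by
      rw [hd, hu, Z'.d_u j hj _ (hA j v hv), map_smul, hy])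
    u_d := fun j v hv => hφ (by
      rw [hu, hd, Z'.u_d j _ (hA _ v hv), map_smul, hy]) }

theorem eq_zero (Z : IsZigzag g κ μ A u d y) {j : ℕ} (hj : g < j) {v : V} (hv : v ∈ A j) :
    v = 0 := by rwa [Z.eq_bot j hj] at hv

theorem isZigzagHom_string (Z : IsZigzag g κ μ A u d y) (Z' : IsZigzag g κ' μ' A' u' d' y')
    (hy : ∀ j, ∀ v ∈ A j, y j v = 0) (hy' : ∀ j, ∀ v ∈ A' j, y' j v = 0) {ε δ : ℕ → Bool}
    {ξ : ℕ → V →ₗ[K] K} {v' : ℕ → W} (hξ : IsZigzagCochain A u d ε δ g ξ)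
    (hv : IsZigzagChain A' u' d' ε δ g v') :
    IsZigzagHom A u d y A' u' d' y' fun j => (ξ j).smulRight (v' j) where
  mem j x hx := by
    rcases Nat.lt_or_ge g j with h | h
    · rw [Z.eq_zero h hx, map_zero]; exact zero_mem _
    · exact Submodule.smul_mem _ _ (hv.1 j h)
  loop j x hx := by
    rcases Nat.lt_or_ge g j with h | h
    · rw [Z.eq_zero h hx]; simp
    · simp [hy j x hx, hy' j _ (hv.1 j h)]
  climb j x hx := by
    rcases Nat.lt_trichotomy j g with h | rfl | h
    · simp only [LinearMap.smulRight_apply, map_smul, (hv.2 j h).1, (hξ j h).1 x hx]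
      cases ε j <;> simp
    · rw [Z.eq_zero (Nat.lt_succ_self j) (Z.u_mem j x hx), LinearMap.smulRight_apply (ξ j), map_smul,
        Z'.eq_zero (Nat.lt_succ_self j) (Z'.u_mem j _ (hv.1 j le_rfl))]
      simp
    · rw [Z.eq_zero h hx]; simp
  descend j x hx := by
    rcases Nat.lt_or_ge j g with h | h
    · simp only [LinearMap.smulRight_apply, map_smul, (hv.2 j h).2, (hξ j h).2 x hx]
      cases δ j <;> simp
    · rw [Z.eq_zero (by omega) hx]; simp

/-- The homomorphism from the projective cover of a vertex carrying a nonzero loop. -/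
def loopHom (κ μ : ℕ → K) (u d y : ℕ → Module.End K V) (u' d' y' : ℕ → Module.End K W) (i : ℕ)
    (ξ : V →ₗ[K] K) (v' : W) (j : ℕ) : V →ₗ[K] W :=
  if j = i then (ξ ∘ₗ y i).smulRight v' + ξ.smulRight (y' i v')
  else if j = i + 1 then (ξ ∘ₗ d i).smulRight ((κ i)⁻¹ • u' i v')
  else if j + 1 = i then (ξ ∘ₗ u j).smulRight ((μ j)⁻¹ • d' j v')
  else 0

section

variable {i j : ℕ} {ξ : V →ₗ[K] K} {v' : W}

theorem loopHom_self : loopHom κ μ u d y u' d' y' i ξ v' i =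
    (ξ ∘ₗ y i).smulRight v' + ξ.smulRight (y' i v') := if_pos rfl

theorem loopHom_next : loopHom κ μ u d y u' d' y' i ξ v' (i + 1) =
    (ξ ∘ₗ d i).smulRight ((κ i)⁻¹ • u' i v') := by simp [loopHom]

theorem loopHom_prev : loopHom κ μ u d y u' d' y' (j + 1) ξ v' j =
    (ξ ∘ₗ u j).smulRight ((μ j)⁻¹ • d' j v') := by
  simp [loopHom, show j ≠ j + 1 + 1 by omega]

theorem loopHom_of_ne (h1 : j ≠ i) (h2 : j ≠ i + 1) (h3 : j + 1 ≠ i) :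
    loopHom κ μ u d y u' d' y' i ξ v' j = 0 := by
  simp [loopHom, h1, h2, h3]

end

theorem isZigzagHom_loop (Z : IsZigzag g κ μ A u d y) (Z' : IsZigzag g κ μ A' u' d' y') {i : ℕ}
    (ξ : V →ₗ[K] K) {v' : W} (hv : v' ∈ A' i) :
    IsZigzagHom A u d y A' u' d' y' (loopHom κ μ u d y u' d' y' i ξ v') where
  mem j x hx := by
    unfold loopHom
    split_ifs with h1 h2 h3
    · subst h1
      exact add_mem (Submodule.smul_mem _ _ hv) (Submodule.smul_mem _ _ (Z'.y_mem _ _ hv))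
    · subst h2
      exact Submodule.smul_mem _ _ (Submodule.smul_mem _ _ (Z'.u_mem _ _ hv))
    · subst h3
      exact Submodule.smul_mem _ _ (Submodule.smul_mem _ _ (Z'.d_mem _ _ hv))
    · exact zero_mem _
  loop j x hx := by
    unfold loopHom
    split_ifs with h1 h2 h3
    · subst h1
      simp [Z.y_y _ _ hx, Z'.y_y _ _ hv]
    · subst h2
      simp [Z.d_y _ _ hx, Z'.y_u _ _ hv]
    · subst h3
      simp [Z.u_y _ _ hx, Z'.y_d _ _ hv]
    · simp
  climb j x hx := by
    by_cases h1 : j = i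
    · subst h1
      rw [loopHom_self, loopHom_next]
      rcases Nat.lt_or_ge j g with h | h
      · simp [Z.d_u j h x hx, Z'.u_y _ _ hv, smul_smul, mul_right_comm, Z.du_ne]
      · simp [Z'.eq_zero (by omega) (Z'.u_mem j _ hv), Z'.u_y _ _ hv]
    by_cases h2 : j = i + 1
    · subst h2
      rw [loopHom_next, loopHom_of_ne (by omega) (by omega) (by omega)]
      simp [Z'.u_u _ _ hv]
    by_cases h3 : j + 1 = i
    · subst h3
      rw [loopHom_self, loopHom_prev]
      simp [Z.y_u _ _ hx, Z'.u_d _ _ hv, smul_smul, Z.ud_ne]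
    rw [loopHom_of_ne h1 h2 h3]
    by_cases h4 : j + 2 = i
    · subst h4
      rw [loopHom_prev (j := j + 1)]
      simp [Z.u_u _ _ hx]
    · rw [loopHom_of_ne (by omega) (by omega) (by omega)]
      simp
  descend j x hx := by
    by_cases h1 : j = i
    · subst h1
      rw [loopHom_self, loopHom_next]
      rcases Nat.lt_or_ge j g with h | h
      · simp [Z'.d_u j h _ hv, Z.y_d _ _ hx, smul_smul, Z.du_ne]
      · simp [Z.eq_zero (by omega) hx]
    by_cases h2 : j = i + 1
    · subst h2
      rw [loopHom_next, loopHom_of_ne (by omega) (by omega) (by omega)]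
      simp [Z.d_d _ _ hx]
    by_cases h3 : j + 1 = i
    · subst h3
      rw [loopHom_self, loopHom_prev]
      simp [Z.u_d _ _ hx, Z'.d_y _ _ hv, smul_smul, mul_right_comm, Z.ud_ne]
    rw [loopHom_of_ne h1 h2 h3]
    by_cases h4 : j + 2 = i
    · subst h4
      rw [loopHom_prev (j := j + 1)]
      simp [Z'.d_d _ _ hv]
    · rw [loopHom_of_ne (by omega) (by omega) (by omega)]
      simp

end IsZigzag

end zigzagHom

/-- The labels of the indecomposable representations in a base block. -/
abbrev BlockLabel (g : ℕ) : Type := Fin (g + 1) ⊕ (Fin g → Bool) × (Fin g → Bool) × Fin (g + 1)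

/-- The zigzag of a base block has a direct summand of the given shape. -/
def HasLabel {K V : Type*} [Field K] [AddCommGroup V] [Module K V] (q r : K) (g : ℕ)
    (t : ℕ → Module.End K V) : BlockLabel g → Prop
  | .inl i => ∃ v ∈ sortedSpace q r g t i, loop q r t g i v ≠ 0
  | .inr (ε, δ, i) => (∀ j, ∀ v ∈ sortedSpace q r g t j, loop q r t g j v = 0) ∧
      HasString (sortedSpace q r g t) (climb q t g) (descend q t g) (IsBaseBlock.extendBits ε)
        (IsBaseBlock.extendBits δ) g i

namespace IsBaseBlock

variable {K V W : Type*} [Field K] [AddCommGroup V] [Module K V] [AddCommGroup W] [Module K W]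
  {α β q r : K} {g : ℕ} {t : ℕ → Module.End K V} {s : ℕ → Module.End K W}

theorem exists_sortedSpace_ne_bot [Nontrivial V] (B : IsBaseBlock α β q r g t) :
    ∃ j, sortedSpace q r g t j ≠ ⊥ := by
  by_contra! h
  refine bot_ne_top (α := Submodule K V) (B.eq_top_of_bitSpace_le fun b v hv => ?_)
  obtain ⟨w, hw, rfl⟩ := B.exists_transport_eq (show g ≤ g by omega) b hv
  have hw' : w ∈ sortedSpace q r g t (zeros b g) := by
    rwa [sortedSpace_of_le (zeros_le g)]
  rw [h, Submodule.mem_bot] at hw'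
  simp [hw']

theorem exists_hasLabel [Nontrivial V] (B : IsBaseBlock α β q r g t) :
    ∃ l, HasLabel q r g t l := by
  by_cases h : ∃ i, ∃ v ∈ sortedSpace q r g t i, loop q r t g i v ≠ 0
  · obtain ⟨i, v, hv, h⟩ := h
    refine ⟨.inl ⟨i, ?_⟩, v, hv, h⟩
    have := le_of_mem_sortedSpace hv fun hv => h (by rw [hv, map_zero])
    omega
  · push Not at h
    obtain ⟨κ, μ, Z⟩ := B.exists_isZigzag
    obtain ⟨ε, δ, i, hi, hs⟩ := Z.exists_hasString h B.exists_sortedSpace_ne_bot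
    exact ⟨.inr (fun i => ε i, fun i => δ i, ⟨i, by omega⟩), h,
      hs.congr (extendBits_restrict ε) (extendBits_restrict δ)⟩

theorem exists_isZigzag_pair (B : IsBaseBlock α β q r g t) (B' : IsBaseBlock α β q r g s) :
    ∃ κ μ, IsZigzag g κ μ (sortedSpace q r g t) (climb q t g) (descend q t g) (loop q r t g) ∧
      IsZigzag g κ μ (sortedSpace q r g s) (climb q s g) (descend q s g) (loop q r s g) := by
  obtain ⟨κ, μ, Z⟩ := (B.prodMap B').exists_isZigzag
  obtain ⟨_, _, Z1⟩ := B.exists_isZigzag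
  obtain ⟨_, _, Z2⟩ := B'.exists_isZigzag
  have h1 := IsRepHom.inl (n := g + 1) (t := t) (s := s)
  have h2 := IsRepHom.inr (n := g + 1) (t := t) (s := s)
  exact ⟨κ, μ, Z1.of_injective Z LinearMap.inl_injective (fun j v hv => h1.mem_sortedSpace hv)
    h1.climb h1.descend h1.loop, Z2.of_injective Z LinearMap.inr_injective
    (fun j v hv => h2.mem_sortedSpace hv) h2.climb h2.descend h2.loop⟩

theorem exists_hom [FiniteDimensional K V] [FiniteDimensional K W]
    (B : IsBaseBlock α β q r g t) (B' : IsBaseBlock α β q r g s) {l : BlockLabel g}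
    (hl : HasLabel q r g t l) (hl' : HasLabel q r g s l) :
    ∃ (F : V →ₗ[K] W) (G : W →ₗ[K] V), IsRepHom (g + 1) t s F ∧ IsRepHom (g + 1) s t G ∧
      ¬ IsNilpotent (G ∘ₗ F : Module.End K V) := by
  obtain ⟨κ, μ, Z, Z'⟩ := B.exists_isZigzag_pair B'
  suffices h : ∃ f f', IsZigzagHom (sortedSpace q r g t) (climb q t g) (descend q t g)
      (loop q r t g) (sortedSpace q r g s) (climb q s g) (descend q s g) (loop q r s g) f ∧
      IsZigzagHom (sortedSpace q r g s) (climb q s g) (descend q s g) (loop q r s g)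
      (sortedSpace q r g t) (climb q t g) (descend q t g) (loop q r t g) f' ∧
      ∃ j, ∃ v ∈ sortedSpace q r g t j, v ≠ 0 ∧ f' j (f j v) = v by
    obtain ⟨f, f', hf, hf', j, v, hv, h0, h⟩ := h
    obtain ⟨F, hF, hFf⟩ := B.exists_lift B' f hf.mem hf.loop hf.climb hf.descend
    obtain ⟨G, hG, hGf⟩ := B'.exists_lift B f' hf'.mem hf'.loop hf'.climb hf'.descend
    refine ⟨F, G, hF, hG, fun ⟨N, hN⟩ => h0 ?_⟩
    have h1 : Function.IsFixedPt (G ∘ₗ F) v := by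
      rw [Function.IsFixedPt, LinearMap.comp_apply, hFf j v hv, hGf j _ (hf.mem j v hv), h]
    have h2 := h1.iterate N
    rw [Function.IsFixedPt, ← Module.End.coe_pow] at h2
    rw [← h2]
    exact LinearMap.congr_fun hN v
  match l with
  | .inl i =>
    obtain ⟨v, hv, h0⟩ := hl
    obtain ⟨v', hv', h0'⟩ := hl'
    obtain ⟨ξ, hξ⟩ := Module.Projective.exists_dual_eq_one K h0
    obtain ⟨ξ', hξ'⟩ := Module.Projective.exists_dual_eq_one K h0'
    refine ⟨_, _, Z.isZigzagHom_loop Z' ξ hv', Z'.isZigzagHom_loop Z ξ' hv, i, _,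
      Z.y_mem i v hv, h0, ?_⟩
    simp [IsZigzag.loopHom, Z.y_y _ _ hv, Z'.y_y _ _ hv', hξ, hξ']
  | .inr (ε, δ, i) =>
    obtain ⟨hy, v, ξ, hv, hξ, h1⟩ := hl
    obtain ⟨hy', v', ξ', hv', hξ', h1'⟩ := hl'
    refine ⟨_, _, Z.isZigzagHom_string Z' hy hy' hξ hv', Z'.isZigzagHom_string Z hy' hy hξ' hv,
      i, v i, hv.1 i (by omega), fun h => ?_, ?_⟩
    · rw [h, map_zero] at h1
      exact zero_ne_one h1
    · simp [h1, h1']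

theorem exists_equiv [FiniteDimensional K V] [FiniteDimensional K W]
    (B : IsBaseBlock α β q r g t) (B' : IsBaseBlock α β q r g s) {l : BlockLabel g}
    (hl : HasLabel q r g t l) (hl' : HasLabel q r g s l) (h : IsIndecRep (g + 1) t)
    (h' : IsIndecRep (g + 1) s) : ∃ e : V ≃ₗ[K] W, IsRepHom (g + 1) t s e := by
  obtain ⟨F, G, hF, hG, hn⟩ := B.exists_hom B' hl hl'
  exact h.exists_equiv h' hF hG hn

end IsBaseBlock

section central

variable {K R V : Type*} [Field K] [Ring R] [Algebra K R] [AddCommGroup V] [Module K V]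
  {α β q : K} {n : ℕ}

/-- The product of the first `n` Jucys-Murphy elements, shifted by `a`. -/
def jmProd (q : K) (t : ℕ → R) (a : K) : ℕ → R
  | 0 => 1
  | n + 1 => jmProd q t a n * (jucysMurphy q t n - a • 1)

theorem HeckeSystem.commute_gen_jmProd {t : ℕ → R} (H : HeckeSystem α β q n t) (hq : q ≠ 0)
    (a : K) {m i : ℕ} (hm : m ≤ n) (hi : i < n) (him : i ≠ m) :
    Commute (t i) (jmProd q t a m) := by
  have hs {z : R} (h : Commute (t i) z) : Commute (t i) (z - a • 1) :=
    h.sub_right ((Commute.one_right _).smul_right a)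
  induction m using Nat.strong_induction_on with
  | _ m ih =>
  rcases m with _ | m
  · exact Commute.one_right _
  rcases Nat.lt_trichotomy i m with h | h | h
  · exact (ih m (by omega) (by omega) (by omega)).mul_right (hs (H.commute_jm_low h (by omega)))
  · subst h
    rcases i with _ | i
    · exact (Commute.one_right _).mul_right (hs (Commute.refl _))
    · rw [jmProd, jmProd, mul_assoc]
      refine (ih i (by omega) (by omega) (by omega)).mul_right ?_
      have h1 := H.gen_mul_jm_succ hq hi
      have h2 := H.gen_mul_jm hq hi
      have h3 := (H.commute_jm (show i < n by omega) hi).eq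
      have h4 : t (i + 1) * (jucysMurphy q t i * jucysMurphy q t (i + 1)) =
          jucysMurphy q t i * jucysMurphy q t (i + 1) * t (i + 1) := by
        rw [← mul_assoc, h2, sub_mul, mul_assoc, h1, smul_mul_assoc, mul_add, mul_smul_comm,
          add_sub_cancel_right, ← mul_assoc, h3]
      rw [commute_iff_eq]
      have h5 : (jucysMurphy q t i - a • 1) * (jucysMurphy q t (i + 1) - a • 1) =
          jucysMurphy q t i * jucysMurphy q t (i + 1) -
            a • (jucysMurphy q t i + jucysMurphy q t (i + 1)) + (a * a) • (1 : R) := by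
        simp only [sub_mul, mul_sub, smul_mul_assoc, mul_smul_comm, one_mul, mul_one]
        module
      rw [h5]
      simp only [sub_mul, mul_sub, add_mul, mul_add, smul_mul_assoc, mul_smul_comm, one_mul,
        mul_one, h4]
      rw [H.jm_succ_mul_gen hq hi, H.jm_mul_gen hq hi]
      rw [h1, h2, H.jm_succ_mul_gen hq hi, H.jm_mul_gen hq hi, h1]
      module
  · exact (ih m (by omega) (by omega) (by omega)).mul_right
      (hs (H.commute_jm_high (by omega) (by omega)))

theorem jmProd_apply {t : ℕ → Module.End K V} {a : K} {m : ℕ} {v : V} {c : ℕ → K}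
    (h : ∀ k < m, jucysMurphy q t k v = c k • v) :
    jmProd q t a m v = (∏ k ∈ Finset.range m, (c k - a)) • v := by
  induction m with
  | zero => simp [jmProd]
  | succ m ih =>
    rw [jmProd, Module.End.mul_apply, LinearMap.sub_apply, h m (by omega), LinearMap.smul_apply,
      Module.End.one_apply, ← sub_smul, map_smul, ih fun k hk => h k (by omega), smul_smul,
      Finset.prod_range_succ, mul_comm]

/-- On an indecomposable representation all weights involve the same letters. -/
theorem IsIndecRep.exists_eq_weight [FiniteDimensional K V] {t : ℕ → Module.End K V}
    (h : IsIndecRep n t) (H : HeckeSystem α β q n t) (hq : q ≠ 0) {v w : V} (hv : v ≠ 0)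
    (hw : w ≠ 0) {c d : ℕ → K} (hc : ∀ k < n, jucysMurphy q t k v = c k • v)
    (hd : ∀ k < n, jucysMurphy q t k w = d k • w) {i : ℕ} (hi : i < n) :
    ∃ k < n, d k = c i := by
  have hZ : IsRepHom n t t (jmProd q t (c i) n) :=
    IsRepHom.iff_commute.2 fun j hj => H.commute_gen_jmProd hq _ le_rfl hj hj.ne
  have h0 : jmProd q t (c i) n v = 0 := by
    rw [jmProd_apply hc, Finset.prod_eq_zero (Finset.mem_range.2 hi) (sub_self _), zero_smul]
  have hnil : IsNilpotent (jmProd q t (c i) n) := by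
    refine (h.isNilpotent_or_isUnit hZ).resolve_right fun hu => hv ?_
    have := (LinearMap.isUnit_iff_ker_eq_bot _).1 hu
    exact (Submodule.mem_bot K).1 (this ▸ LinearMap.mem_ker.2 h0)
  obtain ⟨N, hN⟩ := hnil
  have hpow (m : ℕ) : (jmProd q t (c i) n ^ m) w =
      (∏ k ∈ Finset.range n, (d k - c i)) ^ m • w := by
    induction m with
    | zero => simp
    | succ m ih => rw [pow_succ', Module.End.mul_apply, ih, map_smul, jmProd_apply hd, smul_smul,
        pow_succ]
  have h1 := hpow N
  rw [hN, LinearMap.zero_apply] at h1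
  have h3 := eq_zero_of_pow_eq_zero ((smul_eq_zero.1 h1.symm).resolve_right hw)
  obtain ⟨k, hk, h4⟩ := Finset.prod_eq_zero_iff.1 h3
  exact ⟨k, Finset.mem_range.1 hk, sub_eq_zero.1 h4⟩

end central

namespace HeckeRep

variable {K : Type} [Field K] {q : K} {n f : ℕ}

theorem exists_isBaseBlock (hq : q ≠ 0) (he : ∀ k, 0 < k → q ^ k = 1 → n + 1 < k ∧ 2 * f ≤ k)
    (h2 : q ^ 2 ≠ 1) (hnf : n + 1 < 2 * f + 4) (M : HeckeRep K 1 (q ^ f) q (n + 1))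
    (hM : IsIndecRep (n + 1) M.t)
    (hnil : ∀ j, IsNilpotent (jmTrace 1 (q ^ f) q M.t (n + 1) (jucysMurphy q M.t n ^ j))) :
    ∃ b : Bool, IsBaseBlock 1 (q ^ f) q (if b then 1 else q ^ f) n M.t := by
  classical
  have hqf : q ^ f ≠ 0 := pow_ne_zero f hq
  have hV := hM.1
  obtain ⟨v, -, hv, c, hc⟩ := M.sys.exists_weight_vector hq one_ne_zero hqf ⊤ top_ne_bot
    fun _ _ _ _ => trivial
  have hcv : ∀ k < n + 1, jucysMurphy q M.t k v = c k • v := fun k hk => (hc k hk).2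
  have hid := M.sys.weight_series_identity hq (by rwa [one_mul]) hnil hv hcv
  obtain ⟨r, g, hg, hr, hinj, hmem⟩ := weights_eq_run hq he (Nat.succ_pos n) hnf
    (fun k hk => (hc k hk).1) fun y hy => by
      simpa only [eq_comm (a := y)] using weight_count hq hid y hy
  obtain rfl : n = g := by omega
  have key (w : M.V) (hw : w ≠ 0) (d : ℕ → K) (hd : ∀ k < n + 1, jucysMurphy q M.t k w = d k • w) :
      (Finset.range (n + 1)).image d = (Finset.range (n + 1)).image c := by
    symm
    refine Finset.eq_of_subset_of_card_le (fun a ha => ?_) ?_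
    · obtain ⟨i, hi, rfl⟩ := Finset.mem_image.1 ha
      obtain ⟨k, hk, e⟩ := hM.exists_eq_weight M.sys hq hv hw hcv hd (Finset.mem_range.1 hi)
      exact Finset.mem_image.2 ⟨k, Finset.mem_range.2 hk, e⟩
    · rw [Finset.card_image_of_injOn hinj]
      exact Finset.card_image_le
  have hB : IsBaseBlock 1 (q ^ f) q r n M.t :=
    { sys := M.sys
      q_ne := hq
      r_ne := by rcases hr with ⟨rfl, -⟩ | ⟨rfl, -⟩ <;> simp [hqf]
      ends := by
        rcases hr with ⟨h, h'⟩ | ⟨h, h'⟩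
        · exact .inl ⟨h.symm, h'.symm⟩
        · exact .inr ⟨h.symm, h'.symm⟩
      pow_ne := fun k hk hk' h => by have := (he k hk h).1; omega
      sq_ne := h2
      inj := fun w hw d hd => by
        rw [← Finset.card_image_iff, key w hw d hd, Finset.card_image_of_injOn hinj]
      mem := fun w hw d hd k hk => by
        have h1 : d k ∈ (Finset.range (n + 1)).image d :=
          Finset.mem_image_of_mem d (Finset.mem_range.2 hk)
        rw [key w hw d hd] at h1
        obtain ⟨i, hi, e⟩ := Finset.mem_image.1 h1
        rw [← e]
        exact hmem i (Finset.mem_range.1 hi) }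
  rcases hr with ⟨rfl, -⟩ | ⟨rfl, -⟩
  · exact ⟨true, hB⟩
  · exact ⟨false, hB⟩

end HeckeRep

namespace FiniteType

variable {K : Type} [Field K] {q : K} {n f : ℕ}

theorem zero (α β q : K) : FiniteType K α β q 0 := by
  refine ⟨Unit, inferInstance, fun _ => ⟨K, 0, ⟨by omega, by omega, by omega, by omega, by omega⟩⟩,
    fun M hM => ⟨(), ?_⟩⟩
  have hV := hM.1
  obtain ⟨v, hv⟩ := exists_ne (0 : M.V)
  obtain ⟨ξ, hξ⟩ := Module.Projective.exists_dual_eq_one K hv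
  have h1 : ξ.smulRight v = 1 := by
    refine (hM.2 (ξ.smulRight v) (fun _ hi => absurd hi (by omega)) ?_).resolve_left fun h => hv ?_
    · ext w
      simp [hξ]
    · simpa [hξ] using LinearMap.congr_fun h v
  refine ⟨LinearEquiv.ofLinearMap ξ (LinearMap.toSpanSingleton K M.V v) ?_ ?_,
    fun _ hi => absurd hi (by omega)⟩
  · ext
    simp [hξ]
  · ext w
    simpa using LinearMap.congr_fun h1 w

theorem succ (hq : q ≠ 0) (he : ∀ k, 0 < k → q ^ k = 1 → n + 1 < k ∧ 2 * f ≤ k)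
    (h2 : q ^ 2 ≠ 1) (hnf : n + 1 < 2 * f + 4) (h : FiniteType K 1 (q ^ f) q n) :
    FiniteType K 1 (q ^ f) q (n + 1) := by
  obtain ⟨ι, hι, L, hL⟩ := HeckeRep.exists_of_trace hq (by rw [one_mul]; exact pow_ne_zero f hq) h
  let p (x : Bool × BlockLabel n) (M : HeckeRep K 1 (q ^ f) q (n + 1)) : Prop :=
    IsIndecRep (n + 1) M.t ∧ IsBaseBlock 1 (q ^ f) q (if x.1 then 1 else q ^ f) n M.t ∧
      HasLabel q (if x.1 then 1 else q ^ f) n M.t x.2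
  choose L' hL' using fun x : {x // ∃ M, p x M} => x.2
  refine ⟨ι ⊕ {x // ∃ M, p x M}, inferInstance, Sum.elim L L', fun M hM => ?_⟩
  by_cases hnil : ∀ j, IsNilpotent (jmTrace 1 (q ^ f) q M.t (n + 1) (jucysMurphy q M.t n ^ j))
  · obtain ⟨b, hB⟩ := HeckeRep.exists_isBaseBlock hq he h2 hnf M hM hnil
    have hV := hM.1
    obtain ⟨l, hl⟩ := hB.exists_hasLabel
    have hp : ∃ M, p (b, l) M := ⟨M, hM, hB, hl⟩
    obtain ⟨h1, h2, h3⟩ := hL' ⟨(b, l), hp⟩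
    exact ⟨.inr ⟨(b, l), hp⟩, hB.exists_equiv h2 hl h3 hM h1⟩
  · push Not at hnil
    obtain ⟨j, hj⟩ := hnil
    obtain ⟨i, hi⟩ := hL M hM _ ((IsRepHom.iff_commute.2 fun i hi =>
      M.sys.commute_jm_low hi (Nat.lt_succ_self n)).pow j) hj
    exact ⟨.inl i, hi⟩

theorem of_lt (hq : q ≠ 0) (he : ∀ k, 0 < k → q ^ k = 1 → n < k ∧ 2 * f ≤ k)
    (h2 : q ^ 2 ≠ 1) (hnf : n < 2 * f + 4) : FiniteType K 1 (q ^ f) q n := by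
  induction n with
  | zero => exact zero ..
  | succ n ih =>
    exact succ hq he h2 hnf (ih (fun k hk h => ⟨by have := (he k hk h).1; omega, (he k hk h).2⟩)
      (by omega))

end FiniteType

open MulOpposite in
theorem HeckeSystem.op {K R : Type*} [Field K] [Ring R] [Algebra K R] {α β q : K} {n : ℕ}
    {t : ℕ → R} (H : HeckeSystem α β q n t) : HeckeSystem α β q n fun i => op (t i) where
  quad_zero h := unop_injective <| by
    have hc : Commute (t 0 - algebraMap K R α) (t 0 - algebraMap K R β) := by
      refine Commute.sub_left (.sub_right (.refl _) (Algebra.commute_algebraMap_right ..))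
        (.sub_right (Algebra.commute_algebraMap_left ..) (Algebra.commute_algebraMap_left ..))
    simpa using hc.eq ▸ H.quad_zero h
  quad i h h' := unop_injective <| by
    have hc : Commute (t i + 1) (t i - algebraMap K R q) :=
      Commute.add_left (.sub_right (.refl _) (Algebra.commute_algebraMap_right ..)) (.one_left _)
    simpa using hc.eq ▸ H.quad i h h'
  braid_zero h := unop_injective <| by simpa [mul_assoc] using (H.braid_zero h).symm
  braid i h h' := unop_injective <| by simpa [mul_assoc] using H.braid i h h'
  comm i j h h' := unop_injective <| by simpa using (H.comm i j h h').symm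

namespace FDRightModule

open MulOpposite

variable {K : Type} [Field K] {α β q : K} {n : ℕ}

/-- A right module over the Hecke algebra as a representation of the generators. -/
noncomputable def toHeckeRep (M : FDRightModule K (HeckeB K α β q n)) : HeckeRep K α β q n where
  V := M.carrier
  t i := Algebra.lsmul K K M.carrier (op (heckeGen K α β q n i))
  sys := heckeGen_system.op.map (Algebra.lsmul K K M.carrier)

theorem map_smul_of_isRepHom {M N : FDRightModule K (HeckeB K α β q n)}
    {φ : M.carrier →ₗ[K] N.carrier} (hφ : IsRepHom n M.toHeckeRep.t N.toHeckeRep.t φ)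
    (a : (HeckeB K α β q n)ᵐᵒᵖ) (v : M.carrier) : φ (a • v) = a • φ v := by
  obtain ⟨a, rfl⟩ := op_surjective a
  induction a using heckeGen_induction generalizing v with
  | h0 r =>
    rw [← MulOpposite.algebraMap_apply, algebraMap_smul, algebraMap_smul, map_smul]
  | hadd a b ha hb => rw [op_add, add_smul, map_add, ha, hb, add_smul]
  | hmul a b ha hb => rw [op_mul, mul_smul, hb, ha, mul_smul]
  | hgen i hi => exact hφ i hi v

theorem isIndecRep_toHeckeRep {M : FDRightModule K (HeckeB K α β q n)}
    (hM : IsIndecomposableModule (HeckeB K α β q n)ᵐᵒᵖ M.carrier) :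
    IsIndecRep n M.toHeckeRep.t := by
  refine ⟨hM.1, fun p hp hpp => ?_⟩
  let P : M.carrier →ₗ[(HeckeB K α β q n)ᵐᵒᵖ] M.carrier :=
    { toFun := p, map_add' := map_add p, map_smul' := map_smul_of_isRepHom hp }
  have hP : IsIdempotentElem P := LinearMap.ext fun v => LinearMap.congr_fun hpp v
  rcases hM.2 _ _ (LinearMap.IsIdempotentElem.isCompl hP) with h | h
  · left
    exact LinearMap.ext fun v => LinearMap.congr_fun (LinearMap.range_eq_bot.1 h) v
  · right
    refine LinearMap.ext fun v => LinearMap.ker_eq_bot.1 h ?_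
    exact LinearMap.congr_fun hpp v

theorem nonempty_linearEquiv {M N : FDRightModule K (HeckeB K α β q n)}
    (h : M.toHeckeRep.Iso N.toHeckeRep) :
    Nonempty (M.carrier ≃ₗ[(HeckeB K α β q n)ᵐᵒᵖ] N.carrier) := by
  obtain ⟨e, he⟩ := h
  exact ⟨{ (show M.carrier ≃+ N.carrier from e.toAddEquiv) with
    map_smul' := map_smul_of_isRepHom he }⟩

end FDRightModule

theorem FiniteType.hasFiniteRepresentationType {K : Type} [Field K] {α β q : K} {n : ℕ}
    (h : FiniteType K α β q n) : HasFiniteRepresentationType K (HeckeB K α β q n) := by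
  obtain ⟨ι, _, L, hL⟩ := h
  choose F hF using fun M : {M : FDRightModule K (HeckeB K α β q n) //
    IsIndecomposableModule (HeckeB K α β q n)ᵐᵒᵖ M.carrier} =>
      hL M.1.toHeckeRep (FDRightModule.isIndecRep_toHeckeRep M.2)
  refine Finite.of_injective (fun x => F x.out) fun x y hxy => ?_
  rw [← x.out_eq, ← y.out_eq]
  refine Quot.sound (FDRightModule.nonempty_linearEquiv ((hF x.out).trans ?_))
  simp only [hxy]
  exact (hF y.out).symm

theorem heckeB_finite_representation_type_of_lt
    (K : Type) [Field K] (q : K) (hq : q ≠ 0) (he : 3 ≤ multOrder q)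
    (f : ℕ) (hf : ((2 * f : ℕ) : ℕ∞) ≤ multOrder q) (n : ℕ) (hn : 1 ≤ n)
    (hne : (n : ℕ∞) < multOrder q) (hnf : n < 2 * f + 4) :
    HasFiniteRepresentationType K (HeckeB K 1 (q ^ f) q n) := by
  have key (k m : ℕ) (hk : 0 < k) (h : q ^ k = 1) (hm : (m : ℕ∞) ≤ multOrder q) : m ≤ k := by
    have h1 : 0 < orderOf q := orderOf_pos_iff.2 (isOfFinOrder_iff_pow_eq_one.2 ⟨k, hk, h⟩)
    rw [multOrder, if_neg h1.ne', Nat.cast_le] at hm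
    exact hm.trans (orderOf_le_of_pow_eq_one hk h)
  refine (FiniteType.of_lt hq (fun k hk h => ⟨?_, key k _ hk h hf⟩)
    (fun h => absurd (key 2 3 two_pos h he) (by norm_num)) hnf).hasFiniteRepresentationType
  exact key k (n + 1) hk h (by exact_mod_cast Order.add_one_le_of_lt hne)
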